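/- arXiv:2605.02514 — 3 statements merged into one kernel-verified Lean document; each statement's English description precedes it below -/
import Mathlib

section
/- Two graphons U, W on ([0,1], λ) are weakly isomorphic (t(F, U) = t(F, W) for every finite simple graph F) if and only if their cut distance is zero, δ_□(U, W) = 0. -/
open MeasureTheory unitInterval Filter
open scoped Classical unitInterval Topology

/-- The homomorphism density `t(F, W)` of a finite simple graph `F` (on vertex set `Fin m`)
in a kernel `W : Ω → Ω → ℝ` with respect to a measure `μ`. -/
noncomputable def homDensity {Ω : Type*} [MeasurableSpace Ω] (μ : Measure Ω)
    (W : Ω → Ω → ℝ) {m : ℕ} (G : SimpleGraph (Fin m)) : ℝ :=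
  ∫ x : Fin m → Ω,
    ∏ p ∈ Finset.univ.filter (fun p : Fin m × Fin m => p.1 < p.2 ∧ G.Adj p.1 p.2),
      W (x p.1) (x p.2) ∂(Measure.pi fun _ : Fin m => μ)

/-- `W` is a graphon: a symmetric measurable function with values in `[0,1]`. -/
def IsGraphon {Ω : Type*} [MeasurableSpace Ω] (W : Ω → Ω → ℝ) : Prop :=
  Measurable (Function.uncurry W) ∧ (∀ x y, W x y = W y x) ∧
    ∀ x y, W x y ∈ Set.Icc (0 : ℝ) 1

/-- The cut norm of a kernel on the unit interval. -/
noncomputable def cutNorm (U : I → I → ℝ) : ℝ :=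
  sSup {r : ℝ | ∃ f g : I → ℝ, Measurable f ∧ Measurable g ∧
    (∀ x, |f x| ≤ 1) ∧ (∀ x, |g x| ≤ 1) ∧
    r = |∫ p : I × I, U p.1 p.2 * f p.1 * g p.2
          ∂((volume : Measure I).prod (volume : Measure I))|}

/-- The cut metric `δ_□` on kernels on the unit interval: the infimum of the cut norm of
`U - W ∘ (φ × φ)` over all measure-preserving maps `φ : [0,1] → [0,1]`. -/
noncomputable def cutDist (U W : I → I → ℝ) : ℝ :=
  sInf {r : ℝ | ∃ φ : I → I, MeasurePreserving φ (volume : Measure I) (volume : Measure I) ∧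
    r = cutNorm (fun x y => U x y - W (φ x) (φ y))}

lemma gr_exists_map_uniform (μ : Measure I) [IsProbabilityMeasure μ] (h : ∀ x, μ {x} = 0) :
    ∃ g : I → I, Measurable g ∧ μ.map g = volume := by
  have hle : ∀ x : I, μ.real (Set.Iic x) ∈ Set.Icc (0:ℝ) 1 := fun x =>
    ⟨measureReal_nonneg, measureReal_le_one⟩
  let g : I → I := fun x => ⟨μ.real (Set.Iic x), hle x⟩
  have hmono : Monotone g := fun x y hxy => by
    apply Subtype.mk_le_mk.2
    exact measureReal_mono (Set.Iic_subset_Iic.2 hxy)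
  have hcont : Continuous g := by
    apply Continuous.subtype_mk
    have : (fun x : I => μ.real (Set.Iic x)) =
        fun x => ∫ y, (Set.Iic x).indicator (fun _ => (1:ℝ)) y ∂μ := by
      ext x
      rw [integral_indicator_const _ measurableSet_Iic]; simp
    rw [this, continuous_iff_continuousAt]
    intro x0
    apply continuousAt_of_dominated (bound := fun _ => 1)
    · exact Eventually.of_forall fun x => (measurable_const.indicator measurableSet_Iic).aestronglyMeasurable
    · refine Eventually.of_forall fun x => Eventually.of_forall fun y => ?_
      by_cases hy : y ∈ Set.Iic x <;> simp [hy]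
    · exact integrable_const _
    · have : ∀ᵐ y ∂μ, y ≠ x0 := by
        rw [ae_iff]; simpa using h x0
      filter_upwards [this] with y hy
      rcases lt_or_gt_of_ne hy with hlt | hgt
      · apply ContinuousAt.congr (f := fun _ => (1:ℝ)) continuousAt_const
        filter_upwards [lt_mem_nhds hlt] with x hx
        simp [hx.le]
      · apply ContinuousAt.congr (f := fun _ => (0:ℝ)) continuousAt_const
        filter_upwards [gt_mem_nhds hgt] with x hx
        simp [hx]
  have hg0 : g 0 = 0 := by
    apply Subtype.ext
    have : Set.Iic (0:I) = {0} := by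
      ext x; simp
    simp [g, this, Measure.real, h]
  have hg1 : g 1 = 1 := by
    apply Subtype.ext
    have : Set.Iic (1:I) = Set.univ := by
      ext x; simp only [Set.mem_Iic, Set.mem_univ, iff_true]; exact x.2.2
    simp [g, this]
  have hsurj : ∀ t : I, ∃ s, g s = t := by
    intro t
    have := intermediate_value_Icc (a := (0:I)) (b := 1) zero_le_one hcont.continuousOn
    rw [hg0, hg1] at this
    obtain ⟨s, _, hs⟩ := this ⟨t.2.1, t.2.2⟩
    exact ⟨s, hs⟩
  have hgs : ∀ s, μ (Set.Iic s) = ENNReal.ofReal (g s) := by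
    intro s; simp [g]
  have hvol : ∀ t : I, (volume : Measure I) (Set.Iic t) = ENNReal.ofReal t := by
    intro t
    simp
  refine ⟨g, hcont.measurable, ?_⟩
  have : IsProbabilityMeasure (μ.map g) := Measure.isProbabilityMeasure_map hcont.measurable.aemeasurable
  apply Measure.ext_of_Iic
  intro t
  rw [Measure.map_apply hcont.measurable measurableSet_Iic, hvol]
  obtain ⟨s, rfl⟩ := hsurj t
  apply le_antisymm
  · by_cases ht : g s = 1
    · rw [ht]; simpa using prob_le_one
    have hlt : ((g s : I):ℝ) < 1 := lt_of_le_of_ne (g s).2.2 (fun h => ht (Subtype.ext h))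
    refine le_of_forall_gt_imp_ge_of_dense ?_
    intro r hr
    by_cases hr1 : 1 ≤ r
    · exact prob_le_one.trans hr1
    push Not at hr1
    have hrt : r ≠ ⊤ := (hr1.trans ENNReal.one_lt_top).ne
    lift r to NNReal using hrt
    obtain ⟨s', hs'⟩ := hsurj ⟨r, r.2, by exact_mod_cast hr1.le⟩
    have h2 : (r : ENNReal) = ENNReal.ofReal (g s') := by rw [hs']; simp
    rw [h2] at hr ⊢
    rw [← hgs s']
    apply measure_mono
    intro x hx
    by_contra hxs
    have h3 : g s' ≤ g x := hmono (not_le.1 hxs).le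
    have h4 : g x ≤ g s := hx
    have h5 : g s' ≤ g s := h3.trans h4
    exact absurd hr (not_lt.2 (ENNReal.ofReal_le_ofReal h5))
  · rw [← hgs s]
    exact measure_mono fun x hx => hmono hx

lemma gr_coupling (p q : I → ℕ) (hp : Measurable p) (hq : Measurable q)
    (hpq : (volume : Measure I).map p = (volume : Measure I).map q) :
    ∃ φ : I → I, MeasurePreserving φ (volume : Measure I) volume ∧
      ∀ᵐ x ∂(volume : Measure I), q (φ x) = p x := by
  have hvol : ∀ n : ℕ, (volume : Measure I) (p ⁻¹' {n}) = volume (q ⁻¹' {n}) := by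
    intro n
    rw [← Measure.map_apply hp (by measurability), hpq, Measure.map_apply hq (by measurability)]
  have hpm : ∀ n, MeasurableSet (p ⁻¹' {n}) := fun n => hp (by measurability)
  have hqm : ∀ n, MeasurableSet (q ⁻¹' {n}) := fun n => hq (by measurability)
  let κf : ℕ → Measure I := fun n =>
    if volume (q ⁻¹' {n}) = 0 then (volume : Measure I)
      else ProbabilityTheory.cond (volume : Measure I) (q ⁻¹' {n})
  let κ : ProbabilityTheory.Kernel ℕ I := ⟨κf, measurable_from_nat⟩
  have hκ : ProbabilityTheory.IsMarkovKernel κ := by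
    refine ⟨fun n => ?_⟩
    change IsProbabilityMeasure (κf n)
    by_cases h0 : (volume : Measure I) (q ⁻¹' {n}) = 0
    · simp only [κf, h0, if_true]; infer_instance
    · simp only [κf, h0, if_false]
      exact ProbabilityTheory.cond_isProbabilityMeasure h0
  obtain ⟨f, hf, hfm⟩ := ProbabilityTheory.Kernel.exists_measurable_map_eq_unitInterval κ
  have hg : ∀ n : ℕ, ∃ g : I → I, Measurable g ∧ (volume (p ⁻¹' {n}) ≠ 0 →
      (ProbabilityTheory.cond (volume : Measure I) (p ⁻¹' {n})).map g = volume) := by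
    intro n
    by_cases h0 : (volume : Measure I) (p ⁻¹' {n}) = 0
    · exact ⟨id, measurable_id, fun h => absurd h0 h⟩
    · have := ProbabilityTheory.cond_isProbabilityMeasure (μ := (volume : Measure I)) h0
      obtain ⟨g, h1, h2⟩ := gr_exists_map_uniform
        (ProbabilityTheory.cond (volume : Measure I) (p ⁻¹' {n})) (fun x => by
          exact ProbabilityTheory.cond_absolutelyContinuous (measure_singleton x))
      exact ⟨g, h1, fun _ => h2⟩
  choose g hgm hgmap using hg
  let φ : I → I := fun x => f (p x) (g (p x) x)
  have hgg : Measurable (fun y : ℕ × I => g y.1 y.2) := measurable_from_prod_countable_right hgm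
  have hφ : Measurable φ := by
    have h1 : Measurable (fun x => g (p x) x) := hgg.comp (hp.prodMk measurable_id)
    exact hf.comp (hp.prodMk h1)
  have key : ∀ (n : ℕ) (s : Set I), MeasurableSet s →
      volume (p ⁻¹' {n} ∩ φ ⁻¹' s) = volume (q ⁻¹' {n} ∩ s) := by
    intro n s hs
    by_cases h0 : (volume : Measure I) (p ⁻¹' {n}) = 0
    · rw [measure_mono_null Set.inter_subset_left h0,
        measure_mono_null Set.inter_subset_left (hvol n ▸ h0)]
    · have h0' : (volume : Measure I) (q ⁻¹' {n}) ≠ 0 := hvol n ▸ h0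
      have hfn : Measurable (f n) := hf.comp (measurable_const.prodMk measurable_id)
      have e1 : p ⁻¹' {n} ∩ φ ⁻¹' s = p ⁻¹' {n} ∩ (g n) ⁻¹' (f n ⁻¹' s) := by
        ext x
        simp only [Set.mem_inter_iff, Set.mem_preimage, Set.mem_singleton_iff, φ]
        constructor <;> rintro ⟨rfl, h⟩ <;> exact ⟨rfl, h⟩
      rw [e1, ← ProbabilityTheory.cond_mul_eq_inter (hpm n) , ← Measure.map_apply (hgm n) (hfn hs),
        hgmap n h0, ← Measure.map_apply hfn hs, hfm n,
        ← ProbabilityTheory.cond_mul_eq_inter (hqm n), hvol n]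
      congr 1
      change κf n s = _
      simp only [κf, h0', if_false]
  have hsum : ∀ (r : I → ℕ), Measurable r → ∀ s : Set I, MeasurableSet s →
      (volume : Measure I) s = ∑' n, volume (r ⁻¹' {n} ∩ s) := by
    intro r hr s hs
    rw [← measure_iUnion]
    · congr 1; ext x; simp
    · intro i j hij
      refine Set.disjoint_left.2 ?_
      rintro x ⟨h1, _⟩ ⟨h2, _⟩
      exact hij (h1.symm.trans h2)
    · intro n; exact (hr (by measurability)).inter hs
  refine ⟨φ, ⟨hφ, ?_⟩, ?_⟩
  · ext s hs
    rw [Measure.map_apply hφ hs, hsum p hp _ (hφ hs), hsum q hq _ hs]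
    exact tsum_congr fun n => key n s hs
  · have : ∀ n : ℕ, ∀ᵐ x ∂(volume : Measure I), p x = n → q (φ x) = n := by
      intro n
      rw [ae_iff]
      have := key n (q ⁻¹' {n})ᶜ (hqm n).compl
      rw [Set.inter_compl_self, measure_empty] at this
      rw [← this]
      congr 1
      ext x
      simp
    filter_upwards [ae_all_iff.2 this] with x hx
    exact hx _ rfl

lemma gr_measure_ext {E J : Type*} [TopologicalSpace E] [PolishSpace E] [MeasurableSpace E]
    [BorelSpace E] (μ ν : Measure E) [IsFiniteMeasure μ] [IsFiniteMeasure ν]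
    (c : J → E → I) (hc : ∀ j, Continuous (c j))
    (hsep : ∀ x y, (∀ j, c j x = c j y) → x = y)
    (h : ∀ l : List J, ∫ x, (l.map fun j => (c j x : ℝ)).prod ∂μ
      = ∫ x, (l.map fun j => (c j x : ℝ)).prod ∂ν) : μ = ν := by
  let cb : J → BoundedContinuousFunction E ℝ := fun j =>
    BoundedContinuousFunction.ofNormedAddCommGroup (fun x => (c j x : ℝ))
      (continuous_subtype_val.comp (hc j)) 1 (fun x => by
        rw [Real.norm_eq_abs, abs_of_nonneg (c j x).2.1]; exact (c j x).2.2)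
  let A : StarSubalgebra ℝ (BoundedContinuousFunction E ℝ) :=
    { Algebra.adjoin ℝ (Set.range cb) with
      star_mem' := by
        intro a ha
        have : star a = a := by ext x; simp
        rw [this]; exact ha }
  have hlist : ∀ (l : List J) (x : E), (l.map cb).prod x = (l.map fun j => (c j x : ℝ)).prod := by
    intro l x
    induction l with
    | nil => simp
    | cons j l ih => 
      simp only [List.map_cons, List.prod_cons, BoundedContinuousFunction.coe_mul, Pi.mul_apply, ih]
      rfl
  have hspan : ∀ g ∈ A, g ∈ Submodule.span ℝ (Submonoid.closure (Set.range cb) : Set (BoundedContinuousFunction E ℝ)) := by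
    intro g hg
    rw [← Algebra.adjoin_eq_span]
    exact hg
  refine ext_of_forall_mem_subalgebra_integral_eq_of_polish (𝕜 := ℝ) (A := A) ?_ ?_
  · intro x y hxy
    have : ∃ j, c j x ≠ c j y := by
      by_contra hcon
      push Not at hcon
      exact hxy (hsep x y hcon)
    obtain ⟨j, hj⟩ := this
    refine ⟨cb j, ⟨(cb j).toContinuousMap, ?_, rfl⟩, fun h => hj (Subtype.ext h)⟩
    refine ⟨cb j, ?_, rfl⟩
    exact Algebra.subset_adjoin ⟨j, rfl⟩
  · intro g hg
    have := hspan g hg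
    induction this using Submodule.span_induction with
    | mem x hx =>
      obtain ⟨l, hl, rfl⟩ := Submonoid.exists_list_of_mem_closure hx
      obtain ⟨l', rfl⟩ : ∃ l' : List J, l = l'.map cb := by
        clear hx
        clear hg
        induction l with
        | nil => exact ⟨[], rfl⟩
        | cons a l ih =>
          obtain ⟨l', hl'⟩ := ih (fun y hy => hl y (List.mem_cons_of_mem _ hy))
          obtain ⟨j, hj⟩ := hl a List.mem_cons_self
          exact ⟨j :: l', by simp [hl', hj]⟩
      simp only [hlist]
      exact h l'
    | zero => simp
    | add x y hx hy h1 h2 =>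
      have hx' : x ∈ A := by
        have := Algebra.adjoin_eq_span ℝ (Set.range cb) ▸ hx
        exact this
      have hy' : y ∈ A := by
        have := Algebra.adjoin_eq_span ℝ (Set.range cb) ▸ hy
        exact this
      simp only [BoundedContinuousFunction.coe_add, Pi.add_apply]
      rw [integral_add (x.integrable μ) (y.integrable μ), integral_add (x.integrable ν) (y.integrable ν), h1 hx', h2 hy']
    | smul r x hx h1 =>
      have hx' : x ∈ A := by
        have := Algebra.adjoin_eq_span ℝ (Set.range cb) ▸ hx
        exact this
      simp only [BoundedContinuousFunction.coe_smul]
      rw [integral_smul, integral_smul, h1 hx']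

lemma gr_bdd_integrable {Ω : Type*} [MeasurableSpace Ω] {μ : Measure Ω} [IsFiniteMeasure μ]
    {f : Ω → ℝ} (hf : Measurable f) (C : ℝ) (h : ∀ x, |f x| ≤ C) : Integrable f μ :=
  Integrable.of_bound hf.aestronglyMeasurable C (Eventually.of_forall h)

lemma gr_meas2 {Ω : Type*} [MeasurableSpace Ω] {U : I → I → ℝ} (hU : Measurable (Function.uncurry U))
    {f g : Ω → I} (hf : Measurable f) (hg : Measurable g) : Measurable (fun x => U (f x) (g x)) :=
  hU.comp (hf.prodMk hg)

lemma gr_cutNorm_nonneg (D : I → I → ℝ) : 0 ≤ cutNorm D := by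
  apply Real.sSup_nonneg
  rintro r ⟨f, g, _, _, _, _, rfl⟩
  exact abs_nonneg _

lemma gr_cutNorm_bdd (D : I → I → ℝ) (C : ℝ) (hC : ∀ x y, |D x y| ≤ C) :
    BddAbove {r : ℝ | ∃ f g : I → ℝ, Measurable f ∧ Measurable g ∧
    (∀ x, |f x| ≤ 1) ∧ (∀ x, |g x| ≤ 1) ∧
    r = |∫ p : I × I, D p.1 p.2 * f p.1 * g p.2
          ∂((volume : Measure I).prod (volume : Measure I))|} := by
  refine ⟨C, ?_⟩
  rintro r ⟨f, g, hf, hg, hf1, hg1, rfl⟩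
  have := norm_integral_le_of_norm_le_const (μ := (volume : Measure I).prod (volume : Measure I))
    (f := fun p : I × I => D p.1 p.2 * f p.1 * g p.2) (C := C) (Eventually.of_forall fun p => by
      rw [Real.norm_eq_abs, abs_mul, abs_mul]
      have h0 := hC p.1 p.2
      have h1 := hf1 p.1
      have h2 := hg1 p.2
      have : |D p.1 p.2| * |f p.1| * |g p.2| ≤ C * 1 * 1 := by
        have hC0 := (abs_nonneg _).trans h0
        gcongr
      linarith)
  simpa using this

lemma gr_le_cutNorm (D : I → I → ℝ) (C : ℝ) (hC : ∀ x y, |D x y| ≤ C) (f g : I → ℝ)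
    (hf : Measurable f) (hg : Measurable g) (hf1 : ∀ x, |f x| ≤ 1) (hg1 : ∀ x, |g x| ≤ 1) :
    |∫ p : I × I, D p.1 p.2 * f p.1 * g p.2
          ∂((volume : Measure I).prod (volume : Measure I))| ≤ cutNorm D :=
  le_csSup (gr_cutNorm_bdd D C hC) ⟨f, g, hf, hg, hf1, hg1, rfl⟩

lemma gr_update_mp {m : ℕ} (i : Fin m) :
    MeasurePreserving (fun q : (Fin m → I) × I => Function.update q.1 i q.2)
      ((Measure.pi fun _ : Fin m => (volume : Measure I)).prod (volume : Measure I))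
      (Measure.pi fun _ : Fin m => (volume : Measure I)) := by
  have hm : Measurable (fun q : (Fin m → I) × I => Function.update q.1 i q.2) := by
    rw [measurable_pi_iff]
    intro j
    by_cases h : j = i
    · subst h; simp; fun_prop
    · simp [Function.update_of_ne h]; fun_prop
  refine ⟨hm, ?_⟩
  symm
  apply Measure.pi_eq
  intro s hs
  rw [Measure.map_apply hm (MeasurableSet.univ_pi hs)]
  have : (fun q : (Fin m → I) × I => Function.update q.1 i q.2) ⁻¹' (Set.univ.pi s)
      = (Set.univ.pi (Function.update s i Set.univ)) ×ˢ (s i) := by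
    ext q
    simp only [Set.mem_preimage, Set.mem_pi, Set.mem_univ, true_imp_iff, Set.mem_prod]
    constructor
    · intro h
      refine ⟨fun j => ?_, by simpa using h i⟩
      by_cases hj : j = i
      · subst hj; simp
      · simpa [Function.update_of_ne hj] using h j
    · rintro ⟨h1, h2⟩ j
      by_cases hj : j = i
      · subst hj; simpa using h2
      · simpa [Function.update_of_ne hj] using h1 j
  rw [this, Measure.prod_prod, Measure.pi_pi, ← Finset.mul_prod_erase _ _ (Finset.mem_univ i),
    ← Finset.mul_prod_erase _ (fun j => volume (s j)) (Finset.mem_univ i)]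
  simp only [Function.update_self, measure_univ, one_mul]
  rw [mul_comm]
  congr 1
  apply Finset.prod_congr rfl
  intro j hj
  rw [Function.update_of_ne (Finset.ne_of_mem_erase hj)]

/-- two-point resampling -/
lemma gr_pair (m : ℕ) (i j : Fin m) (hij : i ≠ j) (D : I → I → ℝ)
    (hD : Measurable (Function.uncurry D)) (C : ℝ) (hC : ∀ x y, |D x y| ≤ C)
    (f g : (Fin m → I) → ℝ) (hf : Measurable f) (hg : Measurable g)
    (hf1 : ∀ x, |f x| ≤ 1) (hg1 : ∀ x, |g x| ≤ 1)
    (hfj : ∀ x u, f (Function.update x j u) = f x)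
    (hgi : ∀ x u, g (Function.update x i u) = g x) :
    |∫ x : Fin m → I, D (x i) (x j) * f x * g x ∂(Measure.pi fun _ : Fin m => (volume : Measure I))|
      ≤ cutNorm D := by
  set P := (Measure.pi fun _ : Fin m => (volume : Measure I)) with hP
  let T : ((Fin m → I) × I) × I → (Fin m → I) := fun q =>
    Function.update (Function.update q.1.1 i q.1.2) j q.2
  have hT : MeasurePreserving T ((P.prod volume).prod volume) P :=
    (gr_update_mp j).comp ((gr_update_mp i).prod (MeasurePreserving.id _))
  let T' : (Fin m → I) × (I × I) → (Fin m → I) := fun q =>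
    Function.update (Function.update q.1 i q.2.1) j q.2.2
  have hT' : MeasurePreserving T' (P.prod ((volume : Measure I).prod volume)) P := by
    have := hT.comp ((measurePreserving_prodAssoc P (volume : Measure I) (volume : Measure I)).symm)
    exact this
  have hmeas : Measurable (fun x : Fin m → I => D (x i) (x j) * f x * g x) := by
    have : Measurable fun x : Fin m → I => D (x i) (x j) :=
      gr_meas2 hD (measurable_pi_apply i) (measurable_pi_apply j)
    exact (this.mul hf).mul hg
  have hb : ∀ x : Fin m → I, |D (x i) (x j) * f x * g x| ≤ C := by
    intro x
    rw [abs_mul, abs_mul]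
    have h0 := hC (x i) (x j)
    have h1 := hf1 x
    have h2 := hg1 x
    have : |D (x i) (x j)| * |f x| * |g x| ≤ C * 1 * 1 := by
        have hC0 := (abs_nonneg _).trans h0
        gcongr
    linarith
  rw [← hT'.map_eq, integral_map hT'.measurable.aemeasurable
    hmeas.aestronglyMeasurable, integral_prod]
  swap
  · exact gr_bdd_integrable (hmeas.comp hT'.measurable) C (fun x => hb _)
  have hbound : ∀ x : Fin m → I, ‖∫ p : I × I, D (T' (x, p) i) (T' (x, p) j) * f (T' (x, p)) * g (T' (x, p)) ∂((volume : Measure I).prod (volume : Measure I))‖ ≤ cutNorm D := by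
    intro x
    have hTi : ∀ p : I × I, T' (x, p) i = p.1 := by
      intro p; simp [T', Function.update_of_ne hij]
    have hTj : ∀ p : I × I, T' (x, p) j = p.2 := by
      intro p; simp [T']
    have hTf : ∀ p : I × I, f (T' (x, p)) = f (Function.update x i p.1) := by
      intro p; simp only [T', hfj]
    have hTg : ∀ p : I × I, g (T' (x, p)) = g (Function.update x j p.2) := by
      intro p; simp only [T']; rw [Function.update_comm hij, hgi]
    simp only [hTi, hTj, hTf, hTg]
    refine gr_le_cutNorm D C hC (fun u => f (Function.update x i u)) (fun u => g (Function.update x j u))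
      (hf.comp (measurable_update x)) (hg.comp (measurable_update x)) (fun _ => hf1 _) (fun _ => hg1 _)
  have := norm_integral_le_of_norm_le_const (μ := P) (Eventually.of_forall hbound)
  simpa using this

lemma gr_prod_meas {Ω ι : Type*} [MeasurableSpace Ω] (U : I → I → ℝ) (hU : Measurable (Function.uncurry U))
    (E : Finset ι) (s t : ι → Ω → I) (hs : ∀ e, Measurable (s e)) (ht : ∀ e, Measurable (t e)) :
    Measurable (fun x => ∏ e ∈ E, U (s e x) (t e x)) :=
  Finset.measurable_fun_prod _ fun e _ => hU.comp ((hs e).prodMk (ht e))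

lemma gr_prod_bd {ι : Type*} (E : Finset ι) (h : ι → ℝ) (hh : ∀ e, h e ∈ Set.Icc (0:ℝ) 1) :
    |∏ e ∈ E, h e| ≤ 1 := by
  rw [abs_of_nonneg (Finset.prod_nonneg fun e _ => (hh e).1)]
  exact Finset.prod_le_one (fun e _ => (hh e).1) (fun e _ => (hh e).2)

lemma gr_counting (U W : I → I → ℝ) (hU : IsGraphon U) (hW : IsGraphon W) (m : ℕ)
    (A B : Finset (Fin m × Fin m)) (hA : ∀ p ∈ A, p.1 < p.2) (hB : ∀ p ∈ B, p.1 < p.2)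
    (hAB : Disjoint A B) :
    |(∫ x : Fin m → I, (∏ p ∈ A, U (x p.1) (x p.2)) * ∏ p ∈ B, W (x p.1) (x p.2)
        ∂(Measure.pi fun _ : Fin m => (volume : Measure I)))
      - ∫ x : Fin m → I, (∏ p ∈ A, W (x p.1) (x p.2)) * ∏ p ∈ B, W (x p.1) (x p.2)
        ∂(Measure.pi fun _ : Fin m => (volume : Measure I))|
      ≤ A.card * cutNorm (fun x y => U x y - W x y) := by
  induction A using Finset.induction_on generalizing B with
  | empty => simp
  | insert e A he ih =>
    have hA' : ∀ p ∈ A, p.1 < p.2 := fun p hp => hA p (Finset.mem_insert_of_mem hp)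
    have heB : e ∉ B := fun h => Finset.disjoint_left.1 hAB (Finset.mem_insert_self _ _) h
    have hAB' : Disjoint A (insert e B) := by
      rw [Finset.disjoint_insert_right]
      exact ⟨he, hAB.mono_left (Finset.subset_insert _ _)⟩
    have hlt := hA e (Finset.mem_insert_self _ _)
    have ih' := ih (insert e B) hA' (by
      intro p hp
      rcases Finset.mem_insert.1 hp with rfl | hp
      · exact hlt
      · exact hB p hp) hAB'
    simp only [Finset.prod_insert heB] at ih'
    simp only [Finset.prod_insert he, Finset.card_insert_of_notMem he]
    set P := (Measure.pi fun _ : Fin m => (volume : Measure I)) with hP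
    have mU : ∀ (E : Finset (Fin m × Fin m)), Measurable (fun x : Fin m → I => ∏ p ∈ E, U (x p.1) (x p.2)) :=
      fun E => gr_prod_meas U hU.1 E _ _ (fun e => measurable_pi_apply _) (fun e => measurable_pi_apply _)
    have mW : ∀ (E : Finset (Fin m × Fin m)), Measurable (fun x : Fin m → I => ∏ p ∈ E, W (x p.1) (x p.2)) :=
      fun E => gr_prod_meas W hW.1 E _ _ (fun e => measurable_pi_apply _) (fun e => measurable_pi_apply _)
    have bU : ∀ (E : Finset (Fin m × Fin m)) (x : Fin m → I), |∏ p ∈ E, U (x p.1) (x p.2)| ≤ 1 :=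
      fun E x => gr_prod_bd E _ (fun p => hU.2.2 _ _)
    have bW : ∀ (E : Finset (Fin m × Fin m)) (x : Fin m → I), |∏ p ∈ E, W (x p.1) (x p.2)| ≤ 1 :=
      fun E x => gr_prod_bd E _ (fun p => hW.2.2 _ _)
    have meU : Measurable (fun x : Fin m → I => U (x e.1) (x e.2)) :=
      gr_meas2 hU.1 (measurable_pi_apply e.1) (measurable_pi_apply e.2)
    have meW : Measurable (fun x : Fin m → I => W (x e.1) (x e.2)) :=
      gr_meas2 hW.1 (measurable_pi_apply e.1) (measurable_pi_apply e.2)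
    have beU : ∀ x y, |U x y| ≤ 1 := fun x y => by
      rw [abs_of_nonneg (hU.2.2 x y).1]; exact (hU.2.2 x y).2
    have beW : ∀ x y, |W x y| ≤ 1 := fun x y => by
      rw [abs_of_nonneg (hW.2.2 x y).1]; exact (hW.2.2 x y).2
    have b3 : ∀ a b c : ℝ, |a| ≤ 1 → |b| ≤ 1 → |c| ≤ 1 → |a * b * c| ≤ 1 := by
      intro a b c ha hb hc
      rw [abs_mul, abs_mul]
      have : |a| * |b| * |c| ≤ 1 * 1 * 1 := by gcongr
      linarith
    -- the swap of one edge
    have hswap : |(∫ x : Fin m → I, U (x e.1) (x e.2) * (∏ p ∈ A, U (x p.1) (x p.2)) * ∏ p ∈ B, W (x p.1) (x p.2) ∂P)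
      - ∫ x : Fin m → I, (∏ p ∈ A, U (x p.1) (x p.2)) * (W (x e.1) (x e.2) * ∏ p ∈ B, W (x p.1) (x p.2)) ∂P|
        ≤ cutNorm (fun x y => U x y - W x y) := by
      rw [← integral_sub]
      rotate_left
      · exact gr_bdd_integrable ((meU.mul (mU A)).mul (mW B)) 1
          (fun x => b3 _ _ _ (beU _ _) (bU A x) (bW B x))
      · exact gr_bdd_integrable ((mU A).mul (meW.mul (mW B))) 1
          (fun x => by rw [← mul_assoc]; exact b3 _ _ _ (bU A x) (beW _ _) (bW B x))
      let q : Fin m × Fin m → Prop := fun p => p.1 = e.2 ∨ p.2 = e.2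
      let f : (Fin m → I) → ℝ := fun x => (∏ p ∈ A with ¬ q p, U (x p.1) (x p.2)) * ∏ p ∈ B with ¬ q p, W (x p.1) (x p.2)
      let g : (Fin m → I) → ℝ := fun x => (∏ p ∈ A with q p, U (x p.1) (x p.2)) * ∏ p ∈ B with q p, W (x p.1) (x p.2)
      have hq : ∀ p ∈ A ∪ B, q p → p.1 ≠ e.1 ∧ p.2 ≠ e.1 := by
        intro p hp hqp
        have hplt : p.1 < p.2 := by
          rcases Finset.mem_union.1 hp with h | h
          · exact hA' p h
          · exact hB p h
        have hpe : p ≠ e := by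
          rintro rfl
          rcases Finset.mem_union.1 hp with h | h
          · exact he h
          · exact heB h
        rcases hqp with h | h
        · constructor
          · intro h'; exact absurd (h'.symm.trans h) hlt.ne
          · intro h'; rw [h, h'] at hplt; exact absurd hplt (not_lt.2 hlt.le)
        · constructor
          · intro h'; exact hpe (Prod.ext h' h)
          · intro h'; exact absurd (h'.symm.trans h) hlt.ne
      have hmain := gr_pair m e.1 e.2 hlt.ne (fun x y => U x y - W x y) (hU.1.sub hW.1) 2
        (fun x y => by
          have := abs_sub (U x y) (W x y)
          have h1 := beU x y
          have h2 := beW x y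
          linarith) f g ((mU _).mul (mW _)) ((mU _).mul (mW _))
        (fun x => by
          have := b3 1 _ _ (by simp) (bU (A.filter fun p => ¬ q p) x) (bW (B.filter fun p => ¬ q p) x)
          rwa [one_mul] at this)
        (fun x => by
          have := b3 1 _ _ (by simp) (bU (A.filter fun p => q p) x) (bW (B.filter fun p => q p) x)
          rwa [one_mul] at this)
        (by
          intro x u
          simp only [f]
          congr 1
          · refine Finset.prod_congr rfl fun p hp => ?_
            have := (Finset.mem_filter.1 hp).2
            simp only [q, not_or] at this
            rw [Function.update_of_ne this.1, Function.update_of_ne this.2]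
          · refine Finset.prod_congr rfl fun p hp => ?_
            have := (Finset.mem_filter.1 hp).2
            simp only [q, not_or] at this
            rw [Function.update_of_ne this.1, Function.update_of_ne this.2])
        (by
          intro x u
          simp only [g]
          congr 1
          · refine Finset.prod_congr rfl fun p hp => ?_
            have := hq p (Finset.mem_union_left _ (Finset.mem_filter.1 hp).1) (Finset.mem_filter.1 hp).2
            rw [Function.update_of_ne this.1, Function.update_of_ne this.2]
          · refine Finset.prod_congr rfl fun p hp => ?_
            have := hq p (Finset.mem_union_right _ (Finset.mem_filter.1 hp).1) (Finset.mem_filter.1 hp).2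
            rw [Function.update_of_ne this.1, Function.update_of_ne this.2])
      refine le_of_eq_of_le ?_ hmain
      congr 2
      ext x
      rw [← Finset.prod_filter_mul_prod_filter_not A q, ← Finset.prod_filter_mul_prod_filter_not B q]
      simp only [f, g]
      ring
    have e2 : (∫ x : Fin m → I, (∏ p ∈ A, W (x p.1) (x p.2)) * (W (x e.1) (x e.2) * ∏ p ∈ B, W (x p.1) (x p.2)) ∂P)
        = ∫ x : Fin m → I, W (x e.1) (x e.2) * (∏ p ∈ A, W (x p.1) (x p.2)) * ∏ p ∈ B, W (x p.1) (x p.2) ∂P := by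
      congr 1; ext x; ring
    rw [e2] at ih'
    push_cast
    rw [add_mul, one_mul, add_comm]
    exact (abs_sub_le _ _ _).trans (add_le_add hswap ih')

lemma gr_homDensity_sub (U W : I → I → ℝ) (hU : IsGraphon U) (hW : IsGraphon W) (m : ℕ)
    (G : SimpleGraph (Fin m)) :
    |homDensity volume U G - homDensity volume W G| ≤ (m * m : ℝ) * cutNorm (fun x y => U x y - W x y) := by
  have := gr_counting U W hU hW m
    (Finset.univ.filter (fun p : Fin m × Fin m => p.1 < p.2 ∧ G.Adj p.1 p.2)) ∅
    (by intro p hp; simp at hp; exact hp.1) (by simp) (by simp)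
  simp only [Finset.prod_empty, mul_one] at this
  refine this.trans ?_
  apply mul_le_mul_of_nonneg_right _ (gr_cutNorm_nonneg _)
  have := Finset.card_filter_le (Finset.univ : Finset (Fin m × Fin m)) (fun p : Fin m × Fin m => p.1 < p.2 ∧ G.Adj p.1 p.2)
  simp only [Finset.card_univ, Fintype.card_prod, Fintype.card_fin] at this
  exact_mod_cast this

lemma gr_homDensity_comp (W : I → I → ℝ) (hW : IsGraphon W) (φ : I → I)
    (hφ : MeasurePreserving φ (volume : Measure I) volume) (m : ℕ) (G : SimpleGraph (Fin m)) :
    homDensity volume (fun x y => W (φ x) (φ y)) G = homDensity volume W G := by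
  have hmp : MeasurePreserving (fun (x : Fin m → I) i => φ (x i)) (Measure.pi fun _ : Fin m => (volume : Measure I))
      (Measure.pi fun _ : Fin m => (volume : Measure I)) := measurePreserving_pi _ _ (fun _ => hφ)
  unfold homDensity
  conv_rhs => rw [← hmp.map_eq]
  rw [integral_map hmp.measurable.aemeasurable]
  exact (gr_prod_meas W hW.1 _ (fun (p : Fin m × Fin m) (x : Fin m → I) => x p.1) (fun p x => x p.2) (fun e => measurable_pi_apply _) (fun e => measurable_pi_apply _)).aestronglyMeasurable

lemma gr_easy (U W : I → I → ℝ) (hU : IsGraphon U) (hW : IsGraphon W) (h : cutDist U W = 0)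
    (m : ℕ) (G : SimpleGraph (Fin m)) : homDensity volume U G = homDensity volume W G := by
  rw [← sub_eq_zero, ← abs_eq_zero]
  apply le_antisymm _ (abs_nonneg _)
  refine le_of_forall_pos_le_add fun ε hε => ?_
  have hpos : 0 < ε / ((m * m : ℝ) + 1) := by positivity
  unfold cutDist at h
  obtain ⟨r, ⟨φ, hφ, rfl⟩, hr⟩ := Real.lt_sInf_add_pos (s := {r : ℝ | ∃ φ : I → I, MeasurePreserving φ (volume : Measure I) (volume : Measure I) ∧
    r = cutNorm (fun x y => U x y - W (φ x) (φ y))}) ⟨_, id, MeasurePreserving.id _, rfl⟩ hpos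
  rw [h, zero_add] at hr
  have hWφ : IsGraphon (fun x y => W (φ x) (φ y)) :=
    ⟨hW.1.comp ((hφ.measurable.comp measurable_fst).prodMk (hφ.measurable.comp measurable_snd)),
      fun x y => hW.2.1 _ _, fun x y => hW.2.2 _ _⟩
  have := gr_homDensity_sub U _ hU hWφ m G
  rw [gr_homDensity_comp W hW φ hφ] at this
  refine this.trans ?_
  rw [zero_add]
  have h1 : (m * m : ℝ) * cutNorm (fun x y => U x y - W (φ x) (φ y)) ≤ ((m * m : ℝ) + 1) * (ε / ((m * m : ℝ) + 1)) := by
    apply mul_le_mul _ hr.le (gr_cutNorm_nonneg _) (by positivity)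
    linarith
  rwa [mul_div_cancel₀] at h1
  positivity

noncomputable abbrev grP (V : Type) [Fintype V] : Measure (V → I) :=
  Measure.pi fun _ : V => (volume : Measure I)

noncomputable abbrev grInf : Measure (ℕ → I) :=
  Measure.infinitePi fun _ : ℕ => (volume : Measure I)

lemma gr_sum_mp (A B : Type) [Fintype A] [Fintype B] :
    MeasurePreserving (fun q : (A → I) × (B → I) => (Sum.elim q.1 q.2 : A ⊕ B → I))
      ((grP A).prod (grP B)) (grP (A ⊕ B)) := by
  have := measurePreserving_sumPiEquivProdPi_symm (fun _ : A ⊕ B => (volume : Measure I))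
  convert this using 1
  funext q v
  cases v <;> rfl

lemma gr_inj_mp {V T : Type} [Fintype V] (ρ : V → T) (hρ : Function.Injective ρ) :
    MeasurePreserving (fun (x : T → I) (v : V) => x (ρ v))
      (Measure.infinitePi fun _ : T => (volume : Measure I)) (grP V) := by
  have hm : Measurable (fun (x : T → I) (v : V) => x (ρ v)) := by fun_prop
  refine ⟨hm, ?_⟩
  symm
  apply Measure.pi_eq
  intro s hs
  rw [Measure.map_apply hm (MeasurableSet.univ_pi hs)]
  have : (fun (x : T → I) (v : V) => x (ρ v)) ⁻¹' (Set.univ.pi s)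
      = Set.pi (Finset.univ.image ρ : Finset T) (Function.extend ρ s (fun _ => Set.univ)) := by
    ext x
    simp [Set.mem_pi, hρ.extend_apply]
  rw [this, Measure.infinitePi_pi, Finset.prod_image (fun a _ b _ h => hρ h)]
  · simp [hρ.extend_apply]
  · intro i hi
    obtain ⟨v, _, rfl⟩ := Finset.mem_image.1 hi
    rw [hρ.extend_apply]; exact hs v

lemma gr_hd (V E : Type) [Fintype V] [Fintype E] (s t : E → V) (hne : ∀ e, s e ≠ t e)
    (hinj : Function.Injective fun e => s(s e, t e)) :
    ∃ (m : ℕ) (G : SimpleGraph (Fin m)), ∀ U : I → I → ℝ, IsGraphon U →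
      ∫ x, ∏ e, U (x (s e)) (x (t e)) ∂(grP V) = homDensity volume U G := by
  let τ : V ≃ Fin (Fintype.card V) := Fintype.equivFin V
  obtain ⟨G, hG⟩ : ∃ G : SimpleGraph (Fin (Fintype.card V)), ∀ a b, G.Adj a b ↔
      s(a, b) ∈ (Set.range fun e => s(τ (s e), τ (t e))) ∧ a ≠ b :=
    ⟨SimpleGraph.fromEdgeSet (Set.range fun e => s(τ (s e), τ (t e))), fun a b =>
      SimpleGraph.fromEdgeSet_adj _⟩
  refine ⟨Fintype.card V, G, ?_⟩
  intro U hU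
  have hmp := gr_inj_mp (fun v => τ v) τ.injective
  rw [Measure.infinitePi_eq_pi] at hmp
  rw [← hmp.map_eq, integral_map hmp.measurable.aemeasurable
    (gr_prod_meas U hU.1 _ (fun (e : E) (x : V → I) => x (s e)) (fun e x => x (t e))
      (fun e => measurable_pi_apply _) (fun e => measurable_pi_apply _)).aestronglyMeasurable]
  unfold homDensity
  congr 1
  ext x
  refine Finset.prod_bij (fun e _ => if τ (s e) < τ (t e) then (τ (s e), τ (t e)) else (τ (t e), τ (s e))) ?_ ?_ ?_ ?_
  · intro e _
    have hst : τ (s e) ≠ τ (t e) := fun h => hne e (τ.injective h)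
    rw [Finset.mem_filter]
    refine ⟨Finset.mem_univ _, ?_⟩
    split_ifs with h
    · refine ⟨h, ?_⟩
      rw [hG]
      exact ⟨⟨e, rfl⟩, hst⟩
    · refine ⟨lt_of_le_of_ne (not_lt.1 h) hst.symm, ?_⟩
      rw [hG]
      exact ⟨⟨e, Sym2.eq_swap⟩, hst.symm⟩
  · intro e _ e' _ h
    apply hinj
    have key : ∀ e : E, Sym2.mk ((if τ (s e) < τ (t e) then (τ (s e), τ (t e)) else (τ (t e), τ (s e))) : Fin (Fintype.card V) × Fin (Fintype.card V)).1 ((if τ (s e) < τ (t e) then (τ (s e), τ (t e)) else (τ (t e), τ (s e))) : Fin (Fintype.card V) × Fin (Fintype.card V)).2 = Sym2.map τ s(s e, t e) := by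
      intro e
      split_ifs
      · rfl
      · exact Sym2.eq_swap
    have h2 : Sym2.map τ s(s e, t e) = Sym2.map τ s(s e', t e') := by
      rw [← key, ← key]
      rw [h]
    exact Sym2.map.injective τ.injective h2
  · rintro ⟨a, b⟩ hab
    rw [Finset.mem_filter, hG] at hab
    obtain ⟨_, hlt, ⟨e, he⟩, _⟩ := hab
    refine ⟨e, Finset.mem_univ _, ?_⟩
    simp only at he hlt
    rcases Sym2.eq_iff.1 he with ⟨h1, h2⟩ | ⟨h1, h2⟩
    · rw [h1, h2, if_pos hlt]
    · rw [h1, h2, if_neg (not_lt.2 hlt.le)]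
  · intro e _
    split_ifs
    · rfl
    · exact hU.2.1 _ _

/-- simultaneous graph representation -/
def GrRep (U W : I → I → ℝ) (N : ℕ) (gU gW : (ℕ → I) → ℝ) : Prop :=
  ∃ (S E : Type) (_ : Fintype S) (_ : Fintype E) (s : E → Fin N ⊕ S) (t : E → S),
    (∀ e, s e ≠ Sum.inr (t e)) ∧ (Function.Injective fun e => s(s e, Sum.inr (t e))) ∧
    (∀ x, gU x = ∫ y : S → I, ∏ e, U ((Sum.elim (fun i : Fin N => x i) y : Fin N ⊕ S → I) (s e)) (y (t e)) ∂(grP S)) ∧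
    (∀ x, gW x = ∫ y : S → I, ∏ e, W ((Sum.elim (fun i : Fin N => x i) y : Fin N ⊕ S → I) (s e)) (y (t e)) ∂(grP S))

lemma GrRep.one (U W : I → I → ℝ) (N : ℕ) : GrRep U W N (fun _ => 1) (fun _ => 1) := by
  refine ⟨Empty, Empty, inferInstance, inferInstance, fun e => e.elim, fun e => e.elim,
    fun e => e.elim, fun e => e.elim, ?_, ?_⟩ <;> intro x <;> simp

lemma gr_mul_aux (U : I → I → ℝ) (hU : IsGraphon U) (N : ℕ) (S E S' E' : Type) [Fintype S] [Fintype E]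
    [Fintype S'] [Fintype E'] (s : E → Fin N ⊕ S) (t : E → S) (s' : E' → Fin N ⊕ S') (t' : E' → S')
    (x : Fin N → I) :
    (∫ y : S → I, ∏ e, U ((Sum.elim x y : Fin N ⊕ S → I) (s e)) (y (t e)) ∂(grP S)) *
    (∫ y : S' → I, ∏ e, U ((Sum.elim x y : Fin N ⊕ S' → I) (s' e)) (y (t' e)) ∂(grP S')) =
    ∫ y : S ⊕ S' → I, ∏ e : E ⊕ E', U ((Sum.elim x y : Fin N ⊕ (S ⊕ S') → I)
      ((Sum.elim (fun e => Sum.map id Sum.inl (s e)) (fun e => Sum.map id Sum.inr (s' e)) : E ⊕ E' → Fin N ⊕ (S ⊕ S')) e)) (y (Sum.map t t' e)) ∂(grP (S ⊕ S')) := by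
  rw [← (gr_sum_mp S S').map_eq, integral_map (gr_sum_mp S S').measurable.aemeasurable, ← integral_prod_mul]
  · congr 1
    ext q
    rw [Fintype.prod_sum_type]
    congr 1
    · refine Finset.prod_congr rfl fun e _ => ?_
      simp only [Sum.elim_inl, Sum.map_inl]
      congr 1
      cases s e <;> rfl
    · refine Finset.prod_congr rfl fun e _ => ?_
      simp only [Sum.elim_inr, Sum.map_inr]
      congr 1
      cases s' e <;> rfl
  · apply Measurable.aestronglyMeasurable
    apply gr_prod_meas U hU.1
    · intro e
      generalize (Sum.elim (fun e => Sum.map id Sum.inl (s e)) (fun e => Sum.map id Sum.inr (s' e)) : E ⊕ E' → Fin N ⊕ (S ⊕ S')) e = v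
      cases v with
      | inl v => exact measurable_const
      | inr v => exact measurable_pi_apply _
    · intro e
      exact measurable_pi_apply _

lemma GrRep.mul {U W : I → I → ℝ} (hU : IsGraphon U) (hW : IsGraphon W) {N : ℕ}
    {gU gW gU' gW' : (ℕ → I) → ℝ} (h : GrRep U W N gU gW) (h' : GrRep U W N gU' gW') :
    GrRep U W N (fun x => gU x * gU' x) (fun x => gW x * gW' x) := by
  obtain ⟨S, E, _, _, s, t, hne, hinj, h1, h2⟩ := h
  obtain ⟨S', E', _, _, s', t', hne', hinj', h1', h2'⟩ := h'
  refine ⟨S ⊕ S', E ⊕ E', inferInstance, inferInstance,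
    Sum.elim (fun e => Sum.map id Sum.inl (s e)) (fun e => Sum.map id Sum.inr (s' e)), Sum.map t t', ?_, ?_, ?_, ?_⟩
  · have := hne
    have := hne'
    rintro (e | e) h
    · apply hne e
      simp only [Sum.elim_inl, Sum.map_inl] at h
      cases hs : s e <;> simp_all
    · apply hne' e
      simp only [Sum.elim_inr, Sum.map_inr] at h
      cases hs : s' e <;> simp_all
  · have i1 : Function.Injective (Sum.map id Sum.inl : Fin N ⊕ S → Fin N ⊕ (S ⊕ S')) :=
      Function.Injective.sumMap Function.injective_id Sum.inl_injective
    have i2 : Function.Injective (Sum.map id Sum.inr : Fin N ⊕ S' → Fin N ⊕ (S ⊕ S')) :=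
      Function.Injective.sumMap Function.injective_id Sum.inr_injective
    have cross : ∀ e e', s((Sum.map id Sum.inl (s e) : Fin N ⊕ (S ⊕ S')), Sum.inr (Sum.inl (t e)))
        ≠ s((Sum.map id Sum.inr (s' e') : Fin N ⊕ (S ⊕ S')), Sum.inr (Sum.inr (t' e'))) := by
      intro e e' h
      rcases Sym2.eq_iff.1 h with ⟨_, h⟩ | ⟨_, h⟩
      · simp at h
      · cases hs : s' e' <;> simp_all
    rintro (e | e) (e' | e') h
    · congr 1
      apply hinj
      exact Sym2.map.injective i1 h
    · exact absurd h (cross _ _)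
    · exact absurd h.symm (cross _ _)
    · congr 1
      apply hinj'
      exact Sym2.map.injective i2 h
  · intro x
    change gU x * gU' x = _
    rw [h1, h1', gr_mul_aux U hU]
  · intro x
    change gW x * gW' x = _
    rw [h2, h2', gr_mul_aux W hW]

lemma gr_int_aux (U : I → I → ℝ) (hU : IsGraphon U) (N : ℕ) (S E : Type) [Fintype S] [Fintype E]
    (s : E → Fin N ⊕ S) (t : E → S) :
    ∫ x : ℕ → I, (∫ y : S → I, ∏ e, U ((Sum.elim (fun i : Fin N => x i) y : Fin N ⊕ S → I) (s e)) (y (t e)) ∂(grP S)) ∂grInf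
    = ∫ z : Fin N ⊕ S → I, ∏ e, U (z (s e)) (z (Sum.inr (t e))) ∂(grP (Fin N ⊕ S)) := by
  have hm : Measurable fun z : Fin N ⊕ S → I => ∏ e, U (z (s e)) (z (Sum.inr (t e))) :=
    gr_prod_meas U hU.1 _ (fun (e : E) (x : Fin N ⊕ S → I) => x (s e)) (fun e x => x (Sum.inr (t e)))
      (fun e => measurable_pi_apply _) (fun e => measurable_pi_apply _)
  have hmp := gr_inj_mp (fun v : Fin N => (v : ℕ)) Fin.val_injective
  have hm2 : Measurable fun q : (Fin N → I) × (S → I) => ∏ e, U ((Sum.elim q.1 q.2 : Fin N ⊕ S → I) (s e)) (q.2 (t e)) :=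
    hm.comp (gr_sum_mp (Fin N) S).measurable
  rw [← (gr_sum_mp (Fin N) S).map_eq, integral_map (gr_sum_mp (Fin N) S).measurable.aemeasurable hm.aestronglyMeasurable,
    integral_prod, ← hmp.map_eq, integral_map hmp.measurable.aemeasurable]
  · rfl
  · exact hm2.stronglyMeasurable.integral_prod_right'.aestronglyMeasurable
  · exact gr_bdd_integrable hm2 1 (fun x => gr_prod_bd _ _ (fun e => hU.2.2 _ _))

lemma GrRep.integral_eq {U W : I → I → ℝ} (hU : IsGraphon U) (hW : IsGraphon W)
    (hyp : ∀ (m : ℕ) (G : SimpleGraph (Fin m)),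
        homDensity (volume : Measure I) U G = homDensity (volume : Measure I) W G) {N : ℕ}
    {gU gW : (ℕ → I) → ℝ} (h : GrRep U W N gU gW) :
    ∫ x, gU x ∂grInf = ∫ x, gW x ∂grInf := by
  obtain ⟨S, E, _, _, s, t, hne, hinj, h1, h2⟩ := h
  simp only [h1, h2]
  rw [gr_int_aux U hU, gr_int_aux W hW]
  obtain ⟨m, G, hG⟩ := gr_hd (Fin N ⊕ S) E s (fun e => Sum.inr (t e)) hne hinj
  rw [hG U hU, hG W hW, hyp]

/-- operator square of a kernel -/
noncomputable def grV (U : I → I → ℝ) (x y : I) : ℝ := ∫ z, U x z * U z y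

lemma grV_meas {U : I → I → ℝ} (hU : IsGraphon U) : Measurable (Function.uncurry (grV U)) := by
  have : Measurable fun q : (I × I) × I => U q.1.1 q.2 * U q.2 q.1.2 :=
    (gr_meas2 hU.1 (by fun_prop) (by fun_prop)).mul (gr_meas2 hU.1 (by fun_prop) (by fun_prop))
  exact this.stronglyMeasurable.integral_prod_right'.measurable

lemma grV_mem {U : I → I → ℝ} (hU : IsGraphon U) (x y : I) : grV U x y ∈ Set.Icc (0:ℝ) 1 := by
  constructor
  · exact integral_nonneg fun z => mul_nonneg (hU.2.2 _ _).1 (hU.2.2 _ _).1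
  · have := norm_integral_le_of_norm_le_const (μ := (volume : Measure I)) (f := fun z => U x z * U z y) (C := 1)
      (Eventually.of_forall fun z => by
        rw [Real.norm_eq_abs, abs_mul, abs_of_nonneg (hU.2.2 _ _).1, abs_of_nonneg (hU.2.2 _ _).1]
        exact mul_le_one₀ (hU.2.2 _ _).2 (hU.2.2 _ _).1 (hU.2.2 _ _).2)
    have h2 := (le_abs_self _).trans this
    simpa [grV] using h2

lemma grV_symm {U : I → I → ℝ} (hU : IsGraphon U) (x y : I) : grV U x y = grV U y x := by
  unfold grV
  congr 1; ext z
  rw [hU.2.1 x z, hU.2.1 z y, mul_comm]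

noncomputable def grMomR (U : I → I → ℝ) (x : ℕ → I) (k : Bool × List (ℕ × Bool)) : ℝ :=
  ∫ p : I × I, (if k.1 = true then U p.1 p.2 else 1) *
    (k.2.map fun s => grV U (x s.1) (if s.2 = true then p.1 else p.2)).prod
      ∂((volume : Measure I).prod (volume : Measure I))

lemma gr_listprod_mem {J : Type*} (l : List J) (f : J → ℝ) (hf : ∀ j, f j ∈ Set.Icc (0:ℝ) 1) :
    (l.map f).prod ∈ Set.Icc (0:ℝ) 1 := by
  induction l with
  | nil => simp
  | cons a l ih =>
    simp only [List.map_cons, List.prod_cons]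
    exact ⟨mul_nonneg (hf a).1 ih.1, mul_le_one₀ (hf a).2 ih.1 ih.2⟩

lemma gr_listprod_meas {Ω J : Type*} [MeasurableSpace Ω] (l : List J) (f : J → Ω → ℝ) (hf : ∀ j, Measurable (f j)) :
    Measurable fun x => (l.map fun j => f j x).prod := by
  induction l with
  | nil => simp
  | cons a l ih =>
    simp only [List.map_cons, List.prod_cons]
    exact (hf a).mul ih

lemma gr_mom_integrand_meas {U : I → I → ℝ} (hU : IsGraphon U) (k : Bool × List (ℕ × Bool)) :
    Measurable fun q : (ℕ → I) × (I × I) => (if k.1 = true then U q.2.1 q.2.2 else 1) *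
    (k.2.map fun s => grV U (q.1 s.1) (if s.2 = true then q.2.1 else q.2.2)).prod := by
  apply Measurable.mul
  · by_cases h : k.1 = true
    · simp only [h, if_true]
      exact gr_meas2 hU.1 (by fun_prop) (by fun_prop)
    · simp only [h]
      exact measurable_const
  · apply gr_listprod_meas k.2 (fun s (q : (ℕ → I) × (I × I)) => grV U (q.1 s.1) (if s.2 = true then q.2.1 else q.2.2))
    intro s
    by_cases h : s.2 = true
    · simp only [h, if_true]
      exact gr_meas2 (grV_meas hU) (by fun_prop) (by fun_prop)
    · simp only [if_neg h]
      exact gr_meas2 (grV_meas hU) (by fun_prop) (by fun_prop)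

lemma gr_mom_integrand_mem {U : I → I → ℝ} (hU : IsGraphon U) (k : Bool × List (ℕ × Bool)) (x : ℕ → I) (p : I × I) :
    (if k.1 = true then U p.1 p.2 else 1) *
    (k.2.map fun s => grV U (x s.1) (if s.2 = true then p.1 else p.2)).prod ∈ Set.Icc (0:ℝ) 1 := by
  have h1 := gr_listprod_mem k.2 (fun s => grV U (x s.1) (if s.2 = true then p.1 else p.2)) (fun s => grV_mem hU _ _)
  have h2 : (if k.1 = true then U p.1 p.2 else 1) ∈ Set.Icc (0:ℝ) 1 := by
    split_ifs
    · exact hU.2.2 _ _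
    · simp
  exact ⟨mul_nonneg h2.1 h1.1, mul_le_one₀ h2.2 h1.1 h1.2⟩

lemma grMomR_mem {U : I → I → ℝ} (hU : IsGraphon U) (x : ℕ → I) (k : Bool × List (ℕ × Bool)) :
    grMomR U x k ∈ Set.Icc (0:ℝ) 1 := by
  constructor
  · exact integral_nonneg fun p => (gr_mom_integrand_mem hU k x p).1
  · have := norm_integral_le_of_norm_le_const (μ := (volume : Measure I).prod (volume : Measure I)) (C := 1)
      (Eventually.of_forall fun p => by
        rw [Real.norm_eq_abs, abs_of_nonneg (gr_mom_integrand_mem hU k x p).1]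
        exact (gr_mom_integrand_mem hU k x p).2)
    have h2 := (le_abs_self _).trans this
    simpa [grMomR] using h2

lemma grMomR_meas {U : I → I → ℝ} (hU : IsGraphon U) (k : Bool × List (ℕ × Bool)) :
    Measurable fun x => grMomR U x k :=
  (gr_mom_integrand_meas hU k).stronglyMeasurable.integral_prod_right'.measurable

lemma gr_mom_aux (U : I → I → ℝ) (hU : IsGraphon U) (N : ℕ) (b : Bool) (l : List (ℕ × Bool))
    (ix : Fin l.length → Fin N) (hix : ∀ i, (ix i : ℕ) = (l[i.1]).1) (x : ℕ → I) :
    grMomR U x (b, l) = ∫ y : (Fin 2 ⊕ Fin l.length) → I, ∏ e : {_u : Unit // b = true} ⊕ (Fin l.length × Bool),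
      U ((Sum.elim (fun i : Fin N => x i) y : Fin N ⊕ (Fin 2 ⊕ Fin l.length) → I)
        ((Sum.elim (fun _ => Sum.inr (Sum.inl 0)) (fun q => if q.2 = true then Sum.inr (Sum.inl (if (l[q.1.1]).2 = true then 0 else 1)) else Sum.inl (ix q.1)) : {_u : Unit // b = true} ⊕ (Fin l.length × Bool) → Fin N ⊕ (Fin 2 ⊕ Fin l.length)) e))
        (y ((Sum.elim (fun _ => Sum.inl 1) (fun q => Sum.inr q.1) : {_u : Unit // b = true} ⊕ (Fin l.length × Bool) → Fin 2 ⊕ Fin l.length) e))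
      ∂(grP (Fin 2 ⊕ Fin l.length)) := by
  have hmp := gr_sum_mp (Fin 2) (Fin l.length)
  set F : ((Fin 2 ⊕ Fin l.length) → I) → ℝ := fun y => ∏ e : {_u : Unit // b = true} ⊕ (Fin l.length × Bool),
      U ((Sum.elim (fun i : Fin N => x i) y : Fin N ⊕ (Fin 2 ⊕ Fin l.length) → I)
        ((Sum.elim (fun _ => Sum.inr (Sum.inl 0)) (fun q => if q.2 = true then Sum.inr (Sum.inl (if (l[q.1.1]).2 = true then 0 else 1)) else Sum.inl (ix q.1)) : {_u : Unit // b = true} ⊕ (Fin l.length × Bool) → Fin N ⊕ (Fin 2 ⊕ Fin l.length)) e))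
        (y ((Sum.elim (fun _ => Sum.inl 1) (fun q => Sum.inr q.1) : {_u : Unit // b = true} ⊕ (Fin l.length × Bool) → Fin 2 ⊕ Fin l.length) e)) with hF
  have hFm : Measurable F := by
    apply gr_prod_meas U hU.1
    · intro e
      generalize (Sum.elim (fun _ => Sum.inr (Sum.inl 0)) (fun q => if q.2 = true then Sum.inr (Sum.inl (if (l[q.1.1]).2 = true then 0 else 1)) else Sum.inl (ix q.1)) : {_u : Unit // b = true} ⊕ (Fin l.length × Bool) → Fin N ⊕ (Fin 2 ⊕ Fin l.length)) e = v
      cases v with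
      | inl v => exact measurable_const
      | inr v => exact measurable_pi_apply _
    · intro e
      exact measurable_pi_apply _
  have hF1 : ∀ y, |F y| ≤ 1 := fun y => gr_prod_bd _ _ (fun e => hU.2.2 _ _)
  have hFeq : ∀ (p : Fin 2 → I) (w : Fin l.length → I), F (Sum.elim p w) =
      (if b = true then U (p 0) (p 1) else 1) *
        ∏ i : Fin l.length, (U (x (l[i.1]).1) (w i) * U (w i) (if (l[i.1]).2 = true then p 0 else p 1)) := by
    intro p w
    simp only [hF]
    rw [Fintype.prod_sum_type, Fintype.prod_prod_type]
    congr 1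
    · cases b
      · simp
      · simp
    · refine Finset.prod_congr rfl fun i _ => ?_
      rw [Fintype.prod_bool]
      simp only [Sum.elim_inr, if_true, Sum.elim_inl, Bool.false_eq_true, if_false, hix]
      rw [mul_comm]
      congr 1
      rw [hU.2.1]
      congr 1
      split_ifs <;> rfl
  rw [← hmp.map_eq, integral_map hmp.measurable.aemeasurable hFm.aestronglyMeasurable, integral_prod]
  swap
  · exact gr_bdd_integrable (hFm.comp hmp.measurable) 1 (fun q => hF1 _)
  simp only [hFeq]
  have hin : ∀ p : Fin 2 → I, ∫ w : Fin l.length → I, ((if b = true then U (p 0) (p 1) else 1) *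
        ∏ i : Fin l.length, (U (x (l[i.1]).1) (w i) * U (w i) (if (l[i.1]).2 = true then p 0 else p 1))) ∂(grP (Fin l.length))
      = (fun q : I × I => (if b = true then U q.1 q.2 else 1) *
    (l.map fun s => grV U (x s.1) (if s.2 = true then q.1 else q.2)).prod) (MeasurableEquiv.finTwoArrow p) := by
    intro p
    rw [integral_const_mul, integral_fintype_prod_eq_prod (fun (i : Fin l.length) (z : I) => U (x (l[i.1]).1) z * U z (if (l[i.1]).2 = true then p 0 else p 1))]
    simp only [MeasurableEquiv.finTwoArrow]
    congr 1
    exact Fin.prod_univ_fun_getElem l (fun s => grV U (x s.1) (if s.2 = true then p 0 else p 1))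
  simp only [hin]
  have h9 := (measurePreserving_finTwoArrow (volume : Measure I)).integral_comp' (fun q : I × I => (if b = true then U q.1 q.2 else 1) *
    (l.map fun s => grV U (x s.1) (if s.2 = true then q.1 else q.2)).prod)
  exact h9.symm

lemma gr_mom_rep (U W : I → I → ℝ) (hU : IsGraphon U) (hW : IsGraphon W) (k : Bool × List (ℕ × Bool)) :
    ∀ᶠ N in atTop, GrRep U W N (fun x => grMomR U x k) (fun x => grMomR W x k) := by
  obtain ⟨b, l⟩ := k
  have hb : ∃ M : ℕ, ∀ i : Fin l.length, (l[i.1]).1 < M := by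
    refine ⟨(Finset.univ.sup fun i : Fin l.length => (l[i.1]).1) + 1, fun i => Nat.lt_succ_of_le ?_⟩
    exact Finset.le_sup (f := fun i : Fin l.length => (l[i.1]).1) (Finset.mem_univ i)
  obtain ⟨M, hM⟩ := hb
  filter_upwards [eventually_ge_atTop M] with N hN
  let ix : Fin l.length → Fin N := fun i => ⟨(l[i.1]).1, (hM i).trans_le hN⟩
  refine ⟨Fin 2 ⊕ Fin l.length, {_u : Unit // b = true} ⊕ (Fin l.length × Bool), inferInstance, inferInstance, _, _, ?_, ?_,
    fun x => gr_mom_aux U hU N b l ix (fun i => rfl) x, fun x => gr_mom_aux W hW N b l ix (fun i => rfl) x⟩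
  · rintro (e | ⟨i, c⟩)
    · simp
    · cases c <;> simp
  · rintro (e | ⟨i, c⟩) (e' | ⟨i', c'⟩) h
    · congr 1
      exact Subtype.ext rfl
    · exfalso; cases c' <;> simp at h
    · exfalso; cases c <;> simp at h
    · cases c <;> cases c' <;> simp at h ⊢ <;> exact h.2

lemma gr_mom_list (U W : I → I → ℝ) (hU : IsGraphon U) (hW : IsGraphon W) (L : List (Bool × List (ℕ × Bool))) :
    ∀ᶠ N in atTop, GrRep U W N (fun x => (L.map fun k => grMomR U x k).prod) (fun x => (L.map fun k => grMomR W x k).prod) := by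
  induction L with
  | nil => exact Eventually.of_forall fun N => by simpa using GrRep.one U W N
  | cons k L ih =>
    filter_upwards [ih, gr_mom_rep U W hU hW k] with N h1 h2
    simpa using h2.mul hU hW h1

/-- moment sequence of the sampled structure -/
noncomputable def grMom (U : I → I → ℝ) (x : ℕ → I) (k : Bool × List (ℕ × Bool)) : I :=
  Set.projIcc 0 1 zero_le_one (grMomR U x k)

lemma grMom_coe {U : I → I → ℝ} (hU : IsGraphon U) (x : ℕ → I) (k : Bool × List (ℕ × Bool)) :
    (grMom U x k : ℝ) = grMomR U x k := by
  unfold grMom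
  rw [Set.projIcc_of_mem zero_le_one (grMomR_mem hU x k)]

lemma grMom_meas {U : I → I → ℝ} (hU : IsGraphon U) : Measurable (grMom U) := by
  rw [measurable_pi_iff]
  intro k
  exact continuous_projIcc.measurable.comp (grMomR_meas hU k)

lemma gr_mom_law (U W : I → I → ℝ) (hU : IsGraphon U) (hW : IsGraphon W)
    (hyp : ∀ (m : ℕ) (G : SimpleGraph (Fin m)),
        homDensity (volume : Measure I) U G = homDensity (volume : Measure I) W G) :
    grInf.map (grMom U) = grInf.map (grMom W) := by
  have := Measure.isProbabilityMeasure_map (μ := grInf) (grMom_meas hU).aemeasurable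
  have := Measure.isProbabilityMeasure_map (μ := grInf) (grMom_meas hW).aemeasurable
  apply gr_measure_ext (J := Bool × List (ℕ × Bool)) _ _ (fun k z => z k) (fun k => continuous_apply k)
    (fun x y h => funext h)
  intro L
  have hm : Measurable fun z : (Bool × List (ℕ × Bool)) → I => (L.map fun k => (z k : ℝ)).prod :=
    gr_listprod_meas L (fun k (z : (Bool × List (ℕ × Bool)) → I) => (z k : ℝ)) (fun k => by fun_prop)
  rw [integral_map (grMom_meas hU).aemeasurable hm.aestronglyMeasurable,
    integral_map (grMom_meas hW).aemeasurable hm.aestronglyMeasurable]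
  simp only [grMom_coe hU, grMom_coe hW]
  obtain ⟨N, hN⟩ := (gr_mom_list U W hU hW L).exists
  exact hN.integral_eq hU hW hyp

lemma gr_hit (S : Set I) (hS : MeasurableSet S) (h : (volume : Measure I) S ≠ 0) :
    ∀ᵐ a ∂grInf, ∃ i, a i ∈ S := by
  rw [ae_iff]
  have hlt : (volume : Measure I) Sᶜ < 1 := by
    rw [prob_compl_eq_one_sub hS]
    exact ENNReal.sub_lt_self (by simp) (by simp) h
  have hN : ∀ N : ℕ, grInf {a : ℕ → I | ¬ ∃ i, a i ∈ S} ≤ ((volume : Measure I) Sᶜ) ^ N := by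
    intro N
    calc grInf {a : ℕ → I | ¬ ∃ i, a i ∈ S} ≤ grInf (Set.pi (Finset.range N) fun _ => Sᶜ) := by
          apply measure_mono
          intro a ha i _ hi
          exact ha ⟨i, hi⟩
      _ = _ := by
          rw [Measure.infinitePi_pi _ (fun i _ => hS.compl)]
          simp
  have := ge_of_tendsto' (ENNReal.tendsto_pow_atTop_nhds_zero_of_lt_one hlt) hN
  exact le_antisymm this zero_le

def GrGood (V : I → I → ℝ) (a : ℕ → I) : Prop :=
  ∀ f : I → ℝ, Measurable f → ∀ C : ℝ, (∀ x, |f x| ≤ C) → (∀ i, ∫ y, V (a i) y * f y = 0) →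
    ∀ᵐ x, ∫ y, V x y * f y = 0

lemma gr_good (V : I → I → ℝ) (hV : Measurable (Function.uncurry V))
    (hb : ∀ x y, V x y ∈ Set.Icc (0:ℝ) 1) : ∀ᵐ a ∂grInf, GrGood V a := by
  have : Fact ((1 : ENNReal) ≠ ⊤) := ⟨ENNReal.one_ne_top⟩
  obtain ⟨d, hd⟩ := TopologicalSpace.exists_dense_seq (Lp ℝ 1 (volume : Measure I))
  have hdm : ∀ n, Measurable (d n : I → ℝ) := fun n => (Lp.stronglyMeasurable (d n)).measurable
  have hdi : ∀ n, Integrable (d n : I → ℝ) := fun n => L1.integrable_coeFn (d n)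
  let S : ℕ × ℕ → Set I := fun n => {x | ∫ y, |V x y - d n.1 y| < 1 / ((n.2 : ℝ) + 1)}
  have hVx : ∀ x, Measurable (V x) := fun x => gr_meas2 hV measurable_const measurable_id
  have hVi : ∀ x, Integrable (V x) := fun x => gr_bdd_integrable (hVx x) 1 (fun y => by
    rw [abs_of_nonneg (hb _ _).1]; exact (hb _ _).2)
  have hS : ∀ n, MeasurableSet (S n) := by
    intro n
    apply measurableSet_lt _ measurable_const
    have : Measurable fun q : I × I => |V q.1 q.2 - d n.1 q.2| :=
      (hV.sub ((hdm n.1).comp measurable_snd)).abs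
    exact this.stronglyMeasurable.integral_prod_right'.measurable
  have h1 : ∀ᵐ a ∂grInf, ∀ n, (volume : Measure I) (S n) ≠ 0 → ∃ i, a i ∈ S n := by
    rw [ae_all_iff]
    intro n
    by_cases h : (volume : Measure I) (S n) = 0
    · exact Eventually.of_forall fun a h' => absurd h h'
    · filter_upwards [gr_hit (S n) (hS n) h] with a ha _ using ha
  have h2 : ∀ᵐ x : I, ∀ n, x ∈ S n → (volume : Measure I) (S n) ≠ 0 := by
    rw [ae_all_iff]
    intro n
    by_cases h : (volume : Measure I) (S n) = 0
    · have : ∀ᵐ x : I, x ∉ S n := by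
        rw [ae_iff]; simpa using h
      filter_upwards [this] with x hx hx' using absurd hx' hx
    · exact Eventually.of_forall fun a _ => h
  filter_upwards [h1] with a ha
  intro f hf C hC h0
  filter_upwards [h2] with x hx
  have hC0 : 0 ≤ C := (abs_nonneg _).trans (hC x)
  have hkey : ∀ k : ℕ, |∫ y, V x y * f y| ≤ C * (2 * (1 / ((k : ℝ) + 1))) := by
    intro k
    have hk : (0:ℝ) < 1 / ((k : ℝ) + 1) := by positivity
    obtain ⟨n, hn⟩ := hd.exists_dist_lt ((hVi x).toL1 (V x)) hk
    have hxS : x ∈ S (n, k) := by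
      show ∫ y, |V x y - d n y| < _
      refine lt_of_eq_of_lt ?_ hn
      rw [L1.dist_eq_integral_dist]
      apply integral_congr_ae
      filter_upwards [(hVi x).coeFn_toL1] with y hy
      rw [hy, Real.dist_eq]
    obtain ⟨i, hi⟩ := ha (n, k) (hx _ hxS)
    have hi' : ∫ y, |V (a i) y - d n y| < 1 / ((k : ℝ) + 1) := hi
    have hxS' : ∫ y, |V x y - d n y| < 1 / ((k : ℝ) + 1) := hxS
    have hbf : ∀ z, Integrable fun y => V z y * f y := fun z =>
      gr_bdd_integrable ((hVx z).mul hf) C fun y => by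
        rw [abs_mul, abs_of_nonneg (hb _ _).1]
        calc _ ≤ 1 * C := mul_le_mul (hb _ _).2 (hC y) (abs_nonneg _) zero_le_one
          _ = C := one_mul C
    have hid : ∀ z, Integrable fun y => |V z y - d n y| := fun z => ((hVi z).sub (hdi n)).abs
    have e1 : ∫ y, V x y * f y = ∫ y, (V x y * f y - V (a i) y * f y) := by
      rw [integral_sub (hbf x) (hbf (a i)), h0 i, sub_zero]
    rw [e1]
    calc |∫ y, (V x y * f y - V (a i) y * f y)| ≤ ∫ y, |V x y * f y - V (a i) y * f y| :=
          abs_integral_le_integral_abs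
      _ ≤ ∫ y, C * (|V x y - d n y| + |V (a i) y - d n y|) := by
          apply integral_mono
          · exact ((hbf x).sub (hbf (a i))).abs
          · exact ((((hVi x).sub (hdi n)).abs).add (((hVi (a i)).sub (hdi n)).abs)).const_mul C
          · intro y
            show |V x y * f y - V (a i) y * f y| ≤ C * (|V x y - d n y| + |V (a i) y - d n y|)
            rw [← sub_mul, abs_mul, mul_comm]
            apply mul_le_mul (hC y) _ (abs_nonneg _) hC0
            rw [abs_sub_comm (V (a i) y)]
            exact abs_sub_le _ _ _
      _ = C * ((∫ y, |V x y - d n y|) + ∫ y, |V (a i) y - d n y|) := by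
          rw [integral_const_mul, integral_add (hid x) (hid (a i))]
      _ ≤ _ := by
          apply mul_le_mul_of_nonneg_left _ hC0
          linarith
  have hlim : Tendsto (fun k : ℕ => C * (2 * (1 / ((k : ℝ) + 1)))) atTop (𝓝 (C * (2 * 0))) :=
    (tendsto_one_div_add_atTop_nhds_zero_nat.const_mul 2).const_mul C
  have := ge_of_tendsto' hlim hkey
  simpa using this

lemma gr_rn {Z Y : Type*} [MeasurableSpace Z] [MeasurableSpace Y] (ρ : Measure Z) [IsFiniteMeasure ρ]
    (Φ : Z → Y) (hΦ : Measurable Φ) (D : Z → ℝ) (hD : Measurable D) (hD1 : ∀ z, D z ∈ Set.Icc (0:ℝ) 1) :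
    ∃ F : Y → ℝ, Measurable F ∧ (∀ y, F y ∈ Set.Icc (0:ℝ) 1) ∧
      ∀ G : Y → ℝ, Measurable G → ∫ z, D z * G (Φ z) ∂ρ = ∫ z, F (Φ z) * G (Φ z) ∂ρ := by
  set α : Measure Y := (ρ.withDensity fun z => ENNReal.ofReal (D z)).map Φ with hα
  set ν : Measure Y := ρ.map Φ with hν
  have hle : ρ.withDensity (fun z => ENNReal.ofReal (D z)) ≤ ρ := by
    conv_rhs => rw [← withDensity_one (μ := ρ)]
    apply withDensity_mono
    exact Eventually.of_forall fun z => ENNReal.ofReal_le_one.2 (hD1 z).2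
  have hfin := isFiniteMeasure_of_le _ hle
  have hle' : α ≤ ν := Measure.map_mono hle hΦ
  have h1 := Measure.rnDeriv_le_one_of_le hle'
  have hac : α ≪ ν := Measure.absolutelyContinuous_of_le hle'
  have h2 := Measure.withDensity_rnDeriv_eq α ν hac
  set F : Y → ℝ := fun y => min 1 (α.rnDeriv ν y).toReal with hF
  have hFm : Measurable F := measurable_const.min (Measure.measurable_rnDeriv α ν).ennreal_toReal
  have hF0 : ∀ y, F y ∈ Set.Icc (0:ℝ) 1 := fun y => ⟨le_min zero_le_one ENNReal.toReal_nonneg, min_le_left _ _⟩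
  refine ⟨F, hFm, hF0, fun G hG => ?_⟩
  have h3 : α = ν.withDensity fun y => ENNReal.ofReal (F y) := by
    rw [← h2]
    apply withDensity_congr_ae
    filter_upwards [h1] with y hy
    have hy1 : α.rnDeriv ν y ≤ 1 := hy
    have : F y = (α.rnDeriv ν y).toReal := by
      apply min_eq_right
      exact ENNReal.toReal_le_of_le_ofReal zero_le_one (by simpa using hy1)
    rw [this, ENNReal.ofReal_toReal (ne_top_of_le_ne_top ENNReal.one_ne_top hy1)]
  have e1 : ∫ y, G y ∂α = ∫ z, D z * G (Φ z) ∂ρ := by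
    rw [hα, integral_map hΦ.aemeasurable hG.aestronglyMeasurable,
      integral_withDensity_eq_integral_toReal_smul hD.ennreal_ofReal (Eventually.of_forall fun z => ENNReal.ofReal_lt_top)]
    simp [ENNReal.toReal_ofReal (hD1 _).1]
  have e2 : ∫ y, G y ∂α = ∫ z, F (Φ z) * G (Φ z) ∂ρ := by
    rw [h3, integral_withDensity_eq_integral_toReal_smul hFm.ennreal_ofReal (Eventually.of_forall fun z => ENNReal.ofReal_lt_top),
      hν, integral_map hΦ.aemeasurable]
    · simp [ENNReal.toReal_ofReal (hF0 _).1]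
    · exact (hFm.ennreal_ofReal.ennreal_toReal.smul hG).aestronglyMeasurable
  rw [← e1, e2]

/-- slices -/
lemma gr_slice (K : I → I → ℝ) (hK : Measurable (Function.uncurry K)) (hK1 : ∀ x y, |K x y| ≤ 1)
    (u f : I → ℝ) (hu : Measurable u) (hf : Measurable f) (hu1 : ∀ x, |u x| ≤ 1) (hf1 : ∀ x, |f x| ≤ 1)
    (h : ∀ᵐ x, ∫ y, K x y * f y = 0) :
    ∫ p : I × I, K p.1 p.2 * (u p.1 * f p.2) ∂((volume : Measure I).prod volume) = 0 := by
  rw [integral_prod]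
  · rw [integral_eq_zero_of_ae]
    filter_upwards [h] with x hx
    have : ∀ y, K x y * (u x * f y) = u x * (K x y * f y) := fun y => by ring
    simp only [this]
    rw [integral_const_mul, hx, mul_zero]
    rfl
  · apply gr_bdd_integrable (hK.mul ((hu.comp measurable_fst).mul (hf.comp measurable_snd))) 1
    intro p
    show |K p.1 p.2 * (u p.1 * f p.2)| ≤ 1
    rw [abs_mul, abs_mul]
    exact mul_le_one₀ (hK1 _ _) (by positivity) (mul_le_one₀ (hu1 _) (abs_nonneg _) (hf1 _))

lemma gr_slice' (K : I → I → ℝ) (hK : Measurable (Function.uncurry K)) (hK1 : ∀ x y, |K x y| ≤ 1)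
    (u f : I → ℝ) (hu : Measurable u) (hf : Measurable f) (hu1 : ∀ x, |u x| ≤ 1) (hf1 : ∀ x, |f x| ≤ 1)
    (h : ∀ᵐ y, ∫ x, K x y * f x = 0) :
    ∫ p : I × I, K p.1 p.2 * (f p.1 * u p.2) ∂((volume : Measure I).prod volume) = 0 := by
  rw [← gr_slice (fun x y => K y x) (hK.comp measurable_swap) (fun x y => hK1 y x) u f hu hf hu1 hf1 h,
    ← integral_prod_swap]
  congr 1; ext p
  simp [mul_comm]

/-- from operator square to operator -/
lemma gr_opsq {U : I → I → ℝ} (hU : IsGraphon U) (f : I → ℝ) (hf : Measurable f) (hf1 : ∀ x, |f x| ≤ 1)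
    (h : ∀ᵐ x, ∫ y, grV U x y * f y = 0) : ∀ᵐ x, ∫ y, U x y * f y = 0 := by
  have hUa : ∀ x y, |U x y| ≤ 1 := fun x y => by rw [abs_of_nonneg (hU.2.2 _ _).1]; exact (hU.2.2 _ _).2
  set g : I → ℝ := fun z => ∫ y, U z y * f y with hg
  have hgm : Measurable g := by
    have : Measurable fun q : I × I => U q.1 q.2 * f q.2 := hU.1.mul (hf.comp measurable_snd)
    exact this.stronglyMeasurable.integral_prod_right'.measurable
  have hg1 : ∀ z, |g z| ≤ 1 := by
    intro z
    have := norm_integral_le_of_norm_le_const (μ := (volume : Measure I)) (f := fun y => U z y * f y) (C := 1)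
      (Eventually.of_forall fun y => by
        rw [Real.norm_eq_abs, abs_mul]
        exact mul_le_one₀ (hUa _ _) (abs_nonneg _) (hf1 _))
    simpa using this
  have hVf : ∀ x, ∫ y, grV U x y * f y = ∫ z, U x z * g z := by
    intro x
    simp only [grV, hg, ← integral_const_mul, ← integral_mul_const]
    rw [integral_integral_swap]
    · congr 1; ext z; congr 1; ext y; ring
    · apply gr_bdd_integrable (f := Function.uncurry fun y z => U x z * U z y * f y) _ 1
      · intro p
        show |U x p.2 * U p.2 p.1 * f p.1| ≤ 1
        rw [abs_mul, abs_mul]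
        exact mul_le_one₀ (mul_le_one₀ (hUa _ _) (abs_nonneg _) (hUa _ _)) (abs_nonneg _) (hf1 _)
      · exact ((gr_meas2 hU.1 measurable_const measurable_snd).mul (gr_meas2 hU.1 measurable_snd measurable_fst)).mul
          (hf.comp measurable_fst)
  have h0 : ∫ p : I × I, U p.1 p.2 * (f p.1 * g p.2) ∂((volume : Measure I).prod volume) = 0 := by
    apply gr_slice U hU.1 hUa f g hf hgm hf1 hg1
    filter_upwards [h] with x hx
    rw [← hVf, hx]
  have h1 : ∫ p : I × I, U p.1 p.2 * (f p.1 * g p.2) ∂((volume : Measure I).prod volume) = ∫ z, g z * g z := by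
    rw [integral_prod_symm]
    · congr 1; ext z
      simp only [hg]
      rw [← integral_mul_const]
      congr 1; ext x
      rw [hU.2.1 z x]; ring
    · apply gr_bdd_integrable (hU.1.mul ((hf.comp measurable_fst).mul (hgm.comp measurable_snd))) 1
      intro p
      show |U p.1 p.2 * (f p.1 * g p.2)| ≤ 1
      rw [abs_mul, abs_mul]
      exact mul_le_one₀ (hUa _ _) (by positivity) (mul_le_one₀ (hf1 _) (abs_nonneg _) (hg1 _))
  rw [h1] at h0
  have h2 := (integral_eq_zero_iff_of_nonneg (fun z => mul_self_nonneg (g z))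
    (gr_bdd_integrable (hgm.mul hgm) 1 (fun z => by
      show |g z * g z| ≤ 1
      rw [abs_mul]; exact mul_le_one₀ (hg1 _) (abs_nonneg _) (hg1 _)))).1 h0
  filter_upwards [h2] with z hz
  exact mul_self_eq_zero.1 hz

/-- types -/
noncomputable def grPhi (U : I → I → ℝ) (a : ℕ → I) (y : I) : ℕ → I :=
  fun i => Set.projIcc 0 1 zero_le_one (grV U (a i) y)

lemma grPhi_coe {U : I → I → ℝ} (hU : IsGraphon U) (a : ℕ → I) (y : I) (i : ℕ) :
    (grPhi U a y i : ℝ) = grV U (a i) y := by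
  unfold grPhi
  rw [Set.projIcc_of_mem zero_le_one (grV_mem hU _ _)]

lemma grPhi_meas {U : I → I → ℝ} (hU : IsGraphon U) (a : ℕ → I) : Measurable (grPhi U a) := by
  rw [measurable_pi_iff]
  intro i
  exact continuous_projIcc.measurable.comp (gr_meas2 (grV_meas hU) measurable_const measurable_id)

lemma gr_factor {U : I → I → ℝ} (hU : IsGraphon U) (a : ℕ → I) (ha : GrGood (grV U) a) :
    ∃ h : (ℕ → I) × (ℕ → I) → ℝ, Measurable h ∧ (∀ y, h y ∈ Set.Icc (0:ℝ) 1) ∧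
      ∀ᵐ p ∂((volume : Measure I).prod (volume : Measure I)), U p.1 p.2 = h (grPhi U a p.1, grPhi U a p.2) := by
  have hUa : ∀ x y, |U x y| ≤ 1 := fun x y => by rw [abs_of_nonneg (hU.2.2 _ _).1]; exact (hU.2.2 _ _).2
  have hΦ := grPhi_meas hU a
  have hΦΦ : Measurable fun p : I × I => (grPhi U a p.1, grPhi U a p.2) :=
    (hΦ.comp measurable_fst).prodMk (hΦ.comp measurable_snd)
  obtain ⟨h, hm, h01, hh⟩ := gr_rn ((volume : Measure I).prod (volume : Measure I)) _ hΦΦ (Function.uncurry U) hU.1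
    (fun z => hU.2.2 _ _)
  refine ⟨h, hm, h01, ?_⟩
  set H : I → I → ℝ := fun x y => h (grPhi U a x, grPhi U a y) with hH
  have hHm : Measurable (Function.uncurry H) := hm.comp hΦΦ
  have hH1 : ∀ x y, |H x y| ≤ 1 := fun x y => by rw [abs_of_nonneg (h01 _).1]; exact (h01 _).2
  have key : ∀ s t : Set I, MeasurableSet s → MeasurableSet t →
      ∫ p : I × I, U p.1 p.2 * (s.indicator 1 p.1 * t.indicator 1 p.2) ∂((volume : Measure I).prod volume) =
      ∫ p : I × I, H p.1 p.2 * (s.indicator 1 p.1 * t.indicator 1 p.2) ∂((volume : Measure I).prod volume) := by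
    intro s t hs ht
    have hi01 : ∀ (s : Set I) (x : I), (s.indicator 1 x : ℝ) ∈ Set.Icc (0:ℝ) 1 := by
      intro s x
      by_cases hx : x ∈ s <;> simp [hx]
    have hima : ∀ s : Set I, MeasurableSet s → Measurable (s.indicator (1 : I → ℝ)) := fun s hs =>
      measurable_one.indicator hs
    obtain ⟨F, hFm, hF1, hF⟩ := gr_rn (volume : Measure I) _ hΦ (s.indicator (1 : I → ℝ)) (hima s hs) (hi01 s)
    obtain ⟨F', hFm', hF1', hF'⟩ := gr_rn (volume : Measure I) _ hΦ (t.indicator (1 : I → ℝ)) (hima t ht) (hi01 t)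
    -- general facts
    have gen : ∀ (s : Set I) (hs : MeasurableSet s) (F : (ℕ → I) → ℝ), Measurable F → (∀ y, F y ∈ Set.Icc (0:ℝ) 1) →
        (∀ G : (ℕ → I) → ℝ, Measurable G → ∫ z, s.indicator 1 z * G (grPhi U a z) = ∫ z, F (grPhi U a z) * G (grPhi U a z)) →
        (Measurable fun y => s.indicator (1 : I → ℝ) y - F (grPhi U a y)) ∧
        (∀ y, |s.indicator (1 : I → ℝ) y - F (grPhi U a y)| ≤ 1) ∧
        (∀ G : (ℕ → I) → ℝ, Measurable G → (∀ y, |G y| ≤ 1) →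
          ∫ y, G (grPhi U a y) * (s.indicator (1 : I → ℝ) y - F (grPhi U a y)) = 0) ∧
        ∀ᵐ x, ∫ y, U x y * (s.indicator (1 : I → ℝ) y - F (grPhi U a y)) = 0 := by
      intro s hs F hFm hF1 hF
      have m1 : (Measurable fun y => s.indicator (1 : I → ℝ) y - F (grPhi U a y)) :=
        (hima s hs).sub (hFm.comp hΦ)
      have m2 : (∀ y, |s.indicator (1 : I → ℝ) y - F (grPhi U a y)| ≤ 1) := by
        intro y
        have := hi01 s y
        have := hF1 (grPhi U a y)
        simp only [Set.mem_Icc] at *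
        rw [abs_le]; constructor <;> linarith
      have m3 : (∀ G : (ℕ → I) → ℝ, Measurable G → (∀ y, |G y| ≤ 1) →
          ∫ y, G (grPhi U a y) * (s.indicator (1 : I → ℝ) y - F (grPhi U a y)) = 0) := by
        intro G hG hG1
        have e : ∀ y, G (grPhi U a y) * (s.indicator (1 : I → ℝ) y - F (grPhi U a y)) =
          s.indicator (1 : I → ℝ) y * G (grPhi U a y) - F (grPhi U a y) * G (grPhi U a y) := fun y => by ring
        simp only [e]
        rw [integral_sub, hF G hG, sub_self]
        · apply gr_bdd_integrable ((hima s hs).mul (hG.comp hΦ)) 1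
          intro y
          show |s.indicator (1 : I → ℝ) y * G (grPhi U a y)| ≤ 1
          rw [abs_mul, abs_of_nonneg (hi01 s y).1]
          exact mul_le_one₀ (hi01 s y).2 (abs_nonneg _) (hG1 _)
        · apply gr_bdd_integrable ((hFm.comp hΦ).mul (hG.comp hΦ)) 1
          intro y
          show |F (grPhi U a y) * G (grPhi U a y)| ≤ 1
          rw [abs_mul, abs_of_nonneg (hF1 _).1]
          exact mul_le_one₀ (hF1 _).2 (abs_nonneg _) (hG1 _)
      refine ⟨m1, m2, m3, gr_opsq hU _ m1 m2 (ha _ m1 1 m2 fun i => ?_)⟩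
      have := m3 (fun y => (y i : ℝ)) (by fun_prop) (fun y => by
        rw [abs_of_nonneg (y i).2.1]; exact (y i).2.2)
      simpa only [grPhi_coe hU] using this
    obtain ⟨p1, p2, p3, p4⟩ := gen s hs F hFm hF1 hF
    obtain ⟨q1, q2, q3, q4⟩ := gen t ht F' hFm' hF1' hF'
    -- abstract chain
    have hFΦ1 : ∀ x, |F (grPhi U a x)| ≤ 1 := fun x => by rw [abs_of_nonneg (hF1 _).1]; exact (hF1 _).2
    have hia : ∀ x, |t.indicator (1 : I → ℝ) x| ≤ 1 := fun x => by rw [abs_of_nonneg (hi01 _ _).1]; exact (hi01 _ _).2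
    have chain : ∀ K : I → I → ℝ, Measurable (Function.uncurry K) → (∀ x y, |K x y| ≤ 1) →
        (∀ᵐ y, ∫ x, K x y * (s.indicator (1 : I → ℝ) x - F (grPhi U a x)) = 0) →
        (∀ᵐ x, ∫ y, K x y * (t.indicator (1 : I → ℝ) y - F' (grPhi U a y)) = 0) →
        ∫ p : I × I, K p.1 p.2 * (s.indicator 1 p.1 * t.indicator 1 p.2) ∂((volume : Measure I).prod volume) =
        ∫ p : I × I, K p.1 p.2 * (F (grPhi U a p.1) * F' (grPhi U a p.2)) ∂((volume : Measure I).prod volume) := by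
      intro K hK hK1 k1 k2
      have c1 := gr_slice' K hK hK1 (t.indicator (1 : I → ℝ)) _ (hima t ht) p1 hia p2 k1
      have c2 := gr_slice K hK hK1 (fun x => F (grPhi U a x)) _ (hFm.comp hΦ) q1 hFΦ1 q2 k2
      have hint : ∀ u v : I → ℝ, Measurable u → Measurable v → (∀ x, |u x| ≤ 1) → (∀ x, |v x| ≤ 1) →
          Integrable (fun p : I × I => K p.1 p.2 * (u p.1 * v p.2)) ((volume : Measure I).prod volume) := by
        intro u v hu hv hu1 hv1
        apply gr_bdd_integrable (hK.mul ((hu.comp measurable_fst).mul (hv.comp measurable_snd))) 1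
        intro p
        show |K p.1 p.2 * (u p.1 * v p.2)| ≤ 1
        rw [abs_mul, abs_mul]
        exact mul_le_one₀ (hK1 _ _) (by positivity) (mul_le_one₀ (hu1 _) (abs_nonneg _) (hv1 _))
      have i1 := hint _ _ p1 (hima t ht) p2 hia
      have i2 := hint (fun x => F (grPhi U a x)) _ (hFm.comp hΦ) q1 hFΦ1 q2
      have i3 := hint (fun x => F (grPhi U a x)) (fun x => F' (grPhi U a x)) (hFm.comp hΦ) (hFm'.comp hΦ) hFΦ1
        (fun x => by rw [abs_of_nonneg (hF1' _).1]; exact (hF1' _).2)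
      have e : ∀ p : I × I, K p.1 p.2 * (s.indicator 1 p.1 * t.indicator 1 p.2) =
        (K p.1 p.2 * ((s.indicator 1 p.1 - F (grPhi U a p.1)) * t.indicator 1 p.2) +
         K p.1 p.2 * (F (grPhi U a p.1) * (t.indicator 1 p.2 - F' (grPhi U a p.2)))) +
        K p.1 p.2 * (F (grPhi U a p.1) * F' (grPhi U a p.2)) := fun p => by ring
      simp only [e]
      have i12 : Integrable (fun p : I × I => K p.1 p.2 * ((s.indicator 1 p.1 - F (grPhi U a p.1)) * t.indicator 1 p.2) +
         K p.1 p.2 * (F (grPhi U a p.1) * (t.indicator 1 p.2 - F' (grPhi U a p.2)))) ((volume : Measure I).prod volume) := i1.add i2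
      rw [integral_add i12 i3, integral_add i1 i2, c1, c2]
      simp
    rw [chain U hU.1 hUa ?_ q4, chain H hHm hH1 ?_ ?_]
    · exact hh (fun y => F y.1 * F' y.2) (by fun_prop)
    · exact Eventually.of_forall fun y => p3 (fun z => h (z, grPhi U a y)) (by fun_prop) (fun z => by
        rw [abs_of_nonneg (h01 _).1]; exact (h01 _).2)
    · exact Eventually.of_forall fun x => q3 (fun z => h (grPhi U a x, z)) (by fun_prop) (fun z => by
        rw [abs_of_nonneg (h01 _).1]; exact (h01 _).2)
    · filter_upwards [p4] with y hy
      simpa only [hU.2.1 y] using hy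
  -- conclude
  have hint : ∀ K : I → I → ℝ, Measurable (Function.uncurry K) → (∀ x y, K x y ∈ Set.Icc (0:ℝ) 1) →
      ∀ s t : Set I, MeasurableSet s → MeasurableSet t →
      (((volume : Measure I).prod volume).withDensity fun p => ENNReal.ofReal (K p.1 p.2)) (s ×ˢ t) =
      ENNReal.ofReal (∫ p : I × I, K p.1 p.2 * (s.indicator 1 p.1 * t.indicator 1 p.2) ∂((volume : Measure I).prod volume)) := by
    intro K hK hK1 s t hs ht
    have hKi : Integrable (fun p : I × I => K p.1 p.2) ((volume : Measure I).prod volume) :=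
      gr_bdd_integrable hK 1 (fun p => by
        show |K p.1 p.2| ≤ 1
        rw [abs_of_nonneg (hK1 _ _).1]; exact (hK1 _ _).2)
    rw [withDensity_apply _ (hs.prod ht), ← ofReal_integral_eq_lintegral_ofReal hKi.restrict (Eventually.of_forall fun p => (hK1 _ _).1),
      ← integral_indicator (hs.prod ht)]
    congr 2; ext p
    by_cases h1 : p.1 ∈ s <;> by_cases h2 : p.2 ∈ t <;> simp [Set.indicator, h1, h2]
  have hEq : (((volume : Measure I).prod volume).withDensity fun p => ENNReal.ofReal (U p.1 p.2)) =
      (((volume : Measure I).prod volume).withDensity fun p => ENNReal.ofReal (H p.1 p.2)) := by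
    have : IsFiniteMeasure (((volume : Measure I).prod volume).withDensity fun p => ENNReal.ofReal (U p.1 p.2)) := by
      constructor
      rw [← Set.univ_prod_univ, hint U hU.1 hU.2.2 _ _ MeasurableSet.univ MeasurableSet.univ]
      exact ENNReal.ofReal_lt_top
    apply Measure.ext_prod
    intro s t hs ht
    rw [hint U hU.1 hU.2.2 s t hs ht, hint H hHm (fun x y => h01 _) s t hs ht, key s t hs ht]
  have hae := (withDensity_eq_iff_of_sigmaFinite hU.1.ennreal_ofReal.aemeasurable hHm.ennreal_ofReal.aemeasurable).1 hEq
  filter_upwards [hae] with p hp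
  exact (ENNReal.ofReal_eq_ofReal_iff (hU.2.2 _ _).1 (h01 _).1).1 hp

lemma gr_choose {S T : Set (ℕ → I)} {X : Type*} [TopologicalSpace X] [T2Space X] [SecondCountableTopology X]
    [MeasurableSpace X] [BorelSpace X] (u w : (ℕ → I) → X)
    (hu : Measurable u) (hw : Measurable w) (h : grInf.map u = grInf.map w)
    (hS : ∀ᵐ a ∂grInf, a ∈ S) (hT : ∀ᵐ a ∂grInf, a ∈ T) : ∃ a ∈ S, ∃ b ∈ T, u a = w b := by
  set S' := (toMeasurable grInf Sᶜ)ᶜ with hS'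
  set T' := (toMeasurable grInf Tᶜ)ᶜ with hT'
  have hSS : S' ⊆ S := by
    rw [hS', Set.compl_subset_comm]; exact subset_toMeasurable _ _
  have hTT : T' ⊆ T := by
    rw [hT', Set.compl_subset_comm]; exact subset_toMeasurable _ _
  have hSm : MeasurableSet S' := (measurableSet_toMeasurable _ _).compl
  have hTm : MeasurableSet T' := (measurableSet_toMeasurable _ _).compl
  have hS0 : grInf S'ᶜ = 0 := by
    rw [hS', compl_compl, measure_toMeasurable]; exact hS
  have hT0 : grInf T'ᶜ = 0 := by
    rw [hT', compl_compl, measure_toMeasurable]; exact hT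
  by_contra hcon
  push Not at hcon
  have hA := hSm.analyticSet_image hu
  have hB := hTm.analyticSet_image hw
  have hdis : Disjoint (u '' S') (w '' T') := by
    rw [Set.disjoint_left]
    rintro _ ⟨a, ha, rfl⟩ ⟨b, hb, hab⟩
    exact hcon a (hSS ha) b (hTT hb) hab.symm
  obtain ⟨D, hD1, hD2, hDm⟩ := hA.measurablySeparable hB hdis
  have e : grInf (u ⁻¹' D) = grInf (w ⁻¹' D) := by
    rw [← Measure.map_apply hu hDm, h, Measure.map_apply hw hDm]
  have e1 : grInf (w ⁻¹' D) = 0 := by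
    apply measure_mono_null _ hT0
    intro b hb hb'
    exact Set.disjoint_left.1 hD2 ⟨b, hb', rfl⟩ hb
  have e2 : grInf (u ⁻¹' D)ᶜ = 0 := by
    apply measure_mono_null _ hS0
    intro a ha ha'
    exact ha (hD1 ⟨a, ha', rfl⟩)
  have e3 : grInf (Set.univ) = 0 := by
    rw [← Set.union_compl_self (u ⁻¹' D)]
    exact measure_union_null (e.trans e1) e2
  simp at e3

noncomputable def grPsi (U : I → I → ℝ) (a : ℕ → I) (p : I × I) : (ℕ → I) × (ℕ → I) :=
  (grPhi U a p.1, grPhi U a p.2)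

lemma grPsi_meas {U : I → I → ℝ} (hU : IsGraphon U) (a : ℕ → I) : Measurable (grPsi U a) :=
  ((grPhi_meas hU a).comp measurable_fst).prodMk ((grPhi_meas hU a).comp measurable_snd)

lemma grPsi_mp {U : I → I → ℝ} (hU : IsGraphon U) (a : ℕ → I) :
    ((volume : Measure I).prod (volume : Measure I)).map (grPsi U a) =
      ((volume : Measure I).map (grPhi U a)).prod ((volume : Measure I).map (grPhi U a)) :=
  (Measure.map_prod_map _ _ (grPhi_meas hU a) (grPhi_meas hU a)).symm

def grC (s : ℕ × Bool) (z : (ℕ → I) × (ℕ → I)) : I := if s.2 = true then z.1 s.1 else z.2 s.1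

lemma grC_cont (s : ℕ × Bool) : Continuous (grC s) := by
  unfold grC
  split_ifs <;> fun_prop

lemma grC_sep (x y : (ℕ → I) × (ℕ → I)) (h : ∀ s, grC s x = grC s y) : x = y := by
  apply Prod.ext
  · ext i
    simpa [grC] using congrArg Subtype.val (h (i, true))
  · ext i
    simpa [grC] using congrArg Subtype.val (h (i, false))

lemma grC_psi {U : I → I → ℝ} (hU : IsGraphon U) (a : ℕ → I) (s : ℕ × Bool) (p : I × I) :
    (grC s (grPsi U a p) : ℝ) = grV U (a s.1) (if s.2 = true then p.1 else p.2) := by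
  unfold grC grPsi
  split_ifs <;> simp [grPhi_coe hU]

lemma grC_listm (l : List (ℕ × Bool)) : Measurable fun z => (l.map fun s => (grC s z : ℝ)).prod :=
  gr_listprod_meas l (fun s z => (grC s z : ℝ)) (fun s => measurable_subtype_coe.comp (grC_cont s).measurable)

lemma gr_match (U W : I → I → ℝ) (hU : IsGraphon U) (hW : IsGraphon W) (a b : ℕ → I)
    (ha : GrGood (grV U) a) (hb : GrGood (grV W) b) (hab : grMom U a = grMom W b) :
    (volume : Measure I).map (grPhi U a) = (volume : Measure I).map (grPhi W b) ∧
    ∃ h : (ℕ → I) × (ℕ → I) → ℝ, Measurable h ∧ (∀ y, h y ∈ Set.Icc (0:ℝ) 1) ∧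
      (∀ᵐ p ∂((volume : Measure I).prod (volume : Measure I)), U p.1 p.2 = h (grPsi U a p)) ∧
      (∀ᵐ p ∂((volume : Measure I).prod (volume : Measure I)), W p.1 p.2 = h (grPsi W b p)) := by
  have hmom : ∀ k, grMomR U a k = grMomR W b k := fun k => by
    rw [← grMom_coe hU, ← grMom_coe hW, hab]
  have hmU := grPsi_meas hU a
  have hmW := grPsi_meas hW b
  have := Measure.isProbabilityMeasure_map (μ := (volume : Measure I).prod (volume : Measure I)) hmU.aemeasurable
  have := Measure.isProbabilityMeasure_map (μ := (volume : Measure I).prod (volume : Measure I)) hmW.aemeasurable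
  have hM : ((volume : Measure I).prod (volume : Measure I)).map (grPsi U a) =
      ((volume : Measure I).prod (volume : Measure I)).map (grPsi W b) := by
    apply gr_measure_ext _ _ grC grC_cont grC_sep
    intro l
    rw [integral_map hmU.aemeasurable (grC_listm l).aestronglyMeasurable,
      integral_map hmW.aemeasurable (grC_listm l).aestronglyMeasurable]
    simp only [grC_psi hU, grC_psi hW]
    simpa [grMomR] using hmom (false, l)
  refine ⟨?_, ?_⟩
  · have := congrArg (fun m => m.map Prod.fst) hM
    simp only [grPsi_mp hU, grPsi_mp hW] at this
    have p1 := Measure.isProbabilityMeasure_map (μ := (volume : Measure I)) (grPhi_meas hU a).aemeasurable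
    have p2 := Measure.isProbabilityMeasure_map (μ := (volume : Measure I)) (grPhi_meas hW b).aemeasurable
    simpa using this
  · obtain ⟨h, hm, h1, hh⟩ := gr_factor hU a ha
    obtain ⟨h', hm', h1', hh'⟩ := gr_factor hW b hb
    refine ⟨h, hm, h1, hh, ?_⟩
    set M := ((volume : Measure I).prod (volume : Measure I)).map (grPsi U a) with hMd
    have gen : ∀ (g : (ℕ → I) × (ℕ → I) → ℝ), Measurable g → (∀ y, g y ∈ Set.Icc (0:ℝ) 1) →
        IsFiniteMeasure (M.withDensity fun y => ENNReal.ofReal (g y)) ∧ ∀ l : List (ℕ × Bool),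
        ∫ z, (l.map fun s => (grC s z : ℝ)).prod ∂(M.withDensity fun y => ENNReal.ofReal (g y)) =
        ∫ z, g z * (l.map fun s => (grC s z : ℝ)).prod ∂M := by
      intro g hg hg1
      constructor
      · apply isFiniteMeasure_of_le M
        conv_rhs => rw [← withDensity_one (μ := M)]
        apply withDensity_mono
        exact Eventually.of_forall fun z => ENNReal.ofReal_le_one.2 (hg1 z).2
      · intro l
        rw [integral_withDensity_eq_integral_toReal_smul hg.ennreal_ofReal (Eventually.of_forall fun z => ENNReal.ofReal_lt_top)]
        simp [ENNReal.toReal_ofReal (hg1 _).1]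
    have f1 := (gen h hm h1).1
    have f2 := (gen h' hm' h1').1
    have hEq : (M.withDensity fun y => ENNReal.ofReal (h y)) = (M.withDensity fun y => ENNReal.ofReal (h' y)) := by
      apply gr_measure_ext _ _ grC grC_cont grC_sep
      intro l
      rw [(gen h hm h1).2, (gen h' hm' h1').2]
      have e1 : ∫ z, h z * (l.map fun s => (grC s z : ℝ)).prod ∂M = grMomR U a (true, l) := by
        rw [hMd, integral_map hmU.aemeasurable (show Measurable fun z => h z * (l.map fun s => (grC s z : ℝ)).prod from hm.mul (grC_listm l)).aestronglyMeasurable]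
        unfold grMomR
        apply integral_congr_ae
        filter_upwards [hh] with p hp
        simp only [grC_psi hU, hp, if_true]
        rfl
      have e2 : ∫ z, h' z * (l.map fun s => (grC s z : ℝ)).prod ∂M = grMomR W b (true, l) := by
        rw [hM, integral_map hmW.aemeasurable (show Measurable fun z => h' z * (l.map fun s => (grC s z : ℝ)).prod from hm'.mul (grC_listm l)).aestronglyMeasurable]
        unfold grMomR
        apply integral_congr_ae
        filter_upwards [hh'] with p hp
        simp only [grC_psi hW, hp, if_true]
        rfl
      rw [e1, e2, hmom]
    have hae := (withDensity_eq_iff_of_sigmaFinite hm.ennreal_ofReal.aemeasurable hm'.ennreal_ofReal.aemeasurable).1 hEq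
    rw [hM] at hae
    have hae' := ae_of_ae_map hmW.aemeasurable hae
    filter_upwards [hae', hh'] with p hp hp'
    rw [hp']
    exact ((ENNReal.ofReal_eq_ofReal_iff (h1 _).1 (h1' _).1).1 hp).symm

lemma gr_cells {X : Type*} [MetricSpace X] [CompactSpace X] [MeasurableSpace X] [BorelSpace X] [Nonempty X]
    (Φ Ψ : I → X) (hΦ : Measurable Φ) (hΨ : Measurable Ψ)
    (hlaw : (volume : Measure I).map Φ = (volume : Measure I).map Ψ)
    (h : X × X → ℝ) (hm : Measurable h) (h1 : ∀ y, h y ∈ Set.Icc (0:ℝ) 1) (ε : ℝ) (hε : 0 < ε) :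
    ∃ φ : I → I, MeasurePreserving φ (volume : Measure I) (volume : Measure I) ∧
      ∫ p : I × I, |h (Φ p.1, Φ p.2) - h (Ψ (φ p.1), Ψ (φ p.2))| ∂((volume : Measure I).prod (volume : Measure I)) ≤ 3 * ε := by
  set ν := (volume : Measure I).map Φ with hν
  have pν : IsProbabilityMeasure ν := Measure.isProbabilityMeasure_map hΦ.aemeasurable
  have hha : ∀ y, |h y| ≤ 1 := fun y => by rw [abs_of_nonneg (h1 _).1]; exact (h1 _).2
  have hi : Integrable h (ν.prod ν) := gr_bdd_integrable hm 1 hha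
  obtain ⟨c, hc, hci⟩ := hi.exists_boundedContinuous_integral_sub_le hε
  have huc : UniformContinuous c := CompactSpace.uniformContinuous_of_continuous c.continuous
  obtain ⟨δ, hδ, hcδ⟩ := Metric.uniformContinuous_iff.1 huc ε hε
  obtain ⟨d, hd⟩ := TopologicalSpace.exists_dense_seq X
  have hex : ∀ x, ∃ n, dist x (d n) < δ / 2 := fun x => hd.exists_dist_lt x (by positivity)
  let j : X → ℕ := fun x => Nat.find (hex x)
  have hj : Measurable j := measurable_find hex fun n =>
    measurableSet_lt (measurable_id.dist measurable_const) measurable_const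
  have hjd : ∀ x y, j x = j y → dist x y < δ := by
    intro x y hxy
    have e1 : dist x (d (j x)) < δ / 2 := Nat.find_spec (hex x)
    have e2 : dist y (d (j y)) < δ / 2 := Nat.find_spec (hex y)
    rw [← hxy] at e2
    have := dist_triangle_right x y (d (j x))
    linarith
  obtain ⟨φ, hφ, hφj⟩ := gr_coupling (fun x => j (Φ x)) (fun x => j (Ψ x)) (hj.comp hΦ) (hj.comp hΨ) (by
    have e1 := Measure.map_map (μ := (volume : Measure I)) hj hΦ
    have e2 := Measure.map_map (μ := (volume : Measure I)) hj hΨ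
    show (volume : Measure I).map (j ∘ Φ) = (volume : Measure I).map (j ∘ Ψ)
    rw [← e1, ← e2, ← hlaw])
  refine ⟨φ, hφ, ?_⟩
  have mpA : MeasurePreserving Φ (volume : Measure I) ν := ⟨hΦ, rfl⟩
  have mpB : MeasurePreserving (Ψ ∘ φ) (volume : Measure I) ν := (MeasurePreserving.mk hΨ hlaw.symm).comp hφ
  have MA := mpA.prod mpA
  have MB := mpB.prod mpB
  have hdiff : Integrable (fun y => |h y - c y|) (ν.prod ν) := (hi.sub hci).abs
  have hdiff1 : ∫ y, |h y - c y| ∂(ν.prod ν) ≤ ε := hc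
  have IA := MA.integrable_comp_of_integrable hdiff
  have IB := MB.integrable_comp_of_integrable hdiff
  have EA : ∫ p : I × I, |h (Φ p.1, Φ p.2) - c (Φ p.1, Φ p.2)| ∂((volume : Measure I).prod (volume : Measure I)) ≤ ε := by
    rw [← MA.map_eq, integral_map MA.measurable.aemeasurable (MA.map_eq ▸ hdiff.aestronglyMeasurable)] at hdiff1
    exact hdiff1
  have EB : ∫ p : I × I, |h (Ψ (φ p.1), Ψ (φ p.2)) - c (Ψ (φ p.1), Ψ (φ p.2))| ∂((volume : Measure I).prod (volume : Measure I)) ≤ ε := by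
    rw [← MB.map_eq, integral_map MB.measurable.aemeasurable (MB.map_eq ▸ hdiff.aestronglyMeasurable)] at hdiff1
    exact hdiff1
  have IA' : Integrable (fun p : I × I => |h (Φ p.1, Φ p.2) - c (Φ p.1, Φ p.2)| + ε) ((volume : Measure I).prod (volume : Measure I)) :=
    IA.add (integrable_const ε)
  have IB' : Integrable (fun p : I × I => |h (Ψ (φ p.1), Ψ (φ p.2)) - c (Ψ (φ p.1), Ψ (φ p.2))|) ((volume : Measure I).prod (volume : Measure I)) := IB
  have ae1 := (Measure.quasiMeasurePreserving_fst (μ := (volume : Measure I)) (ν := (volume : Measure I))).ae hφj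
  have ae2 := (Measure.quasiMeasurePreserving_snd (μ := (volume : Measure I)) (ν := (volume : Measure I))).ae hφj
  calc _ ≤ ∫ p : I × I, ((|h (Φ p.1, Φ p.2) - c (Φ p.1, Φ p.2)| + ε) + |h (Ψ (φ p.1), Ψ (φ p.2)) - c (Ψ (φ p.1), Ψ (φ p.2))|) ∂((volume : Measure I).prod (volume : Measure I)) := by
        apply integral_mono_of_nonneg (Eventually.of_forall fun p => abs_nonneg _) (IA'.add IB')
        filter_upwards [ae1, ae2] with p q1 q2
        have r1 := hjd _ _ q1
        have r2 := hjd _ _ q2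
        have r3 : dist ((Ψ (φ p.1), Ψ (φ p.2)) : X × X) (Φ p.1, Φ p.2) < δ := by
          rw [Prod.dist_eq]; exact max_lt r1 r2
        have r4 := hcδ r3
        rw [Real.dist_eq] at r4
        have t1 := abs_lt.1 r4
        show |h (Φ p.1, Φ p.2) - h (Ψ (φ p.1), Ψ (φ p.2))| ≤ (|h (Φ p.1, Φ p.2) - c (Φ p.1, Φ p.2)| + ε) + |h (Ψ (φ p.1), Ψ (φ p.2)) - c (Ψ (φ p.1), Ψ (φ p.2))|
        have u1 := abs_le.1 (le_refl |h (Φ p.1, Φ p.2) - c (Φ p.1, Φ p.2)|)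
        have u2 := abs_le.1 (le_refl |h (Ψ (φ p.1), Ψ (φ p.2)) - c (Ψ (φ p.1), Ψ (φ p.2))|)
        rw [abs_le]
        constructor <;> linarith [u1.1, u1.2, u2.1, u2.2, t1.1, t1.2]
    _ = (∫ p : I × I, |h (Φ p.1, Φ p.2) - c (Φ p.1, Φ p.2)| ∂((volume : Measure I).prod (volume : Measure I))) + ε +
        ∫ p : I × I, |h (Ψ (φ p.1), Ψ (φ p.2)) - c (Ψ (φ p.1), Ψ (φ p.2))| ∂((volume : Measure I).prod (volume : Measure I)) := by
        rw [integral_add IA' IB', integral_add _ (integrable_const ε)]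
        · simp
        · exact IA
    _ ≤ 3 * ε := by linarith

lemma gr_cutNorm_le (D : I → I → ℝ) (hD : Measurable (Function.uncurry D)) (hD1 : ∀ x y, |D x y| ≤ 1) :
    cutNorm D ≤ ∫ p : I × I, |D p.1 p.2| ∂((volume : Measure I).prod (volume : Measure I)) := by
  apply Real.sSup_le
  · rintro r ⟨f, g, hf, hg, hf1, hg1, rfl⟩
    refine abs_integral_le_integral_abs.trans ?_
    apply integral_mono_of_nonneg (Eventually.of_forall fun p => abs_nonneg _)
    · exact (gr_bdd_integrable hD 1 (fun p => hD1 _ _)).abs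
    · refine Eventually.of_forall fun p => ?_
      show |D p.1 p.2 * f p.1 * g p.2| ≤ |D p.1 p.2|
      rw [abs_mul, abs_mul, mul_assoc]
      exact mul_le_of_le_one_right (abs_nonneg _) (mul_le_one₀ (hf1 _) (abs_nonneg _) (hg1 _))
  · exact integral_nonneg fun p => abs_nonneg _

lemma gr_hard (U W : I → I → ℝ) (hU : IsGraphon U) (hW : IsGraphon W)
    (hyp : ∀ (m : ℕ) (G : SimpleGraph (Fin m)),
        homDensity (volume : Measure I) U G = homDensity (volume : Measure I) W G) : cutDist U W = 0 := by
  obtain ⟨a, ha, b, hb, hab⟩ := gr_choose (S := {a | GrGood (grV U) a}) (T := {b | GrGood (grV W) b})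
    (grMom U) (grMom W) (grMom_meas hU) (grMom_meas hW)
    (gr_mom_law U W hU hW hyp) (gr_good _ (grV_meas hU) (grV_mem hU)) (gr_good _ (grV_meas hW) (grV_mem hW))
  obtain ⟨hlaw, h, hm, h1, hhU, hhW⟩ := gr_match U W hU hW a b ha hb hab
  let _ : MetricSpace (ℕ → I) := TopologicalSpace.metrizableSpaceMetric (ℕ → I)
  have hnn : ∀ r ∈ {r : ℝ | ∃ φ : I → I, MeasurePreserving φ (volume : Measure I) (volume : Measure I) ∧
    r = cutNorm (fun x y => U x y - W (φ x) (φ y))}, 0 ≤ r := by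
    rintro r ⟨φ, _, rfl⟩
    exact gr_cutNorm_nonneg _
  apply le_antisymm _ (Real.sInf_nonneg hnn)
  apply le_of_forall_pos_le_add
  intro ε hε
  obtain ⟨φ, hφ, hle⟩ := gr_cells (grPhi U a) (grPhi W b) (grPhi_meas hU a) (grPhi_meas hW b) hlaw h hm h1 (ε / 3) (by positivity)
  have hWφ : ∀ᵐ p ∂((volume : Measure I).prod (volume : Measure I)), W (φ p.1) (φ p.2) = h (grPsi W b (φ p.1, φ p.2)) :=
    (hφ.prod hφ).quasiMeasurePreserving.ae hhW
  rw [zero_add]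
  refine (csInf_le ⟨0, hnn⟩ ⟨φ, hφ, rfl⟩).trans ?_
  refine (gr_cutNorm_le (fun x y => U x y - W (φ x) (φ y)) (hU.1.sub (gr_meas2 hW.1 (hφ.measurable.comp measurable_fst) (hφ.measurable.comp measurable_snd))) ?_).trans ?_
  · intro x y
    have e1 := hU.2.2 x y
    have e2 := hW.2.2 (φ x) (φ y)
    rw [abs_le]
    constructor <;> linarith [e1.1, e1.2, e2.1, e2.2]
  · calc _ = _ := by
          apply integral_congr_ae
          filter_upwards [hhU, hWφ] with p q1 q2
          rw [q1, q2]
          rfl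
      _ ≤ _ := hle
      _ = ε := by ring

theorem weaklyIsomorphic_iff_cutDist_eq_zero
    (U W : I → I → ℝ) (hU : IsGraphon U) (hW : IsGraphon W) :
    (∀ (m : ℕ) (G : SimpleGraph (Fin m)),
        homDensity (volume : Measure I) U G = homDensity (volume : Measure I) W G) ↔
      cutDist U W = 0 :=
  ⟨gr_hard U W hU hW, fun h m G => gr_easy U W hU hW h m G⟩
end

section
/- The space of graphons on ([0,1], λ) is compact with respect to the cut metric: every sequence (W_n) of graphons on ([0,1], λ) has a subsequence (W_{n_k}) and a graphon W on ([0,1], λ) such that δ_□(W_{n_k}, W) → 0. -/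
open MeasureTheory unitInterval Filter
open scoped Classical unitInterval Topology

lemma bdd_integrable {Ω : Type*} [MeasurableSpace Ω] {μ : Measure Ω} [IsFiniteMeasure μ]
    {F : Ω → ℝ} (hF : Measurable F) {C : ℝ} (h : ∀ x, |F x| ≤ C) : Integrable F μ :=
  Integrable.of_bound hF.aestronglyMeasurable C (ae_of_all _ h)

lemma bdd_memLp {Ω : Type*} [MeasurableSpace Ω] {μ : Measure Ω} [IsFiniteMeasure μ]
    {F : Ω → ℝ} (hF : Measurable F) {C : ℝ} (h : ∀ x, |F x| ≤ C) : MemLp F 2 μ :=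
  MemLp.of_bound hF.aestronglyMeasurable C (ae_of_all _ h)

lemma weak_limit {Ω : Type*} [MeasurableSpace Ω] [MeasurableSpace.CountablyGenerated Ω]
    {μ : Measure Ω} [IsProbabilityMeasure μ] (T : ℕ → Ω → Ω)
    (hT : ∀ n, MeasurePreserving (T n) μ μ) (W : ℕ → Ω → ℝ) (hWm : ∀ n, Measurable (W n))
    (hW : ∀ n x, W n x ∈ Set.Icc (0:ℝ) 1) :
    ∃ φ : ℕ → ℕ, StrictMono φ ∧ ∃ w : Ω → ℝ, Measurable w ∧ (∀ x, w x ∈ Set.Icc (0:ℝ) 1) ∧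
      ∀ (C : ℝ) (F : Ω → ℝ), Measurable F → (∀ x, |F x| ≤ C) →
        Tendsto (fun n => ∫ x, W (φ n) x * F (T (φ n) x) ∂μ) atTop (𝓝 (∫ x, w x * F x ∂μ)) := by
  have hWb : ∀ n x, |W n x| ≤ 1 := fun n x => by
    rw [abs_le]; constructor <;> linarith [(hW n x).1, (hW n x).2]
  let Wl : ℕ → Lp ℝ 2 μ := fun n => (bdd_memLp (μ := μ) (hWm n) (hWb n)).toLp (W n)
  have hWl : ∀ n, ‖Wl n‖ ≤ 1 := by
    intro n
    have := Lp.norm_le_of_ae_bound (f := Wl n) (C := 1) zero_le_one (by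
      filter_upwards [(bdd_memLp (μ := μ) (hWm n) (hWb n)).coeFn_toLp] with x hx
      rw [hx]; exact hWb n x)
    simpa [measureUnivNNReal] using this
  have : Fact ((2:ENNReal) ≠ ⊤) := ⟨by norm_num⟩
  have : SecondCountableTopology (Lp ℝ 2 μ) := inferInstance
  let Φ : ℕ → StrongDual ℝ (Lp ℝ 2 μ) := fun n =>
    (innerSL ℝ (Wl n)).comp (Lp.compMeasurePreservingₗᵢ ℝ (T n) (hT n)).toContinuousLinearMap
  have hΦn : ∀ n, ‖Φ n‖ ≤ 1 := by
    intro n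
    refine ContinuousLinearMap.opNorm_le_bound _ zero_le_one fun F => ?_
    simp only [Φ, ContinuousLinearMap.comp_apply, innerSL_apply_apply]
    refine (norm_inner_le_norm _ _).trans ?_
    have : ‖(Lp.compMeasurePreservingₗᵢ ℝ (T n) (hT n)).toContinuousLinearMap F‖ = ‖F‖ :=
      (Lp.compMeasurePreservingₗᵢ ℝ (T n) (hT n)).norm_map F
    rw [this]
    exact mul_le_mul_of_nonneg_right (hWl n) (norm_nonneg _)
  have hΦ : ∀ n (C : ℝ) (F : Ω → ℝ) (hF : Measurable F) (hb : ∀ x, |F x| ≤ C),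
      Φ n ((bdd_memLp (μ := μ) hF hb).toLp F) = ∫ x, W n x * F (T n x) ∂μ := by
    intro n C F hF hb
    simp only [Φ, ContinuousLinearMap.comp_apply, innerSL_apply_apply]
    rw [L2.inner_def]
    refine integral_congr_ae ?_
    have h1 := (bdd_memLp (μ := μ) (hWm n) (hWb n)).coeFn_toLp
    have h2 := Lp.coeFn_compMeasurePreserving ((bdd_memLp (μ := μ) hF hb).toLp F) (hT n)
    have h3 := (hT n).quasiMeasurePreserving.ae (bdd_memLp (μ := μ) hF hb).coeFn_toLp
    filter_upwards [h1, h2, h3] with x h1 h2 h3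
    change inner ℝ ((Wl n) x) ((Lp.compMeasurePreserving (T n) (hT n) _ : Lp ℝ 2 μ) x) = _
    rw [h1, h2, Function.comp, h3]
    simp [mul_comm]
  obtain ⟨ψ, -, φ, hφ, hlim⟩ := WeakDual.isSeqCompact_closedBall ℝ (Lp ℝ 2 μ) 0 1
    (x := fun n => StrongDual.toWeakDual (Φ n)) (fun n => by
      simpa using hΦn n)
  refine ⟨φ, hφ, ?_⟩
  have hlim' : ∀ F : Lp ℝ 2 μ, Tendsto (fun n => Φ (φ n) F) atTop (𝓝 (ψ F)) := by
    intro F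
    exact ((WeakDual.eval_continuous F).tendsto ψ).comp hlim
  let w₀ : Lp ℝ 2 μ := (InnerProductSpace.toDual ℝ (Lp ℝ 2 μ)).symm (WeakDual.toStrongDual ψ)
  have hw₀ : ∀ F : Lp ℝ 2 μ, ψ F = inner ℝ w₀ F := by
    intro F
    simp [w₀]
  have hw₁ : ∀ (C : ℝ) (F : Ω → ℝ), Measurable F → (∀ x, |F x| ≤ C) →
        Tendsto (fun n => ∫ x, W (φ n) x * F (T (φ n) x) ∂μ) atTop
          (𝓝 (∫ x, w₀ x * F x ∂μ)) := by
    intro C F hF hb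
    have := hlim' ((bdd_memLp (μ := μ) hF hb).toLp F)
    rw [hw₀] at this
    have h2 := this.congr fun n => hΦ _ C F hF hb
    convert h2 using 2
    rw [L2.inner_def]
    refine integral_congr_ae ?_
    filter_upwards [(bdd_memLp (μ := μ) hF hb).coeFn_toLp] with x h
    rw [h]; simp [mul_comm]
  have hint : Integrable w₀ μ := (Lp.memLp w₀).integrable (by norm_num)
  have hind : ∀ s : Set Ω, MeasurableSet s →
      Tendsto (fun n => ∫ x, W (φ n) x * (s.indicator 1 (T (φ n) x)) ∂μ) atTop
          (𝓝 (∫ x in s, w₀ x ∂μ)) := by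
    intro s hs
    have := hw₁ 1 (s.indicator 1) (measurable_one.indicator hs) (by
      intro x; by_cases h : x ∈ s <;> simp [h])
    convert this using 2
    rw [← integral_indicator hs]
    congr 1; ext x; by_cases h : x ∈ s <;> simp [h]
  have hge : 0 ≤ᵐ[μ] w₀ := by
    refine ae_nonneg_of_forall_setIntegral_nonneg hint fun s hs _ => ?_
    refine ge_of_tendsto' (hind s hs) fun n => integral_nonneg fun x => ?_
    exact mul_nonneg (hW _ _).1 (Set.indicator_nonneg (by simp) _)
  have hle : 0 ≤ᵐ[μ] fun x => 1 - w₀ x := by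
    refine ae_nonneg_of_forall_setIntegral_nonneg ((integrable_const _).sub hint) fun s hs _ => ?_
    rw [integral_sub (integrable_const _).integrableOn hint.integrableOn, sub_nonneg]
    refine le_of_tendsto' (hind s hs) fun n => ?_
    have h1 : ∫ x in s, (1:ℝ) ∂μ = ∫ x, s.indicator 1 (T (φ n) x) ∂μ := by
      have := (hT (φ n)).map_eq
      rw [← integral_map (φ := T (φ n)) (f := s.indicator (1 : Ω → ℝ)) (hT _).measurable.aemeasurable
        (measurable_one.indicator hs).aestronglyMeasurable, this, integral_indicator hs]
      rfl
    rw [h1]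
    have hm : Measurable fun x => s.indicator (1 : Ω → ℝ) (T (φ n) x) :=
      (measurable_one.indicator hs).comp (hT _).measurable
    have hb : ∀ x, |s.indicator (1 : Ω → ℝ) (T (φ n) x)| ≤ 1 := by
      intro x; by_cases h : T (φ n) x ∈ s <;> simp [h]
    refine integral_mono (bdd_integrable ((hWm _).mul hm) (C := 1) ?_) (bdd_integrable hm hb) ?_
    · intro x
      rw [abs_mul]; exact mul_le_one₀ (hWb _ _) (abs_nonneg _) (hb x)
    · intro x
      exact mul_le_of_le_one_left (Set.indicator_nonneg (by simp) _) (hW _ _).2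
  have hsm := (Lp.stronglyMeasurable w₀).measurable
  refine ⟨fun x => max 0 (min 1 (w₀ x)), by fun_prop, fun x => ⟨by simp, by simp⟩, ?_⟩
  intro C F hF hb
  convert hw₁ C F hF hb using 2
  refine integral_congr_ae ?_
  filter_upwards [hge, hle] with x h1 h2
  simp only [Pi.zero_apply] at h1 h2
  rw [min_eq_right (by linarith), max_eq_right h1]

/-- pushing a test function forward along a measure preserving map -/
lemma push_test (T : I → I) (hT : MeasurePreserving T (volume : Measure I) volume)
    (f : I → ℝ) (hf : Measurable f) (hb : ∀ x, |f x| ≤ 1) :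
    ∃ f' : I → ℝ, Measurable f' ∧ (∀ x, |f' x| ≤ 1) ∧
      ∀ (C : ℝ) (u : I → ℝ), Measurable u → (∀ x, |u x| ≤ C) →
        ∫ x, u (T x) * f x = ∫ x, u x * f' x := by
  obtain ⟨φ, -, w, hwm, hw, h⟩ := weak_limit (μ := (volume : Measure I)) (fun _ => T) (fun _ => hT)
    (fun _ x => (1 + f x) / 2) (fun _ => by fun_prop) (fun _ x => by
      have := abs_le.1 (hb x)
      constructor <;> linarith [this.1, this.2])
  refine ⟨fun x => 2 * w x - 1, by fun_prop, fun x => by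
    rw [abs_le]; constructor <;> linarith [(hw x).1, (hw x).2], ?_⟩
  intro C u hu hub
  have h1 := tendsto_nhds_unique (h C u hu hub) tendsto_const_nhds
  have hi : Integrable u (volume : Measure I) := bdd_integrable hu hub
  have hi2 : Integrable (fun x => u (T x)) (volume : Measure I) :=
    bdd_integrable (hu.comp hT.measurable) (fun x => hub _)
  have hC : 0 ≤ C := (abs_nonneg _).trans (hub 0)
  have hi3 : Integrable (fun x => w x * u x) (volume : Measure I) :=
    bdd_integrable (hwm.mul hu) (C := 1 * C) (fun x => by
      rw [abs_mul]; exact mul_le_mul (abs_le.2 ⟨by linarith [(hw x).1], (hw x).2⟩) (hub x)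
        (abs_nonneg _) zero_le_one)
  have hi4 : Integrable (fun x => (1 + f x)/2 * u (T x)) (volume : Measure I) :=
    bdd_integrable (((measurable_const.add hf).div_const 2).mul (hu.comp hT.measurable))
      (C := 1 * C) (fun x => by
      have := abs_le.1 (hb x)
      rw [abs_mul]; exact mul_le_mul (abs_le.2 ⟨by linarith, by linarith⟩) (hub _)
        (abs_nonneg _) zero_le_one)
  have h2 : ∫ x, u (T x) = ∫ x, u x := by
    rw [← integral_map (φ := T) (f := u) hT.measurable.aemeasurable hu.aestronglyMeasurable,
      hT.map_eq]
  calc ∫ x, u (T x) * f x = ∫ x, (2 * ((1 + f x)/2 * u (T x)) - u (T x)) := by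
        congr 1; ext x; ring
    _ = 2 * (∫ x, (1 + f x)/2 * u (T x)) - ∫ x, u (T x) := by
        rw [integral_sub (hi4.const_mul 2) hi2, integral_const_mul]
    _ = 2 * (∫ x, w x * u x) - ∫ x, u x := by rw [h1, h2]
    _ = ∫ x, (2 * (w x * u x) - u x) := by
        rw [integral_sub (hi3.const_mul 2) hi, integral_const_mul]
    _ = _ := by congr 1; ext x; ring

lemma quantile (π : I → ℝ) (hπ : Measurable π) (hinj : Function.Injective π)
    (h0 : ∀ x, 0 ≤ π x) (h2 : ∀ x, π x < 2) :
    ∃ T : I → I, MeasurePreserving T (volume : Measure I) volume ∧ ∃ F : ℝ → I,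
      ∀ c, ∀ᵐ x, (π x < c ↔ T x < F c) := by
  let ν : Measure ℝ := Measure.map π volume
  have : IsProbabilityMeasure ν := Measure.isProbabilityMeasure_map hπ.aemeasurable
  have hsing : ∀ c, ν {c} = 0 := by
    intro c
    rw [Measure.map_apply hπ (measurableSet_singleton c)]
    exact (Set.subsingleton_singleton.preimage hinj).measure_zero _
  let F : ℝ → ℝ := fun c => ProbabilityTheory.cdf ν c
  have hmono : Monotone F := ProbabilityTheory.monotone_cdf ν
  have hcont : Continuous F := by
    rw [continuous_iff_continuousAt]
    intro c
    rw [continuousAt_iff_continuous_left'_right']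
    refine ⟨?_, ((ProbabilityTheory.cdf ν).right_continuous c).mono Set.Ioi_subset_Ici_self⟩
    rw [hmono.continuousWithinAt_Iio_iff_leftLim_eq]
    have h := (ProbabilityTheory.cdf ν).measure_singleton c
    rw [ProbabilityTheory.measure_cdf, hsing, eq_comm, ENNReal.ofReal_eq_zero] at h
    exact le_antisymm (hmono.leftLim_le le_rfl) (by linarith)
  have hF : ∀ c, ENNReal.ofReal (F c) = volume {x | π x < c} := by
    intro c
    have h1 : ENNReal.ofReal (F c) = ν (Set.Iic c) := by
      simp only [F]; rw [ProbabilityTheory.ofReal_cdf]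
    have h2 : ν (Set.Iic c) = ν (Set.Iio c) := by
      rw [← Set.Iio_union_right]
      refine le_antisymm ((measure_union_le _ _).trans (by rw [hsing, add_zero])) (measure_mono (by simp))
    rw [h1, h2, Measure.map_apply hπ measurableSet_Iio]; rfl
  have hF0 : ∀ c, 0 ≤ F c := ProbabilityTheory.cdf_nonneg ν
  have hF1 : ∀ c, F c ≤ 1 := ProbabilityTheory.cdf_le_one ν
  have hFz : F 0 = 0 := by
    have := hF 0
    have h : {x | π x < 0} = ∅ := by ext x; simp [h0 x]
    rw [h, measure_empty, ENNReal.ofReal_eq_zero] at this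
    exact le_antisymm this (hF0 0)
  have hF2 : F 2 = 1 := by
    have := hF 2
    have h : {x | π x < 2} = Set.univ := by ext x; simp [h2 x]
    rw [h, measure_univ, ENNReal.ofReal_eq_one] at this
    exact this
  have key : ∀ c, ∀ᵐ x, (π x < c ↔ F (π x) < F c) := by
    intro c
    have hnull : volume {x | π x < c ∧ F c ≤ F (π x)} = 0 := by
      by_cases hc : c < 0
      · convert measure_empty (μ := (volume : Measure I))
        ext x; simp; intro h; linarith [h0 x]
      push Not at hc
      have hK : IsCompact (Set.Icc 0 c ∩ F ⁻¹' (Set.Ici (F c))) :=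
        isCompact_Icc.inter_right (isClosed_Ici.preimage hcont)
      obtain ⟨a, ha, hmin⟩ := hK.exists_isLeast ⟨c, ⟨hc, le_rfl⟩, le_refl (F c)⟩
      have hac : F a = F c := le_antisymm (hmono ha.1.2) ha.2
      have hsub : {x | π x < c ∧ F c ≤ F (π x)} ⊆ {x | π x < c} \ {x | π x < a} := by
        rintro x ⟨hx1, hx2⟩
        refine ⟨hx1, ?_⟩
        have := hmin ⟨⟨h0 x, hx1.le⟩, hx2⟩
        simpa using this
      refine measure_mono_null hsub ?_
      have hss : {x | π x < a} ⊆ {x | π x < c} := fun x hx => lt_of_lt_of_le hx ha.1.2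
      rw [measure_sdiff hss
        (measurableSet_lt hπ measurable_const).nullMeasurableSet (measure_ne_top _ _),
        ← hF, ← hF, hac, tsub_self]
    have : ∀ᵐ x, ¬ (π x < c ∧ F c ≤ F (π x)) := by
      rw [ae_iff]; simpa using hnull
    filter_upwards [this] with x hx
    constructor
    · intro h; by_contra h'; exact hx ⟨h, not_lt.1 h'⟩
    · intro h; exact hmono.reflect_lt h
  have hTm : Measurable (fun x => (⟨F (π x), hF0 _, hF1 _⟩ : I)) :=
    (hmono.measurable.comp hπ).subtype_mk
  refine ⟨fun x => ⟨F (π x), hF0 _, hF1 _⟩, ⟨hTm, ?_⟩, fun c => ⟨F c, hF0 _, hF1 _⟩, key⟩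
  have : IsProbabilityMeasure (Measure.map (fun x => (⟨F (π x), hF0 _, hF1 _⟩ : I)) volume) :=
    Measure.isProbabilityMeasure_map hTm.aemeasurable
  refine Measure.ext_of_Ici _ _ fun s => ?_
  obtain ⟨c, -, hc⟩ := intermediate_value_Icc (by norm_num : (0:ℝ) ≤ 2) hcont.continuousOn
    (show (s:ℝ) ∈ Set.Icc (F 0) (F 2) by rw [hFz, hF2]; exact s.2)
  rw [← Set.compl_Iio, measure_compl measurableSet_Iio (measure_ne_top _ _),
    measure_compl measurableSet_Iio (measure_ne_top _ _), measure_univ, measure_univ,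
    Measure.map_apply hTm measurableSet_Iio, unitInterval.volume_Iio, ← hc, hF]
  congr 1
  refine measure_congr ?_
  filter_upwards [key c] with x hx
  apply propext
  change (_ < s) ↔ _
  rw [← Subtype.coe_lt_coe, ← hc]
  exact hx.symm

/-- sign of a bit -/
noncomputable def sg (b : Bool) : ℝ := if b then 1 else -1

noncomputable def chi (m : ℕ) : ℝ := if m % 4 = 1 then 1 else -1

noncomputable def stepFn (j : ℕ) (e : ℕ → I) (t : I) : ℝ :=
  ∑ m ∈ Finset.range (2 * 4 ^ j),
    chi m * ((if t < e (m + 1) then 1 else 0) - (if t < e m then 1 else 0))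

lemma sum_chi (M : ℕ) (y : ℝ) (hy : 0 ≤ y) (hM : y < M) :
    ∑ m ∈ Finset.range M, chi m * ((if y < (m + 1 : ℕ) then (1:ℝ) else 0)
      - (if y < m then 1 else 0)) = chi ⌊y⌋₊ := by
  rw [Finset.sum_eq_single ⌊y⌋₊]
  · have h1 := Nat.lt_floor_add_one y
    have h2 := Nat.floor_le hy
    push_cast
    rw [if_pos h1, if_neg (not_lt.2 h2)]; ring
  · intro m _ hm
    rcases lt_or_gt_of_ne hm with h | h
    · have : ((m + 1 : ℕ) : ℝ) ≤ y := (Nat.le_floor_iff hy).1 h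
      rw [if_neg (not_lt.2 this), if_neg]
      · simp
      · push_cast at this; linarith
    · have : y < m := (Nat.floor_lt hy).1 h
      rw [if_pos this, if_pos]
      · simp
      · push_cast; linarith
  · intro h
    exact absurd (Finset.mem_range.2 ((Nat.floor_lt hy).2 hM)) h

lemma cf_bounds (f : ℕ → Bool) : 0 ≤ Cardinal.cantorFunction (1/4) f ∧
    Cardinal.cantorFunction (1/4) f ≤ 4/3 := by
  constructor
  · exact tsum_nonneg fun n => Cardinal.cantorFunctionAux_nonneg (by norm_num)
  · have h1 := Cardinal.cantorFunction_le (c := 1/4) (f := f) (g := fun _ => true)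
      (by norm_num) (by norm_num) (by simp)
    refine h1.trans ?_
    have h2 := Cardinal.cantorFunction_succ (c := 1/4) (fun _ => true) (by norm_num) (by norm_num)
    simp only [Bool.cond_true] at h2
    linarith

lemma cf_floor (f : ℕ → Bool) (j : ℕ) :
    chi ⌊(4:ℝ) ^ j * Cardinal.cantorFunction (1/4) f⌋₊ = sg (f j) := by
  have h : ∀ j, ∃ K : ℕ, (4:ℝ) ^ j * Cardinal.cantorFunction (1/4) f
      = 4 * K + Cardinal.cantorFunction (1/4) (fun n => f (n + j)) := by
    intro j
    induction j with
    | zero => exact ⟨0, by simp⟩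
    | succ j ih =>
      obtain ⟨K, hK⟩ := ih
      refine ⟨4 * K + (if f j then 1 else 0), ?_⟩
      have hs := Cardinal.cantorFunction_succ (c := 1/4) (fun n => f (n + j))
        (by norm_num) (by norm_num)
      have e : (fun n => f (n + 1 + j)) = fun n => f (n + (j + 1)) := by
        ext n; congr 1; ring
      rw [hs, e] at hK
      rw [pow_succ]
      generalize Cardinal.cantorFunction (1/4) (fun n => f (n + (j + 1))) = z at hK ⊢
      generalize Cardinal.cantorFunction (1/4) f = z' at hK ⊢
      rw [zero_add] at hK
      cases hf : f j
      · rw [hf] at hK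
        simp only [cond_false] at hK
        push_cast
        try simp only [Bool.false_eq_true, if_false]
        linarith
      · rw [hf] at hK
        simp only [cond_true] at hK
        push_cast
        try simp only [if_true]
        linarith
  obtain ⟨K, hK⟩ := h j
  have hs := Cardinal.cantorFunction_succ (c := 1/4) (fun n => f (n + j)) (by norm_num) (by norm_num)
  have hb := cf_bounds (fun n => f (n + 1 + j))
  rw [hK, hs]
  generalize Cardinal.cantorFunction (1/4) (fun n => f (n + 1 + j)) = z at hb ⊢
  rw [zero_add]
  have hK0 : (0:ℝ) ≤ K := Nat.cast_nonneg K
  cases hf : f j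
  · simp only [cond_false]
    have : ⌊4 * (K:ℝ) + (0 + 1/4 * z)⌋₊ = 4 * K := by
      rw [Nat.floor_eq_iff (by linarith)]
      push_cast
      constructor <;> linarith
    rw [this]
    simp [chi, sg]
  · simp only [cond_true]
    have : ⌊4 * (K:ℝ) + (1 + 1/4 * z)⌋₊ = 4 * K + 1 := by
      rw [Nat.floor_eq_iff (by linarith)]
      push_cast
      constructor <;> linarith
    rw [this]
    simp [chi, sg, Nat.add_mod]

lemma encode (b : ℕ → I → Bool) (hb : ∀ j, Measurable (b j)) :
    ∃ T : I → I, MeasurePreserving T (volume : Measure I) volume ∧ ∃ e : ℕ → ℕ → I,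
      ∀ j, ∀ᵐ x, sg (b j x) = stepFn (2 * j + 1) (e j) (T x) := by
  obtain ⟨s, hsm, hsi⟩ := MeasurableSpace.measurable_injection_nat_bool_of_countablySeparated I
  let d : I → ℕ → Bool := fun x n => if n % 2 = 0 then s x (n / 2) else b (n / 2) x
  have hdm : ∀ n, Measurable fun x => d x n := by
    intro n
    by_cases h : n % 2 = 0
    · simp only [d, h, if_true]; exact (measurable_pi_apply _).comp hsm
    · simp only [d, h, if_false]; exact hb _
  have hdi : Function.Injective d := by
    intro x y hxy
    apply hsi
    ext n
    have := congrFun hxy (2 * n)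
    simp only [d] at this
    simpa using this
  have hdb : ∀ j x, d x (2 * j + 1) = b j x := by
    intro j x
    have h1 : (2 * j + 1) % 2 = 1 := by omega
    have h2 : (2 * j + 1) / 2 = j := by omega
    simp [d, h1, h2]
  let π : I → ℝ := fun x => Cardinal.cantorFunction (1/4) (d x)
  have hπ : Measurable π := by
    simp only [π, Cardinal.cantorFunction]
    refine Measurable.tsum fun n => ?_
    simp only [Cardinal.cantorFunctionAux]
    exact (measurable_of_countable (fun c : Bool => cond c ((1/4:ℝ)^n) 0)).comp (hdm n)
  obtain ⟨T, hT, F, hF⟩ := quantile π hπ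
    ((Cardinal.cantorFunction_injective (by norm_num) (by norm_num)).comp hdi)
    (fun x => (cf_bounds _).1) (fun x => lt_of_le_of_lt (cf_bounds _).2 (by norm_num))
  refine ⟨T, hT, fun j m => F (m / 4 ^ (2 * j + 1)), fun j => ?_⟩
  have hall : ∀ᵐ x, ∀ m : ℕ, (π x < m / 4 ^ (2 * j + 1) ↔ T x < F (m / 4 ^ (2 * j + 1))) :=
    ae_all_iff.2 fun m => hF _
  filter_upwards [hall] with x hx
  rw [← hdb, ← cf_floor]
  have h4 : (0:ℝ) < 4 ^ (2 * j + 1) := by positivity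
  rw [← sum_chi (2 * 4 ^ (2 * j + 1)) _ (mul_nonneg h4.le (cf_bounds _).1)]
  · rw [stepFn]
    refine Finset.sum_congr rfl fun m _ => ?_
    have h : ∀ m : ℕ, (4 ^ (2 * j + 1) * Cardinal.cantorFunction (1/4) (d x) < m) ↔
        T x < F (m / 4 ^ (2 * j + 1)) := by
      intro m
      rw [← hx m, lt_div_iff₀ h4, mul_comm]
    simp only [h]
  · push_cast
    nlinarith [(cf_bounds (d x)).2]

def CutLe (U : I → I → ℝ) (ε : ℝ) : Prop :=
  ∀ f g : I → ℝ, Measurable f → Measurable g → (∀ x, |f x| ≤ 1) → (∀ x, |g x| ≤ 1) →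
    |∫ p : I × I, U p.1 p.2 * f p.1 * g p.2
          ∂((volume : Measure I).prod (volume : Measure I))| ≤ ε

lemma sg_abs (b : Bool) : |sg b| ≤ 1 := by cases b <;> simp [sg]
lemma sg_sq (b : Bool) : sg b * sg b = 1 := by cases b <;> simp [sg]
lemma sg_meas : Measurable sg := measurable_of_countable _

lemma abs_mul3 {a b c C : ℝ} (ha : |a| ≤ C) (hb : |b| ≤ 1) (hc : |c| ≤ 1) :
    |a * b * c| ≤ C := by
  rw [abs_mul, abs_mul]
  have hC : 0 ≤ C := (abs_nonneg _).trans ha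
  calc |a| * |b| * |c| ≤ C * 1 * 1 := by gcongr
    _ = C := by ring

lemma test_meas {U : I → I → ℝ} (hU : Measurable (Function.uncurry U)) {f g : I → ℝ}
    (hf : Measurable f) (hg : Measurable g) :
    Measurable fun p : I × I => U p.1 p.2 * f p.1 * g p.2 :=
  ((show Measurable (fun p : I × I => U p.1 p.2) from hU).mul (hf.comp measurable_fst)).mul
    (hg.comp measurable_snd)

lemma test_int {U : I → I → ℝ} (hU : Measurable (Function.uncurry U)) {C : ℝ}
    (hC : ∀ x y, |U x y| ≤ C) {f g : I → ℝ}
    (hf : Measurable f) (hg : Measurable g) (hfb : ∀ x, |f x| ≤ 1) (hgb : ∀ x, |g x| ≤ 1) :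
    Integrable (fun p : I × I => U p.1 p.2 * f p.1 * g p.2)
      ((volume : Measure I).prod (volume : Measure I)) :=
  bdd_integrable (test_meas hU hf hg) (fun p => abs_mul3 (hC _ _) (hfb _) (hgb _))

lemma sign_left {U : I → I → ℝ} (hU : Measurable (Function.uncurry U)) {C : ℝ}
    (hC : ∀ x y, |U x y| ≤ C) {f g : I → ℝ}
    (hf : Measurable f) (hg : Measurable g) (hfb : ∀ x, |f x| ≤ 1) (hgb : ∀ x, |g x| ≤ 1) :
    ∃ a : I → Bool, Measurable a ∧ |∫ p : I × I, U p.1 p.2 * f p.1 * g p.2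
          ∂((volume : Measure I).prod (volume : Measure I))| ≤
      ∫ p : I × I, U p.1 p.2 * sg (a p.1) * g p.2
          ∂((volume : Measure I).prod (volume : Measure I)) := by
  let G : I → ℝ := fun x => ∫ y, U x y * g y
  have hG : Measurable G := by
    have : StronglyMeasurable (Function.uncurry fun x y => U x y * g y) :=
      (Measurable.mul (show Measurable (fun p : I × I => U p.1 p.2) from hU)
        (hg.comp measurable_snd)).stronglyMeasurable
    exact this.integral_prod_right.measurable
  have key : ∀ h : I → ℝ, Measurable h → (∀ x, |h x| ≤ 1) →
      ∫ p : I × I, U p.1 p.2 * h p.1 * g p.2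
          ∂((volume : Measure I).prod (volume : Measure I)) = ∫ x, h x * G x := by
    intro h hh hb
    rw [integral_prod _ (test_int hU hC hh hg hb hgb)]
    congr 1; ext x
    simp only [G]
    rw [← integral_const_mul]
    congr 1; ext y; ring
  have hC0 : 0 ≤ C := (abs_nonneg _).trans (hC 0 0)
  have hGb : ∀ x, |G x| ≤ C := by
    intro x
    have := norm_integral_le_of_norm_le_const (μ := (volume : Measure I)) (C := C)
      (f := fun y => U x y * g y) (ae_of_all _ fun y => by
        rw [Real.norm_eq_abs, abs_mul]
        calc |U x y| * |g y| ≤ C * 1 := by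
              gcongr
              · exact hC x y
              · exact hgb y
          _ = C := mul_one C)
    simpa using this
  refine ⟨fun x => decide (0 ≤ G x), ?_, ?_⟩
  · refine measurable_to_bool ?_
    convert measurableSet_le (measurable_const (a := (0:ℝ))) hG using 1
    ext x; simp
  · have hm : Measurable fun x => sg (decide (0 ≤ G x)) := by
      have : (fun x => sg (decide (0 ≤ G x))) = fun x => if 0 ≤ G x then (1:ℝ) else -1 := by
        ext x; simp [sg]
      rw [this]
      exact Measurable.ite (measurableSet_le measurable_const hG) measurable_const measurable_const
    rw [key f hf hfb, key (fun x => sg (decide (0 ≤ G x))) hm (fun x => sg_abs _)]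
    refine (abs_integral_le_integral_abs).trans ?_
    refine integral_mono (bdd_integrable (C := C) (hf.mul hG).abs ?_)
      (bdd_integrable (C := C) (hm.mul hG) ?_) ?_
    · intro x
      have := mul_le_mul (hfb x) (hGb x) (abs_nonneg _) zero_le_one
      simpa [abs_mul] using this
    · intro x
      have := mul_le_mul (sg_abs (decide (0 ≤ G x))) (hGb x) (abs_nonneg _) zero_le_one
      simpa [abs_mul] using this
    · intro x
      have h1 : |f x * G x| ≤ |G x| := by
        rw [abs_mul]; exact mul_le_of_le_one_left (abs_nonneg _) (hfb x)
      refine h1.trans (le_of_eq ?_)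
      by_cases h : 0 ≤ G x
      · simp [sg, h, abs_of_nonneg h]
      · push Not at h
        simp [sg, not_le.2 h, abs_of_neg h]

lemma integral_swap_test (U : I → I → ℝ) (f g : I → ℝ) :
    ∫ p : I × I, U p.1 p.2 * f p.1 * g p.2 ∂((volume : Measure I).prod (volume : Measure I)) =
    ∫ p : I × I, U p.2 p.1 * g p.1 * f p.2 ∂((volume : Measure I).prod (volume : Measure I)) := by
  rw [← integral_prod_swap]
  congr 1; ext p; simp only [Prod.fst_swap, Prod.snd_swap]; ring

lemma sign_both {U : I → I → ℝ} (hU : Measurable (Function.uncurry U)) {C : ℝ}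
    (hC : ∀ x y, |U x y| ≤ C) {ε : ℝ} (h : ¬ CutLe U ε) :
    ∃ a b : I → Bool, Measurable a ∧ Measurable b ∧
      ε < ∫ p : I × I, U p.1 p.2 * sg (a p.1) * sg (b p.2)
          ∂((volume : Measure I).prod (volume : Measure I)) := by
  simp only [CutLe] at h
  push Not at h
  obtain ⟨f, g, hf, hg, hfb, hgb, h⟩ := h
  obtain ⟨a, ha, h1⟩ := sign_left hU hC hf hg hfb hgb
  have h2 := (h.trans_le h1).trans_le (le_abs_self _)
  rw [integral_swap_test U (fun x => sg (a x)) g] at h2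
  obtain ⟨b, hb, h3⟩ := sign_left (U := fun x y => U y x) (hU.comp measurable_swap)
    (fun x y => hC y x) hg (sg_meas.comp ha) hgb (fun x => sg_abs _)
  refine ⟨a, b, ha, hb, ?_⟩
  rw [integral_swap_test U (fun x => sg (a x)) (fun x => sg (b x))]
  exact h2.trans_le h3

noncomputable def lowRank (N : ℕ) (c : ℕ → I) (a b : ℕ → I → ℝ) (x y : I) : ℝ :=
  ∑ i ∈ Finset.range N, (c i : ℝ) * a i x * b i y

lemma lowRank_meas (N : ℕ) (c : ℕ → I) (a b : ℕ → I → ℝ) (ha : ∀ i, Measurable (a i))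
    (hb : ∀ i, Measurable (b i)) : Measurable (Function.uncurry (lowRank N c a b)) := by
  unfold lowRank Function.uncurry
  refine Finset.measurable_sum _ fun i _ => ?_
  exact (measurable_const.mul ((ha i).comp measurable_fst)).mul ((hb i).comp measurable_snd)

lemma lowRank_bound (N : ℕ) (c : ℕ → I) (a b : ℕ → I → ℝ) {K : ℝ} (ha : ∀ i x, |a i x| ≤ K)
    (hb : ∀ i x, |b i x| ≤ K) (x y : I) : |lowRank N c a b x y| ≤ N * (K * K) := by
  unfold lowRank
  refine (Finset.abs_sum_le_sum_abs _ _).trans ?_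
  refine (Finset.sum_le_card_nsmul _ _ (K * K) fun i _ => ?_).trans (by simp)
  rw [abs_mul, abs_mul]
  have hK : 0 ≤ K := (abs_nonneg _).trans (ha 0 0)
  have : |(c i : ℝ)| ≤ 1 := abs_le.2 ⟨by linarith [(c i).2.1], (c i).2.2⟩
  calc |(c i : ℝ)| * |a i x| * |b i y| ≤ 1 * K * K := by
        gcongr
        · exact ha i x
        · exact hb i y
    _ = K * K := by ring

lemma regularity_aux {W : I → I → ℝ} (hW : IsGraphon W) (ε : I) (N : ℕ) :
    ∃ (c : ℕ → I) (a b : ℕ → I → Bool), (∀ i, Measurable (a i)) ∧ (∀ i, Measurable (b i)) ∧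
      (CutLe (fun x y => W x y - lowRank N c (fun i x => sg (a i x)) (fun i y => sg (b i y)) x y) ε ∨
        ∫ p : I × I, (W p.1 p.2 - lowRank N c (fun i x => sg (a i x)) (fun i y => sg (b i y)) p.1 p.2) ^ 2
          ∂((volume : Measure I).prod (volume : Measure I)) ≤ 1 - N * (ε:ℝ) ^ 2) := by
  have hWb : ∀ x y, |W x y| ≤ 1 := fun x y => abs_le.2 ⟨by linarith [(hW.2.2 x y).1], (hW.2.2 x y).2⟩
  have hWm : Measurable fun p : I × I => W p.1 p.2 := hW.1
  induction N with
  | zero =>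
    refine ⟨fun _ => 0, fun _ _ => true, fun _ _ => true, fun _ => measurable_const,
      fun _ => measurable_const, Or.inr ?_⟩
    simp only [lowRank, Finset.range_zero, Finset.sum_empty, sub_zero, Nat.cast_zero, zero_mul]
    calc _ ≤ ∫ p : I × I, (1:ℝ) ∂((volume : Measure I).prod (volume : Measure I)) := by
          refine integral_mono (bdd_integrable (C := 1) (hWm.pow_const 2) ?_) (integrable_const _) ?_
          · intro p; rw [abs_pow]; exact pow_le_one₀ (abs_nonneg _) (hWb _ _)
          · intro p; exact pow_le_one₀ (hW.2.2 _ _).1 (hW.2.2 _ _).2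
      _ = 1 := by simp
  | succ N ih =>
    obtain ⟨c, a, b, ha, hb, h⟩ := ih
    have hext : ∀ (c₁ : I) (a₁ b₁ : I → Bool) (x y : I), lowRank (N + 1)
        (fun i => if i < N then c i else c₁)
        (fun i x => sg ((if i < N then a i else a₁) x))
        (fun i x => sg ((if i < N then b i else b₁) x)) x y =
        lowRank N c (fun i x => sg (a i x)) (fun i y => sg (b i y)) x y
          + c₁ * sg (a₁ x) * sg (b₁ y) := by
      intro c₁ a₁ b₁ x y
      unfold lowRank
      rw [Finset.sum_range_succ]
      congr 1
      · refine Finset.sum_congr rfl fun i hi => ?_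
        simp [Finset.mem_range.1 hi]
      · simp
    by_cases hc : CutLe (fun x y => W x y - lowRank N c (fun i x => sg (a i x)) (fun i y => sg (b i y)) x y) ε
    · refine ⟨fun i => if i < N then c i else 0, fun i => if i < N then a i else fun _ => true,
        fun i => if i < N then b i else fun _ => true, ?_, ?_, Or.inl ?_⟩
      · intro i; dsimp only; split_ifs; exacts [ha i, measurable_const]
      · intro i; dsimp only; split_ifs; exacts [hb i, measurable_const]
      · convert hc using 3
        rw [hext]; simp
    · have h := h.resolve_left hc
      set R : I → I → ℝ := fun x y => W x y - lowRank N c (fun i x => sg (a i x)) (fun i y => sg (b i y)) x y with hR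
      have hRm : Measurable (Function.uncurry R) := by
        have := lowRank_meas N c (fun i x => sg (a i x)) (fun i y => sg (b i y))
          (fun i => sg_meas.comp (ha i)) (fun i => sg_meas.comp (hb i))
        exact hW.1.sub this
      have hRb : ∀ x y, |R x y| ≤ 1 + N * (1 * 1) := by
        intro x y
        refine (abs_sub _ _).trans (add_le_add (hWb _ _) ?_)
        exact lowRank_bound _ _ _ _ (fun _ _ => sg_abs _) (fun _ _ => sg_abs _) _ _
      obtain ⟨a₁, b₁, ha₁, hb₁, hlt⟩ := sign_both hRm hRb hc
      refine ⟨fun i => if i < N then c i else ε, fun i => if i < N then a i else a₁,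
        fun i => if i < N then b i else b₁, ?_, ?_, Or.inr ?_⟩
      · intro i; dsimp only; split_ifs; exacts [ha i, ha₁]
      · intro i; dsimp only; split_ifs; exacts [hb i, hb₁]
      · have e : ∀ p : I × I, (W p.1 p.2 - lowRank (N + 1)
            (fun i => if i < N then c i else ε)
            (fun i x => sg ((if i < N then a i else a₁) x))
            (fun i x => sg ((if i < N then b i else b₁) x)) p.1 p.2) ^ 2 =
            R p.1 p.2 ^ 2 - 2 * ε * (R p.1 p.2 * sg (a₁ p.1) * sg (b₁ p.2)) + (ε:ℝ) ^ 2 := by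
          intro p
          rw [hext]
          simp only [hR]
          have h1 := sg_sq (a₁ p.1)
          have h2 := sg_sq (b₁ p.2)
          generalize sg (a₁ p.1) = s at *
          generalize sg (b₁ p.2) = t at *
          have h3 : (s * t) * (s * t) = 1 := by
            calc (s * t) * (s * t) = (s * s) * (t * t) := by ring
              _ = 1 := by rw [h1, h2, one_mul]
          linear_combination (ε:ℝ) ^ 2 * h3
        simp only [e]
        have hi1 : Integrable (fun p : I × I => R p.1 p.2 ^ 2)
            ((volume : Measure I).prod (volume : Measure I)) :=
          bdd_integrable (C := (1 + N * (1 * 1)) ^ 2) (Measurable.pow_const hRm 2) (fun p => by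
            rw [abs_pow]; exact pow_le_pow_left₀ (abs_nonneg _) (hRb _ _) 2)
        have hi2 := test_int hRm hRb (sg_meas.comp ha₁) (sg_meas.comp hb₁)
          (fun x => sg_abs _) (fun x => sg_abs _)
        simp only [Function.comp] at hi2
        have hi3 : Integrable (fun p : I × I => R p.1 p.2 ^ 2
            - 2 * ε * (R p.1 p.2 * sg (a₁ p.1) * sg (b₁ p.2)))
            ((volume : Measure I).prod (volume : Measure I)) := hi1.sub (hi2.const_mul _)
        rw [integral_add hi3 (integrable_const _),
          integral_sub hi1 (hi2.const_mul _), integral_const_mul]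
        simp only [integral_const, probReal_univ, one_smul]
        push_cast
        have := mul_le_mul_of_nonneg_left hlt.le ε.2.1
        nlinarith

lemma regularity (ε : I) (hε : 0 < (ε:ℝ)) : ∃ N : ℕ, ∀ {W : I → I → ℝ} (_ : IsGraphon W),
    ∃ (c : ℕ → I) (a b : ℕ → I → Bool), (∀ i, Measurable (a i)) ∧ (∀ i, Measurable (b i)) ∧
      CutLe (fun x y => W x y - lowRank N c (fun i x => sg (a i x)) (fun i y => sg (b i y)) x y) ε := by
  obtain ⟨N, hN⟩ := exists_nat_gt (1 / (ε:ℝ) ^ 2)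
  refine ⟨N, fun hW => ?_⟩
  obtain ⟨c, a, b, ha, hb, h⟩ := regularity_aux hW ε N
  refine ⟨c, a, b, ha, hb, h.resolve_right fun h => ?_⟩
  have h0 := (integral_nonneg fun p => sq_nonneg _).trans h
  rw [div_lt_iff₀ (by positivity)] at hN
  linarith

lemma CutLe.add {U V : I → I → ℝ} (hU : Measurable (Function.uncurry U))
    (hV : Measurable (Function.uncurry V)) {C D : ℝ} (hC : ∀ x y, |U x y| ≤ C)
    (hD : ∀ x y, |V x y| ≤ D) {a b : ℝ} (h1 : CutLe U a) (h2 : CutLe V b) :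
    CutLe (fun x y => U x y + V x y) (a + b) := by
  intro f g hf hg hfb hgb
  have e : ∀ p : I × I, (U p.1 p.2 + V p.1 p.2) * f p.1 * g p.2 =
      U p.1 p.2 * f p.1 * g p.2 + V p.1 p.2 * f p.1 * g p.2 := fun p => by ring
  simp only [e]
  rw [integral_add (test_int hU hC hf hg hfb hgb) (test_int hV hD hf hg hfb hgb)]
  exact (abs_add_le _ _).trans (add_le_add (h1 f g hf hg hfb hgb) (h2 f g hf hg hfb hgb))

lemma comp_meas {U : I → I → ℝ} (hU : Measurable (Function.uncurry U)) {T : I → I}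
    (hT : Measurable T) : Measurable (Function.uncurry fun x y => U (T x) (T y)) :=
  hU.comp ((hT.comp measurable_fst).prodMk (hT.comp measurable_snd))

lemma CutLe.push {U : I → I → ℝ} (hU : Measurable (Function.uncurry U))
    {C : ℝ} (hC : ∀ x y, |U x y| ≤ C) {a : ℝ} (h : CutLe U a) {T : I → I}
    (hT : MeasurePreserving T (volume : Measure I) volume) :
    CutLe (fun x y => U (T x) (T y)) a := by
  intro f g hf hg hfb hgb
  obtain ⟨f', hf', hfb', hf2⟩ := push_test T hT f hf hfb
  obtain ⟨g', hg', hgb', hg2⟩ := push_test T hT g hg hgb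
  have hC0 : 0 ≤ C := (abs_nonneg _).trans (hC 0 0)
  have hTm := hT.measurable
  have hU1 : ∀ x, Measurable fun y => U x y := fun x => hU.comp (measurable_const.prodMk measurable_id)
  have hU2 : ∀ y, Measurable fun x => U x y := fun y => hU.comp (measurable_id.prodMk measurable_const)
  have hUT : Measurable (Function.uncurry fun x y => U (T x) y) :=
    hU.comp ((hTm.comp measurable_fst).prodMk measurable_snd)
  have e1 : ∫ p : I × I, U (T p.1) (T p.2) * f p.1 * g p.2
        ∂((volume : Measure I).prod (volume : Measure I)) =
      ∫ p : I × I, U (T p.1) p.2 * f p.1 * g' p.2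
        ∂((volume : Measure I).prod (volume : Measure I)) := by
    rw [integral_prod _ (test_int (U := fun x y => U (T x) (T y)) (comp_meas hU hTm) (fun x y => hC _ _) hf hg hfb hgb),
      integral_prod _ (test_int (U := fun x y => U (T x) y) hUT (fun x y => hC _ _) hf hg' hfb hgb')]
    congr 1; ext x
    have := hg2 (C * 1) (fun y => U (T x) y * f x) ((hU1 _).mul_const _) (fun y => by
      rw [abs_mul]; exact mul_le_mul (hC _ _) (hfb _) (abs_nonneg _) hC0)
    exact this
  have e2 : ∫ p : I × I, U (T p.1) p.2 * f p.1 * g' p.2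
        ∂((volume : Measure I).prod (volume : Measure I)) =
      ∫ p : I × I, U p.1 p.2 * f' p.1 * g' p.2
        ∂((volume : Measure I).prod (volume : Measure I)) := by
    rw [integral_prod_symm _ (test_int (U := fun x y => U (T x) y) hUT (fun x y => hC _ _) hf hg' hfb hgb'),
      integral_prod_symm _ (test_int hU hC hf' hg' hfb' hgb')]
    congr 1; ext y
    dsimp only
    rw [integral_mul_const, integral_mul_const]
    rw [hf2 C (fun x => U x y) (hU2 y) (fun x => hC _ _)]
  rw [e1, e2]
  exact h f' g' hf' hg' hfb' hgb'

lemma final_step (W : ℕ → I → I → ℝ) (hW : ∀ n, IsGraphon (W n)) (T : ℕ → I → I)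
    (hT : ∀ n, MeasurePreserving (T n) (volume : Measure I) volume)
    (S : ℕ → ℕ → I → I → ℝ) (S' : ℕ → I → I → ℝ) (C : ℕ → ℝ) (ε : ℕ → ℝ)
    (hSm : ∀ n k, Measurable (Function.uncurry (S n k)))
    (hSm' : ∀ k, Measurable (Function.uncurry (S' k)))
    (hSb : ∀ n k x y, |S n k x y| ≤ C k) (hSb' : ∀ k x y, |S' k x y| ≤ C k)
    (hε : Tendsto ε atTop (𝓝 0))
    (hcut : ∀ n k, CutLe (fun x y => W n x y - S n k (T n x) (T n y)) (ε k))
    (hconv : ∀ k, ∀ᵐ p : I × I ∂((volume : Measure I).prod (volume : Measure I)),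
      Tendsto (fun n => S n k p.1 p.2) atTop (𝓝 (S' k p.1 p.2)))
    (w : I × I → ℝ) (hwm : Measurable w) (hw : ∀ p, w p ∈ Set.Icc (0:ℝ) 1)
    (hweak : ∀ (C : ℝ) (F : I × I → ℝ), Measurable F → (∀ x, |F x| ≤ C) →
        Tendsto (fun n => ∫ p : I × I, W n p.1 p.2 * F (T n p.1, T n p.2)
          ∂((volume : Measure I).prod (volume : Measure I))) atTop
          (𝓝 (∫ x, w x * F x ∂((volume : Measure I).prod (volume : Measure I))))) :
    ∃ Wlim : I → I → ℝ, IsGraphon Wlim ∧ ∀ δ > 0, ∀ᶠ n in atTop,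
      CutLe (fun x y => W n x y - Wlim (T n x) (T n y)) δ := by
  have hWb : ∀ n x y, |W n x y| ≤ 1 := fun n x y =>
    abs_le.2 ⟨by linarith [((hW n).2.2 x y).1], ((hW n).2.2 x y).2⟩
  let w' : I → I → ℝ := fun x y => w (x, y)
  have hwm' : Measurable (Function.uncurry w') := hwm
  have hwb : ∀ x y, |w' x y| ≤ 1 := fun x y => abs_le.2 ⟨by linarith [(hw (x, y)).1], (hw (x, y)).2⟩
  have hTT : ∀ n, MeasurePreserving (Prod.map (T n) (T n))
      ((volume : Measure I).prod (volume : Measure I)) ((volume : Measure I).prod volume) :=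
    fun n => (hT n).prod (hT n)
  have hTint : ∀ n (F : I × I → ℝ), Measurable F →
      ∫ p : I × I, F (T n p.1, T n p.2) ∂((volume : Measure I).prod (volume : Measure I)) =
      ∫ p : I × I, F p ∂((volume : Measure I).prod (volume : Measure I)) := by
    intro n F hF
    conv_rhs => rw [← (hTT n).map_eq]
    rw [integral_map (hTT n).measurable.aemeasurable hF.aestronglyMeasurable]
    rfl
  have step1 : ∀ k, CutLe (fun x y => S' k x y - w' x y) (ε k) := by
    intro k f g hf hg hfb hgb
    have l1 : Tendsto (fun n => ∫ p : I × I, S n k p.1 p.2 * f p.1 * g p.2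
        ∂((volume : Measure I).prod (volume : Measure I))) atTop
        (𝓝 (∫ p : I × I, S' k p.1 p.2 * f p.1 * g p.2
        ∂((volume : Measure I).prod (volume : Measure I)))) := by
      refine tendsto_integral_of_dominated_convergence (fun _ => C k)
        (fun n => (test_meas (hSm n k) hf hg).aestronglyMeasurable) (integrable_const _)
        (fun n => ae_of_all _ fun p => abs_mul3 (hSb n k _ _) (hfb _) (hgb _)) ?_
      filter_upwards [hconv k] with p hp
      exact (hp.mul_const _).mul_const _
    have l2 := hweak 1 (fun p => f p.1 * g p.2)
      ((hf.comp measurable_fst).mul (hg.comp measurable_snd)) (fun p => by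
        rw [abs_mul]; exact mul_le_one₀ (hfb _) (abs_nonneg _) (hgb _))
    have l3 := (l1.sub l2).abs
    have e1 : ∫ p : I × I, (S' k p.1 p.2 - w' p.1 p.2) * f p.1 * g p.2
        ∂((volume : Measure I).prod (volume : Measure I)) =
        ∫ p : I × I, S' k p.1 p.2 * f p.1 * g p.2
        ∂((volume : Measure I).prod (volume : Measure I)) -
        ∫ p, w p * (f p.1 * g p.2) ∂((volume : Measure I).prod (volume : Measure I)) := by
      have i1 := test_int (hSm' k) (hSb' k) hf hg hfb hgb
      have i2 := test_int hwm' hwb hf hg hfb hgb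
      have e : (fun p : I × I => w p * (f p.1 * g p.2)) =
          fun p => w' p.1 p.2 * f p.1 * g p.2 := by ext p; simp only [w', mul_assoc]
      rw [e, ← integral_sub i1 i2]
      congr 1; ext p; ring
    rw [e1]
    refine le_of_tendsto' l3 fun n => ?_
    have hfT : Measurable fun x => f (T n x) := hf.comp (hT n).measurable
    have hgT : Measurable fun x => g (T n x) := hg.comp (hT n).measurable
    have h := hcut n k (fun x => f (T n x)) (fun x => g (T n x)) hfT hgT (fun x => hfb _)
      (fun x => hgb _)
    have i1 := test_int (hW n).1 (hWb n) hfT hgT (fun x => hfb _) (fun x => hgb _)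
    have i2 := test_int (U := fun x y => S n k (T n x) (T n y)) (comp_meas (hSm n k) (hT n).measurable)
      (fun x y => hSb n k _ _) hfT hgT (fun x => hfb _) (fun x => hgb _)
    have e : (fun p : I × I => W n p.1 p.2 * (f (T n p.1) * g (T n p.2))) =
          fun p => W n p.1 p.2 * f (T n p.1) * g (T n p.2) := by ext p; simp only [mul_assoc]
    have e3 : (∫ p : I × I, W n p.1 p.2 * (f (T n p.1) * g (T n p.2))
        ∂((volume : Measure I).prod (volume : Measure I))) -
        (∫ p : I × I, S n k p.1 p.2 * f p.1 * g p.2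
        ∂((volume : Measure I).prod (volume : Measure I))) =
        ∫ p : I × I, (W n p.1 p.2 - S n k (T n p.1) (T n p.2)) * f (T n p.1) * g (T n p.2)
        ∂((volume : Measure I).prod (volume : Measure I)) := by
      rw [← hTint n (fun p => S n k p.1 p.2 * f p.1 * g p.2) (test_meas (hSm n k) hf hg)]
      dsimp only
      rw [e, ← integral_sub i1 i2]
      congr 1; ext p; ring
    rw [abs_sub_comm]
    exact (congrArg abs e3).trans_le h
  have step2 : ∀ k, Tendsto (fun n => ∫ p : I × I, |S n k p.1 p.2 - S' k p.1 p.2|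
      ∂((volume : Measure I).prod (volume : Measure I))) atTop (𝓝 0) := by
    intro k
    have : (0:ℝ) = ∫ p : I × I, (0:ℝ) ∂((volume : Measure I).prod (volume : Measure I)) := by simp
    rw [this]
    refine tendsto_integral_of_dominated_convergence (fun _ => C k + C k)
      (fun n => (Measurable.abs ((hSm n k).sub (hSm' k))).aestronglyMeasurable)
      (integrable_const _)
      (fun n => ae_of_all _ fun p => ?_) ?_
    · rw [Real.norm_eq_abs, abs_abs]
      exact (abs_sub _ _).trans (add_le_add (hSb _ _ _ _) (hSb' _ _ _))
    · filter_upwards [hconv k] with p hp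
      have := (hp.sub_const (S' k p.1 p.2)).abs
      simpa using this
  have step3 : ∀ n k, CutLe (fun x y => S n k (T n x) (T n y) - S' k (T n x) (T n y))
      (∫ p : I × I, |S n k p.1 p.2 - S' k p.1 p.2|
        ∂((volume : Measure I).prod (volume : Measure I))) := by
    intro n k f g hf hg hfb hgb
    have hm : Measurable fun p : I × I => |S n k p.1 p.2 - S' k p.1 p.2| :=
      Measurable.abs ((hSm n k).sub (hSm' k))
    have hb : ∀ x y, |S n k x y - S' k x y| ≤ C k + C k := fun x y =>
      (abs_sub _ _).trans (add_le_add (hSb _ _ _ _) (hSb' _ _ _))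
    rw [← hTint n _ hm]
    refine abs_integral_le_integral_abs.trans ?_
    refine integral_mono (test_int (U := fun x y => S n k (T n x) (T n y) - S' k (T n x) (T n y))
      (comp_meas (U := fun x y => S n k x y - S' k x y) ((hSm n k).sub (hSm' k)) (hT n).measurable)
      (fun x y => hb _ _) hf hg hfb hgb).abs
      (bdd_integrable (C := C k + C k) (hm.comp (hTT n).measurable) (fun p => ?_)) ?_
    · simp only [Function.comp, abs_abs]; exact hb _ _
    · intro p
      exact abs_mul3 le_rfl (hfb _) (hgb _)
  have step4 : ∀ n k, CutLe (fun x y => W n x y - w' (T n x) (T n y))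
      (ε k + (∫ p : I × I, |S n k p.1 p.2 - S' k p.1 p.2|
        ∂((volume : Measure I).prod (volume : Measure I)) + ε k)) := by
    intro n k
    have hTm := (hT n).measurable
    have m1 : Measurable (Function.uncurry fun x y => W n x y - S n k (T n x) (T n y)) :=
      (hW n).1.sub (comp_meas (hSm n k) hTm)
    have m2 : Measurable (Function.uncurry fun x y => S n k x y - S' k x y) :=
      (hSm n k).sub (hSm' k)
    have m3 : Measurable (Function.uncurry fun x y => S' k x y - w' x y) :=
      (hSm' k).sub hwm'
    have b1 : ∀ x y, |W n x y - S n k (T n x) (T n y)| ≤ 1 + C k := fun x y =>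
      (abs_sub _ _).trans (add_le_add (hWb _ _ _) (hSb _ _ _ _))
    have b2 : ∀ x y, |S n k x y - S' k x y| ≤ C k + C k := fun x y =>
      (abs_sub _ _).trans (add_le_add (hSb _ _ _ _) (hSb' _ _ _))
    have b3 : ∀ x y, |S' k x y - w' x y| ≤ C k + 1 := fun x y =>
      (abs_sub _ _).trans (add_le_add (hSb' _ _ _) (hwb _ _))
    have h3 := CutLe.push m3 b3 (step1 k) (hT n)
    have h23 := CutLe.add (comp_meas m2 hTm) (comp_meas m3 hTm) (fun x y => b2 _ _)
      (fun x y => b3 _ _) (step3 n k) h3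
    have h123 := CutLe.add (V := fun x y => (S n k (T n x) (T n y) - S' k (T n x) (T n y)) +
        (S' k (T n x) (T n y) - w' (T n x) (T n y))) m1 ((comp_meas m2 hTm).add (comp_meas m3 hTm)) b1
      (fun x y => (abs_add_le _ _).trans (add_le_add (b2 _ _) (b3 _ _))) (hcut n k) h23
    have e4 : (fun x y => W n x y - w' (T n x) (T n y)) = fun x y =>
        (W n x y - S n k (T n x) (T n y)) + ((S n k (T n x) (T n y) - S' k (T n x) (T n y)) +
        (S' k (T n x) (T n y) - w' (T n x) (T n y))) := by
      ext x y; ring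
    rw [e4]
    exact h123
  refine ⟨fun x y => (w' x y + w' y x) / 2, ⟨?_, ?_, ?_⟩, ?_⟩
  · exact (hwm'.add (hwm'.comp measurable_swap)).div_const 2
  · intro x y; ring
  · intro x y
    have h1 := hw (x, y)
    have h2 := hw (y, x)
    constructor
    · simp only [w']; linarith [h1.1, h2.1]
    · simp only [w']; linarith [h1.2, h2.2]
  · intro δ hδ
    obtain ⟨k, hk⟩ := (hε.eventually (gt_mem_nhds (show 0 < δ / 3 by linarith))).exists
    filter_upwards [(step2 k).eventually (gt_mem_nhds (show 0 < δ / 3 by linarith))] with n hn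
    intro f g hf hg hfb hgb
    have hTm := (hT n).measurable
    have h1 := step4 n k f g hf hg hfb hgb
    have h2 := step4 n k g f hg hf hgb hfb
    rw [integral_swap_test (fun x y => W n x y - w' (T n x) (T n y)) g f] at h2
    have mm : Measurable (Function.uncurry fun x y => W n x y - w' (T n x) (T n y)) :=
      (hW n).1.sub (comp_meas hwm' hTm)
    have bb : ∀ x y, |W n x y - w' (T n x) (T n y)| ≤ 1 + 1 := fun x y =>
      (abs_sub _ _).trans (add_le_add (hWb _ _ _) (hwb _ _))
    have i1 := test_int mm bb hf hg hfb hgb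
    have i2 := test_int (U := fun y x => W n x y - w' (T n x) (T n y))
      (mm.comp measurable_swap) (fun x y => bb y x) hf hg hfb hgb
    have e : ∫ p : I × I, (W n p.1 p.2 - (w' (T n p.1) (T n p.2) + w' (T n p.2) (T n p.1)) / 2)
        * f p.1 * g p.2 ∂((volume : Measure I).prod (volume : Measure I)) =
        ((∫ p : I × I, (W n p.1 p.2 - w' (T n p.1) (T n p.2)) * f p.1 * g p.2
          ∂((volume : Measure I).prod (volume : Measure I))) +
        ∫ p : I × I, (W n p.2 p.1 - w' (T n p.2) (T n p.1)) * f p.1 * g p.2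
          ∂((volume : Measure I).prod (volume : Measure I))) / 2 := by
      rw [← integral_add i1 i2, ← integral_div]
      congr 1; ext p
      rw [(hW n).2.1 p.2 p.1]; ring
    rw [e]
    rw [abs_le] at h1 h2 ⊢
    constructor <;> linarith [h1.1, h1.2, h2.1, h2.2]

lemma stepFn_meas (j : ℕ) (e : ℕ → I) : Measurable (stepFn j e) := by
  unfold stepFn
  refine Finset.measurable_sum _ fun m _ => ?_
  refine measurable_const.mul (Measurable.sub ?_ ?_) <;>
  exact Measurable.ite (measurableSet_lt measurable_id measurable_const) measurable_const measurable_const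

lemma stepFn_bound (j : ℕ) (e : ℕ → I) (t : I) : |stepFn j e t| ≤ (2 * 4 ^ j : ℕ) := by
  unfold stepFn
  refine (Finset.abs_sum_le_sum_abs _ _).trans ?_
  refine (Finset.sum_le_card_nsmul _ _ 1 fun i _ => ?_).trans (by simp)
  rw [abs_mul]
  refine mul_le_one₀ ?_ (abs_nonneg _) ?_
  · unfold chi; split_ifs <;> simp
  · split_ifs <;> simp

lemma stepFn_tendsto (j : ℕ) (e : ℕ → ℕ → I) (e' : ℕ → I)
    (h : ∀ m, Tendsto (fun n => e n m) atTop (𝓝 (e' m))) (t : I) (ht : ∀ m, t ≠ e' m) :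
    Tendsto (fun n => stepFn j (e n) t) atTop (𝓝 (stepFn j e' t)) := by
  have key : ∀ m, Tendsto (fun n => if t < e n m then (1:ℝ) else 0) atTop
      (𝓝 (if t < e' m then (1:ℝ) else 0)) := by
    intro m
    refine tendsto_const_nhds.congr' ?_
    rcases lt_or_gt_of_ne (ht m) with h' | h'
    · filter_upwards [(h m).eventually (lt_mem_nhds h')] with n hn
      rw [if_pos h', if_pos hn]
    · filter_upwards [(h m).eventually (gt_mem_nhds h')] with n hn
      rw [if_neg (not_lt.2 h'.le), if_neg (not_lt.2 hn.le)]
  unfold stepFn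
  exact tendsto_finsetSum _ fun m _ => ((key _).sub (key _)).const_mul _

lemma lowRank_bound' (N : ℕ) (c : ℕ → I) (a b : ℕ → I → ℝ) (A B : ℕ → ℝ) (ha : ∀ i x, |a i x| ≤ A i)
    (hb : ∀ i x, |b i x| ≤ B i) (x y : I) :
    |lowRank N c a b x y| ≤ ∑ i ∈ Finset.range N, A i * B i := by
  unfold lowRank
  refine (Finset.abs_sum_le_sum_abs _ _).trans (Finset.sum_le_sum fun i _ => ?_)
  rw [abs_mul, abs_mul]
  have hA : 0 ≤ A i := (abs_nonneg _).trans (ha i 0)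
  have : |(c i : ℝ)| ≤ 1 := abs_le.2 ⟨by linarith [(c i).2.1], (c i).2.2⟩
  calc |(c i : ℝ)| * |a i x| * |b i y| ≤ 1 * A i * B i := by
        gcongr
        · exact ha i x
        · exact hb i y
    _ = A i * B i := by ring

lemma cutDist_le {U V : I → I → ℝ} {T : I → I}
    (hT : MeasurePreserving T (volume : Measure I) volume) {δ : ℝ}
    (h : CutLe (fun x y => U x y - V (T x) (T y)) δ) : cutDist U V ≤ δ := by
  have hnn : ∀ X : I → I → ℝ, 0 ≤ cutNorm X := by
    intro X
    apply Real.sSup_nonneg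
    rintro r ⟨f, g, -, -, -, -, rfl⟩
    exact abs_nonneg _
  have h1 : cutDist U V ≤ cutNorm (fun x y => U x y - V (T x) (T y)) := by
    unfold cutDist
    refine csInf_le ⟨0, ?_⟩ ⟨T, hT, rfl⟩
    rintro r ⟨φ, -, rfl⟩
    exact hnn _
  have h2 : cutNorm (fun x y => U x y - V (T x) (T y)) ≤ δ := by
    unfold cutNorm
    refine csSup_le ⟨_, fun _ => 0, fun _ => 0, measurable_const, measurable_const, by simp, by simp, rfl⟩ ?_
    rintro r ⟨f, g, hf, hg, hfb, hgb, rfl⟩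
    exact h f g hf hg hfb hgb
  exact h1.trans h2

lemma cutDist_nonneg (U V : I → I → ℝ) : 0 ≤ cutDist U V := by
  apply Real.sInf_nonneg
  rintro r ⟨φ, -, rfl⟩
  apply Real.sSup_nonneg
  rintro r ⟨f, g, -, -, -, -, rfl⟩
  exact abs_nonneg _

lemma coded (N : ℕ → ℕ) (ε : ℕ → ℝ) (hN : ∀ k {W : I → I → ℝ} (_ : IsGraphon W),
    ∃ (c : ℕ → I) (a b : ℕ → I → Bool), (∀ i, Measurable (a i)) ∧ (∀ i, Measurable (b i)) ∧
      CutLe (fun x y => W x y - lowRank (N k) c (fun i x => sg (a i x))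
        (fun i y => sg (b i y)) x y) (ε k)) {W : I → I → ℝ} (hW : IsGraphon W) :
    ∃ T : I → I, MeasurePreserving T (volume : Measure I) volume ∧ ∃ (e c : ℕ → ℕ → I),
      ∀ k, CutLe (fun x y => W x y - lowRank (N k) (c k)
        (fun i => stepFn (2 * Nat.pair k (2 * i) + 1) (e (Nat.pair k (2 * i))))
        (fun i => stepFn (2 * Nat.pair k (2 * i + 1) + 1) (e (Nat.pair k (2 * i + 1))))
          (T x) (T y)) (ε k) := by
  choose c a b ha hb hcut using fun k => hN k hW
  obtain ⟨T, hT, e, he⟩ := encode (fun j => if (Nat.unpair j).2 % 2 = 0 then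
      a (Nat.unpair j).1 ((Nat.unpair j).2 / 2) else b (Nat.unpair j).1 ((Nat.unpair j).2 / 2)) (by
    intro j; split_ifs; exacts [ha _ _, hb _ _])
  refine ⟨T, hT, e, c, fun k f g hf hg hfb hgb => ?_⟩
  have h1 : ∀ᵐ x : I, ∀ i, sg (a k i x) =
      stepFn (2 * Nat.pair k (2 * i) + 1) (e (Nat.pair k (2 * i))) (T x) := by
    refine ae_all_iff.2 fun i => ?_
    filter_upwards [he (Nat.pair k (2 * i))] with x hx
    rw [← hx]; simp
  have h2 : ∀ᵐ x : I, ∀ i, sg (b k i x) =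
      stepFn (2 * Nat.pair k (2 * i + 1) + 1) (e (Nat.pair k (2 * i + 1))) (T x) := by
    refine ae_all_iff.2 fun i => ?_
    filter_upwards [he (Nat.pair k (2 * i + 1))] with x hx
    have h3 : (2 * i + 1) % 2 = 1 := by omega
    have h4 : (2 * i + 1) / 2 = i := by omega
    rw [← hx]; simp [h3, h4]
  have h := hcut k f g hf hg hfb hgb
  convert h using 2
  refine integral_congr_ae ?_
  have q1 := (Measure.quasiMeasurePreserving_fst (μ := (volume : Measure I)) (ν := (volume : Measure I))).ae h1
  have q2 := (Measure.quasiMeasurePreserving_snd (μ := (volume : Measure I)) (ν := (volume : Measure I))).ae h2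
  filter_upwards [q1, q2] with p h1 h2
  simp only [lowRank, h1, h2]

theorem graphon_space_compact_cutDist
    (W : ℕ → I → I → ℝ) (hW : ∀ n, IsGraphon (W n)) :
    ∃ φ : ℕ → ℕ, StrictMono φ ∧ ∃ Wlim : I → I → ℝ, IsGraphon Wlim ∧
      Filter.Tendsto (fun k => cutDist (W (φ k)) Wlim) Filter.atTop (𝓝 0) := by
  have hεI : ∀ k : ℕ, (1 / ((k:ℝ) + 1)) ∈ I := fun k => by
    constructor
    · positivity
    · rw [div_le_one (by positivity)]; linarith [Nat.cast_nonneg (α := ℝ) k]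
  choose N hN using fun k : ℕ => regularity ⟨1 / ((k:ℝ) + 1), hεI k⟩ (by
    show 0 < 1 / ((k:ℝ) + 1); positivity)
  choose T hT e c hcut using fun n => coded N (fun k => 1 / ((k:ℝ) + 1)) (fun k _ h => hN k h) (hW n)
  obtain ⟨⟨e', c'⟩, φ₁, hφ₁, hlim⟩ := CompactSpace.tendsto_subseq
    (fun n => ((e n, c n) : (ℕ → ℕ → I) × (ℕ → ℕ → I)))
  have he : ∀ j m, Tendsto (fun n => e (φ₁ n) j m) atTop (𝓝 (e' j m)) := by
    intro j m
    have h1 := (continuous_fst.tendsto _).comp hlim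
    exact tendsto_pi_nhds.1 (tendsto_pi_nhds.1 h1 j) m
  have hc : ∀ j m, Tendsto (fun n => c (φ₁ n) j m) atTop (𝓝 (c' j m)) := by
    intro j m
    have h1 := (continuous_snd.tendsto _).comp hlim
    exact tendsto_pi_nhds.1 (tendsto_pi_nhds.1 h1 j) m
  obtain ⟨φ₂, hφ₂, w, hwm, hw, hweak⟩ := weak_limit
    (μ := (volume : Measure I).prod (volume : Measure I))
    (fun n p => (T (φ₁ n) p.1, T (φ₁ n) p.2)) (fun n => (hT _).prod (hT _))
    (fun n p => W (φ₁ n) p.1 p.2) (fun n => (hW _).1) (fun n p => (hW _).2.2 _ _)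
  let S : ((ℕ → ℕ → I) × (ℕ → ℕ → I)) → ℕ → I → I → ℝ := fun z k => lowRank (N k) (z.2 k)
        (fun i => stepFn (2 * Nat.pair k (2 * i) + 1) (z.1 (Nat.pair k (2 * i))))
        (fun i => stepFn (2 * Nat.pair k (2 * i + 1) + 1) (z.1 (Nat.pair k (2 * i + 1))))
  have hSm : ∀ z k, Measurable (Function.uncurry (S z k)) := fun z k =>
    lowRank_meas _ _ _ _ (fun i => stepFn_meas _ _) (fun i => stepFn_meas _ _)
  have hSb : ∀ z k x y, |S z k x y| ≤ _ := fun z k =>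
    lowRank_bound' _ _ _ _ _ _ (fun i x => stepFn_bound _ _ _) (fun i x => stepFn_bound _ _ _)
  obtain ⟨Wlim, hWl, hfin⟩ := final_step (fun n => W (φ₁ (φ₂ n))) (fun n => hW _)
    (fun n => T (φ₁ (φ₂ n))) (fun n => hT _)
    (fun n => S (e (φ₁ (φ₂ n)), c (φ₁ (φ₂ n)))) (S (e', c')) _ (fun k => 1 / ((k:ℝ) + 1))
    (fun n k => hSm _ _) (fun k => hSm _ _) (fun n k => hSb _ k) (fun k => hSb _ k)
    tendsto_one_div_add_atTop_nhds_zero_nat (fun n k => hcut _ k) (by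
      intro k
      have hne : ∀ᵐ t : I, ∀ j m, t ≠ e' j m :=
        ae_all_iff.2 fun j => ae_all_iff.2 fun m => Measure.ae_ne _ _
      have q1 := (Measure.quasiMeasurePreserving_fst (μ := (volume : Measure I))
        (ν := (volume : Measure I))).ae hne
      have q2 := (Measure.quasiMeasurePreserving_snd (μ := (volume : Measure I))
        (ν := (volume : Measure I))).ae hne
      filter_upwards [q1, q2] with p h1 h2
      simp only [S, lowRank]
      refine tendsto_finsetSum _ fun i _ => ?_
      refine Tendsto.mul (Tendsto.mul ?_ ?_) ?_
      · exact (continuous_subtype_val.tendsto _).comp ((hc k i).comp hφ₂.tendsto_atTop)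
      · exact stepFn_tendsto _ (fun n => e (φ₁ (φ₂ n)) _) _
          (fun m => (he _ m).comp hφ₂.tendsto_atTop) _ (h1 _)
      · exact stepFn_tendsto _ (fun n => e (φ₁ (φ₂ n)) _) _
          (fun m => (he _ m).comp hφ₂.tendsto_atTop) _ (h2 _))
    w hwm hw hweak
  refine ⟨fun n => φ₁ (φ₂ n), hφ₁.comp hφ₂, Wlim, hWl, ?_⟩
  rw [Metric.tendsto_atTop']
  intro δ hδ
  obtain ⟨n₀, hn₀⟩ := eventually_atTop.1 (hfin (δ / 2) (by linarith))
  refine ⟨n₀, fun n hn => ?_⟩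
  rw [Real.dist_eq, sub_zero, abs_of_nonneg (cutDist_nonneg _ _)]
  exact (cutDist_le (hT _) (hn₀ n hn.le)).trans_lt (by linarith)
end

section
/- Let n ≥ 1, let σ be the uniform probability measure on S^n, let F : [0, π] → [0,1] be continuous, and define the graphon W(x, y) = F(d_{S^n}(x, y)), where d_{S^n} is the geodesic distance. Assume W is twin-free, i.e., r_W(x, y) = 0 implies x = y. Then the identity map from (S^n, r_W) to (S^n, d_{S^n}) is a homeomorphism; equivalently, the metric r_W induces the standard topology of S^n. -/
open MeasureTheory
open scoped RealInnerProductSpace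

/-- The uniform (normalized surface) probability measure on the unit sphere of a Euclidean
space. -/
noncomputable def sphereUniform (d : ℕ) :
    Measure (Metric.sphere (0 : EuclideanSpace ℝ (Fin d)) 1) :=
  (((volume : Measure (EuclideanSpace ℝ (Fin d))).toSphere Set.univ)⁻¹) •
    (volume : Measure (EuclideanSpace ℝ (Fin d))).toSphere

/-- The geodesic distance on the unit sphere: `d(x,y) = arccos ⟨x,y⟩`. -/
noncomputable def geodesic {d : ℕ} (x y : Metric.sphere (0 : EuclideanSpace ℝ (Fin d)) 1) :
    ℝ :=
  Real.arccos ⟪(x : EuclideanSpace ℝ (Fin d)), (y : EuclideanSpace ℝ (Fin d))⟫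

/-- The metric `r_W(x,y) = ∫ |W(x,z) - W(y,z)| dμ(z)` induced by a graphon. -/
noncomputable def rW {Ω : Type*} [MeasurableSpace Ω] (μ : Measure Ω)
    (W : Ω → Ω → ℝ) (x y : Ω) : ℝ :=
  ∫ z, |W x z - W y z| ∂μ

theorem sphereUniform_finite (d : ℕ) : IsFiniteMeasure (sphereUniform d) := by
  constructor
  unfold sphereUniform
  rw [Measure.smul_apply, smul_eq_mul]
  exact lt_of_le_of_lt (ENNReal.inv_mul_le_one _) ENNReal.one_lt_top

theorem compact_aux {X : Type*} [TopologicalSpace X] [CompactSpace X] (f g : X → ℝ)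
    (hf : Continuous f) (hg : Continuous g) (hg0 : ∀ y, 0 ≤ g y) (ε : ℝ)
    (h : ∀ y, g y = 0 → f y < ε) : ∃ δ > (0 : ℝ), ∀ y, g y < δ → f y < ε := by
  have hc : IsCompact {y | ε ≤ f y} := (isClosed_le continuous_const hf).isCompact
  rcases Set.eq_empty_or_nonempty {y | ε ≤ f y} with he | hne
  · refine ⟨1, one_pos, fun y _ => ?_⟩
    by_contra hy
    have : y ∈ {y | ε ≤ f y} := not_lt.mp hy
    rw [he] at this
    exact this
  · obtain ⟨y0, hy0, hmin⟩ := hc.exists_isMinOn hne hg.continuousOn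
    refine ⟨g y0, lt_of_le_of_ne (hg0 y0) (fun h0 => ?_), fun y hy => ?_⟩
    · exact absurd (h y0 h0.symm) (not_lt.mpr hy0)
    · by_contra hy'
      exact absurd (hmin (show y ∈ {y | ε ≤ f y} from not_lt.mp hy')) (not_le.mpr hy)

theorem geodesic_self_aux {d : ℕ} (x : Metric.sphere (0 : EuclideanSpace ℝ (Fin d)) 1) :
    geodesic x x = 0 := by
  have hx1 : ‖(x : EuclideanSpace ℝ (Fin d))‖ = 1 := norm_eq_of_mem_sphere x
  simp [geodesic, real_inner_self_eq_norm_sq, hx1]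

theorem geodesic_eq_aux {d : ℕ} (x y : Metric.sphere (0 : EuclideanSpace ℝ (Fin d)) 1)
    (hy : geodesic x y = 0) : x = y := by
  have hx1 : ‖(x : EuclideanSpace ℝ (Fin d))‖ = 1 := norm_eq_of_mem_sphere x
  have hy1 : ‖(y : EuclideanSpace ℝ (Fin d))‖ = 1 := norm_eq_of_mem_sphere y
  have h1 := Real.arccos_eq_zero.mp hy
  apply Subtype.ext
  refine (inner_eq_one_iff_of_norm_eq_one (𝕜 := ℝ) hx1 hy1).mp (le_antisymm ?_ h1)
  have := real_inner_le_norm (x : EuclideanSpace ℝ (Fin d)) y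
  rwa [hx1, hy1, one_mul] at this

theorem geodesic_cont_aux (d : ℕ) :
    Continuous (fun p : Metric.sphere (0 : EuclideanSpace ℝ (Fin d)) 1 ×
      Metric.sphere (0 : EuclideanSpace ℝ (Fin d)) 1 => geodesic p.1 p.2) := by
  unfold geodesic
  fun_prop

theorem rW_self_aux {X : Type*} [MeasurableSpace X] (μ : Measure X) (W : X → X → ℝ) (x : X) :
    rW μ W x x = 0 := by
  simp [rW]

theorem rW_nonneg_aux {X : Type*} [MeasurableSpace X] (μ : Measure X) (W : X → X → ℝ)
    (x y : X) : 0 ≤ rW μ W x y :=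
  integral_nonneg (fun z => abs_nonneg _)

theorem rW_cont_aux {X : Type*} [MetricSpace X] [CompactSpace X] [MeasurableSpace X]
    [BorelSpace X] (μ : Measure X) [IsFiniteMeasure μ] (W : X → X → ℝ)
    (hWc : Continuous (fun p : X × X => W p.1 p.2)) (x : X) :
    Continuous (fun y => rW μ W x y) := by
  have h : Continuous (Function.uncurry (fun y z => |W x z - W y z|)) := by
    have h1 : Continuous (fun p : X × X => W x p.2) :=
      hWc.comp (continuous_const.prodMk continuous_snd)
    exact (h1.sub hWc).abs
  have := continuous_parametric_integral_of_continuous (μ := μ) h isCompact_univ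
  simpa only [rW, Measure.restrict_univ] using this

theorem section_cont_aux {X : Type*} [TopologicalSpace X] (g : X → X → ℝ)
    (hg : Continuous (fun p : X × X => g p.1 p.2)) (x : X) : Continuous (fun y => g x y) :=
  hg.comp (continuous_const.prodMk continuous_id)

theorem comp_cont_aux {X : Type*} [TopologicalSpace X] (F : ℝ → ℝ) (s : Set ℝ)
    (hF : ContinuousOn F s) (g W : X → X → ℝ)
    (hg : Continuous (fun p : X × X => g p.1 p.2)) (hs : ∀ x y, g x y ∈ s)
    (hW : ∀ x y, W x y = F (g x y)) : Continuous (fun p : X × X => W p.1 p.2) := by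
  simp only [hW]
  exact hF.comp_continuous hg (fun p => hs p.1 p.2)

theorem geodesic_mem_aux {d : ℕ} (x y : Metric.sphere (0 : EuclideanSpace ℝ (Fin d)) 1) :
    geodesic x y ∈ Set.Icc 0 Real.pi :=
  ⟨Real.arccos_nonneg _, Real.arccos_le_pi _⟩

/-- for a twin-free graphon of the form `W(x,y) = F(d_{S^n}(x,y))` on `S^n`
with `F : [0,π] → [0,1]` continuous, the identity map `(S^n, r_W) → (S^n, d_{S^n})` is a
homeomorphism: the metric `r_W` induces the standard topology of the sphere. -/
theorem rW_induces_standard_topology_on_sphere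
    (n : ℕ) (hn : 1 ≤ n) (F : ℝ → ℝ)
    (hFcont : ContinuousOn F (Set.Icc 0 Real.pi))
    (hFrange : ∀ t ∈ Set.Icc (0 : ℝ) Real.pi, F t ∈ Set.Icc (0 : ℝ) 1)
    (W : Metric.sphere (0 : EuclideanSpace ℝ (Fin (n + 1))) 1 →
      Metric.sphere (0 : EuclideanSpace ℝ (Fin (n + 1))) 1 → ℝ)
    (hWdef : ∀ x y, W x y = F (geodesic x y))
    (htwinfree : ∀ x y, rW (sphereUniform (n + 1)) W x y = 0 → x = y) :
    (∀ x : Metric.sphere (0 : EuclideanSpace ℝ (Fin (n + 1))) 1, ∀ ε > (0 : ℝ),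
      ∃ δ > (0 : ℝ), ∀ y, geodesic x y < δ → rW (sphereUniform (n + 1)) W x y < ε) ∧
    (∀ x : Metric.sphere (0 : EuclideanSpace ℝ (Fin (n + 1))) 1, ∀ ε > (0 : ℝ),
      ∃ δ > (0 : ℝ), ∀ y, rW (sphereUniform (n + 1)) W x y < δ → geodesic x y < ε) := by
  have hgc := geodesic_cont_aux (n + 1)
  have hWc := comp_cont_aux F _ hFcont geodesic W hgc geodesic_mem_aux hWdef
  have hfin := sphereUniform_finite (n + 1)
  have hrc := rW_cont_aux (sphereUniform (n + 1)) W hWc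
  have hgx := section_cont_aux geodesic hgc
  refine ⟨fun x ε hε => ?_, fun x ε hε => ?_⟩
  · refine compact_aux _ _ (hrc x) (hgx x) (fun y => (geodesic_mem_aux x y).1) ε (fun y hy => ?_)
    rw [← geodesic_eq_aux x y hy, rW_self_aux]
    exact hε
  · refine compact_aux _ _ (hgx x) (hrc x) (fun y => rW_nonneg_aux _ _ _ _) ε (fun y hy => ?_)
    rw [← htwinfree x y hy, geodesic_self_aux]
    exact hε
end
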